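/- (Atkinson's formula) Let 0 < A < A' be any two fixed constants. There is a constant C > 0 such that for all large T and any N with AT < N < A'T, putting N' = T/(2π) + N/2 − (N²/4 + NT/(2π))^{1/2}, one has |E(T) − Σ₁(T) − Σ₂(T)| ≤ C log² T, where Σ₁(T) = 2^{1/2} (T/(2π))^{1/4} Σ_{n ≤ N} (−1)^n d(n) n^{−3/4} e(T,n) cos(f(T,n)) and Σ₂(T) = −2 Σ_{n ≤ N'} d(n) n^{−1/2} (log(T/(2πn)))^{−1} cos(T log(T/(2πn)) − T + π/4), with f(T,n) = 2T·arsinh(√(πn/(2T))) + √(2πnT + π²n²) − π/4 and e(T,n) = (1 + πn/(2T))^{−1/4} · { (2T/(πn))^{1/2} arsinh(√(πn/(2T))) }^{−1}. -/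

import Mathlib

open Real MeasureTheory

/-- The error term in the mean square formula:
`E(T) = ∫_0^T |ζ(1/2+it)|² dt - T log(T/(2π)) - (2γ-1)T`. -/
noncomputable def E (T : ℝ) : ℝ :=
  (∫ t in (0:ℝ)..T, ‖riemannZeta (1 / 2 + Complex.I * (t : ℂ))‖ ^ 2) -
    T * Real.log (T / (2 * Real.pi)) - (2 * Real.eulerMascheroniConstant - 1) * T

/-- Atkinson's phase function `f(T,n) = 2T arsinh √(πn/(2T)) + √(2πnT + π²n²) - π/4`. -/
noncomputable def f (T : ℝ) (n : ℕ) : ℝ :=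
  2 * T * Real.arsinh (Real.sqrt (Real.pi * n / (2 * T))) +
    Real.sqrt (2 * Real.pi * n * T + Real.pi ^ 2 * n ^ 2) - Real.pi / 4

/-- Atkinson's amplitude function
`e(T,n) = (1 + πn/(2T))^{-1/4} {(2T/(πn))^{1/2} arsinh √(πn/(2T))}^{-1}`. -/
noncomputable def e (T : ℝ) (n : ℕ) : ℝ :=
  (1 + Real.pi * n / (2 * T)) ^ (-(1 / 4 : ℝ)) *
    ((2 * T / (Real.pi * n)) ^ ((1 : ℝ) / 2) * Real.arsinh (Real.sqrt (Real.pi * n / (2 * T))))⁻¹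

namespace Atk

/-- First derivative test. -/
theorem fdt {a b μ : ℝ} {A A1 φ φ1 φ2 : ℝ → ℝ} (hab : a ≤ b) (hμ : 0 < μ)
    (hA : ∀ x ∈ Set.Icc a b, HasDerivAt A (A1 x) x)
    (hφ : ∀ x ∈ Set.Icc a b, HasDerivAt φ (φ1 x) x)
    (hφ1 : ∀ x ∈ Set.Icc a b, HasDerivAt φ1 (φ2 x) x)
    (cA1 : ContinuousOn A1 (Set.Icc a b)) (cφ2 : ContinuousOn φ2 (Set.Icc a b))
    (A0 : ∀ x ∈ Set.Icc a b, 0 ≤ A x) (A1n : ∀ x ∈ Set.Icc a b, A1 x ≤ 0)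
    (φ2n : ∀ x ∈ Set.Icc a b, 0 ≤ φ2 x)
    (hs : (∀ x ∈ Set.Icc a b, μ ≤ φ1 x) ∨ (∀ x ∈ Set.Icc a b, φ1 x ≤ -μ)) :
    |∫ x in a..b, A x * sin (φ x)| ≤ 4 * A a / μ := by
  have hu : Set.uIcc a b = Set.Icc a b := Set.uIcc_of_le hab
  have ha : a ∈ Set.Icc a b := ⟨le_rfl, hab⟩
  have hb : b ∈ Set.Icc a b := ⟨hab, le_rfl⟩
  have habs : ∀ x ∈ Set.Icc a b, μ ≤ |φ1 x| := by
    intro x hx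
    rcases hs with h | h
    · exact (h x hx).trans (le_abs_self _)
    · have := h x hx
      rw [abs_of_nonpos (by linarith)]; linarith
  have hne : ∀ x ∈ Set.Icc a b, φ1 x ≠ 0 := by
    intro x hx h
    have := habs x hx
    rw [h, abs_zero] at this; linarith
  have cA : ContinuousOn A (Set.Icc a b) := fun x hx => (hA x hx).continuousAt.continuousWithinAt
  have cφ : ContinuousOn φ (Set.Icc a b) := fun x hx => (hφ x hx).continuousAt.continuousWithinAt
  have cφ1 : ContinuousOn φ1 (Set.Icc a b) :=
    fun x hx => (hφ1 x hx).continuousAt.continuousWithinAt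
  have Aanti : ∀ x ∈ Set.Icc a b, A x ≤ A a := by
    have : AntitoneOn A (Set.Icc a b) := by
      apply antitoneOn_of_deriv_nonpos (convex_Icc a b) cA
      · intro x hx
        exact (hA x (interior_subset hx)).differentiableAt.differentiableWithinAt
      · intro x hx
        rw [(hA x (interior_subset hx)).deriv]
        exact A1n x (interior_subset hx)
    intro x hx
    exact this ha hx hx.1
  let u : ℝ → ℝ := fun x => A x / φ1 x
  let u1 : ℝ → ℝ := fun x => (A1 x * φ1 x - A x * φ2 x) / φ1 x ^ 2
  have hud : ∀ x ∈ Set.uIcc a b, HasDerivAt u (u1 x) x := by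
    intro x hx
    rw [hu] at hx
    exact (hA x hx).div (hφ1 x hx) (hne x hx)
  have hvd : ∀ x ∈ Set.uIcc a b, HasDerivAt (fun x => - cos (φ x)) (φ1 x * sin (φ x)) x := by
    intro x hx
    rw [hu] at hx
    exact ((hφ x hx).cos).fun_neg.congr_deriv (by ring)
  have cu1 : ContinuousOn u1 (Set.Icc a b) := by
    apply ContinuousOn.div
    · exact (cA1.mul cφ1).sub (cA.mul cφ2)
    · exact cφ1.pow 2
    · intro x hx; exact pow_ne_zero 2 (hne x hx)
  have cv1 : ContinuousOn (fun x => φ1 x * sin (φ x)) (Set.Icc a b) :=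
    cφ1.mul (continuous_sin.comp_continuousOn cφ)
  have key := intervalIntegral.integral_mul_deriv_eq_deriv_mul hud hvd
    (by apply ContinuousOn.intervalIntegrable; rwa [hu])
    (by apply ContinuousOn.intervalIntegrable; rwa [hu])
  have e1 : ∫ x in a..b, A x * sin (φ x) = ∫ x in a..b, u x * (φ1 x * sin (φ x)) := by
    apply intervalIntegral.integral_congr
    intro x hx
    rw [hu] at hx
    have := hne x hx
    simp only [u]
    field_simp
  rw [e1, key]
  let W : ℝ → ℝ := fun x => - (A x / μ) - A a * (φ1 x)⁻¹
  let W1 : ℝ → ℝ := fun x => - (A1 x / μ) - A a * (-φ2 x / φ1 x ^ 2)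
  have hW : ∀ x ∈ Set.uIcc a b, HasDerivAt W (W1 x) x := by
    intro x hx
    rw [hu] at hx
    exact ((hA x hx).div_const μ).neg.sub (((hφ1 x hx).inv (hne x hx)).const_mul (A a))
  have cW1 : ContinuousOn W1 (Set.Icc a b) := by
    apply ContinuousOn.sub
    · exact (cA1.div_const μ).neg
    · apply ContinuousOn.mul continuousOn_const
      apply ContinuousOn.div cφ2.neg (cφ1.pow 2)
      intro x hx; exact pow_ne_zero 2 (hne x hx)
  have iW1 : IntervalIntegrable W1 volume a b := by
    apply ContinuousOn.intervalIntegrable; rwa [hu]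
  have hintg : ∫ x in a..b, W1 x = W b - W a :=
    intervalIntegral.integral_eq_sub_of_hasDerivAt hW iW1
  have hbd : ‖∫ x in a..b, u1 x * (- cos (φ x))‖ ≤ ∫ x in a..b, W1 x := by
    apply intervalIntegral.norm_integral_le_of_norm_le hab _ iW1
    refine Filter.Eventually.of_forall fun x hx' => ?_
    have hx : x ∈ Set.Icc a b := ⟨hx'.1.le, hx'.2⟩
    have h1 : |u1 x| ≤ W1 x := by
      have hsq : (0:ℝ) < φ1 x ^ 2 := by have := hne x hx; positivity
      have e : u1 x = A1 x / φ1 x - A x * (φ2 x / φ1 x ^ 2) := by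
        simp only [u1]; have := hne x hx; field_simp
      rw [e]
      calc |A1 x / φ1 x - A x * (φ2 x / φ1 x ^ 2)| ≤ |A1 x / φ1 x| + |A x * (φ2 x / φ1 x ^ 2)| :=
            abs_sub _ _
        _ ≤ -(A1 x / μ) + A a * (φ2 x / φ1 x ^ 2) := by
            apply add_le_add
            · rw [abs_div, abs_of_nonpos (A1n x hx), ← neg_div]
              exact div_le_div_of_nonneg_left (by linarith [A1n x hx]) hμ (habs x hx)
            · have : 0 ≤ φ2 x / φ1 x ^ 2 := div_nonneg (φ2n x hx) hsq.le
              rw [abs_of_nonneg (mul_nonneg (A0 x hx) this)]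
              exact mul_le_mul_of_nonneg_right (Aanti x hx) this
        _ = W1 x := by simp only [W1]; ring
    rw [norm_mul, Real.norm_eq_abs, norm_neg, Real.norm_eq_abs]
    calc |u1 x| * |cos (φ x)| ≤ |u1 x| * 1 :=
          mul_le_mul_of_nonneg_left (abs_cos_le_one _) (abs_nonneg _)
      _ ≤ W1 x := by simpa using h1
  rw [hintg, Real.norm_eq_abs] at hbd
  have invd : (φ1 a)⁻¹ - (φ1 b)⁻¹ ≤ μ⁻¹ := by
    rcases hs with h | h
    · have h1 := h a ha
      have h2 := h b hb
      have : (φ1 a)⁻¹ ≤ μ⁻¹ := inv_anti₀ hμ h1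
      have : 0 ≤ (φ1 b)⁻¹ := inv_nonneg.2 (by linarith)
      linarith
    · have h1 := h a ha
      have h2 := h b hb
      have h3 : (- φ1 b)⁻¹ ≤ μ⁻¹ := inv_anti₀ hμ (by linarith)
      have : (φ1 a)⁻¹ ≤ 0 := inv_nonpos.2 (by linarith)
      rw [inv_neg] at h3
      linarith
  have hu_b : ∀ x ∈ Set.Icc a b, |u x| ≤ A x / μ := by
    intro x hx
    simp only [u]
    rw [abs_div, abs_of_nonneg (A0 x hx)]
    exact div_le_div_of_nonneg_left (A0 x hx) hμ (habs x hx)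
  have t1 : |u b * -cos (φ b)| ≤ A b / μ := by
    rw [abs_mul, abs_neg]
    calc _ ≤ |u b| * 1 := mul_le_mul_of_nonneg_left (abs_cos_le_one _) (abs_nonneg _)
      _ ≤ _ := by simpa using hu_b b hb
  have t2 : |u a * -cos (φ a)| ≤ A a / μ := by
    rw [abs_mul, abs_neg]
    calc _ ≤ |u a| * 1 := mul_le_mul_of_nonneg_left (abs_cos_le_one _) (abs_nonneg _)
      _ ≤ _ := by simpa using hu_b a ha
  have t3 : W b - W a ≤ A a / μ - A b / μ + A a * μ⁻¹ := by
    have := mul_le_mul_of_nonneg_left invd (A0 a ha)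
    simp only [W]
    linarith
  have e4 : A a * μ⁻¹ = A a / μ := rfl
  have e5 : 4 * A a / μ = 4 * (A a / μ) := by ring
  have e6 : 0 ≤ A a / μ := div_nonneg (A0 a ha) hμ.le
  rw [e5]
  rw [abs_le] at *
  constructor <;> linarith [t1.1, t1.2, t2.1, t2.2, hbd.1, hbd.2]
end Atk

namespace Atk

theorem seg_ftc {F G : ℂ → ℂ} {S : Set ℂ} (hG : ∀ z ∈ S, HasDerivAt G (F z) z)
    (hF : ContinuousOn F S) {p v : ℂ} (hseg : ∀ x ∈ Set.Icc (0:ℝ) 1, p + x * v ∈ S) :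
    ∫ x in (0:ℝ)..1, F (p + x * v) * v = G (p + v) - G p := by
  have h01 : Set.uIcc (0:ℝ) 1 = Set.Icc 0 1 := Set.uIcc_of_le zero_le_one
  have := intervalIntegral.integral_eq_sub_of_hasDerivAt (a := 0) (b := 1)
    (f := fun x : ℝ => G (p + x * v)) (f' := fun x : ℝ => F (p + x * v) * v) ?_ ?_
  · simpa using this
  · intro x hx
    rw [h01] at hx
    have h1 : HasDerivAt (fun x : ℝ => p + (x:ℂ) * v) v x := by
      have := ((Complex.ofRealCLM.hasDerivAt (x := x)).mul_const v).const_add p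
      simpa using this
    exact (hG _ (hseg x hx)).comp_of_eq x h1 rfl |>.congr_deriv rfl
  · apply ContinuousOn.intervalIntegrable
    rw [h01]
    apply ContinuousOn.mul _ continuousOn_const
    apply hF.comp (by fun_prop)
    intro x hx; exact hseg x hx

theorem norm_cexp_sub_one_le (z : ℂ) : ‖Complex.exp z - 1‖ ≤ ‖z‖ * exp ‖z‖ := by
  simpa using Complex.norm_exp_sub_sum_le_norm_mul_exp z 1

theorem gauss_tail {lam : ℝ} (hl : 0 < lam) :
    |(∫ x in (0:ℝ)..1, exp (-lam * x ^ 2)) - √(π / lam) / 2| ≤ 1 / lam := by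
  have hi : Integrable (fun x : ℝ => exp (-lam * x ^ 2)) := integrable_exp_neg_mul_sq hl
  have h0 := integral_gaussian_Ioi lam
  have h1 : (∫ x in (0:ℝ)..1, exp (-lam * x ^ 2)) + ∫ x in Set.Ioi 1, exp (-lam * x ^ 2) =
      ∫ x in Set.Ioi 0, exp (-lam * x ^ 2) :=
    intervalIntegral.integral_interval_add_Ioi hi.integrableOn hi.integrableOn
  rw [h0] at h1
  have hI : IntegrableOn (fun x : ℝ => exp (-lam * x)) (Set.Ioi 1) := exp_neg_integrableOn_Ioi 1 hl
  have h2 : ∫ x in Set.Ioi (1:ℝ), exp (-lam * x ^ 2) ≤ ∫ x in Set.Ioi (1:ℝ), exp (-lam * x) := by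
    apply setIntegral_mono_on hi.integrableOn hI measurableSet_Ioi
    intro x hx
    apply exp_le_exp.2
    have : (1:ℝ) < x := hx
    have h5 : x ≤ x ^ 2 := by nlinarith
    have := mul_le_mul_of_nonneg_left h5 hl.le
    linarith
  have h3 : ∫ x in Set.Ioi (1:ℝ), exp (-lam * x) ≤ 1 / lam := by
    rw [integral_exp_mul_Ioi (by linarith)]
    rw [neg_div_neg_eq]
    apply div_le_div_of_nonneg_right _ hl.le
    apply exp_le_one_iff.2; linarith
  have h4 : 0 ≤ ∫ x in Set.Ioi (1:ℝ), exp (-lam * x ^ 2) :=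
    setIntegral_nonneg measurableSet_Ioi fun x _ => (exp_pos _).le
  rw [abs_le]
  constructor <;> linarith

theorem int_exp_le {k : ℝ} (hk : 0 < k) : ∫ x in (0:ℝ)..1, exp (-k * x) ≤ 1 / k := by
  have := intervalIntegral.integral_eq_sub_of_hasDerivAt (a := 0) (b := 1)
    (f := fun x : ℝ => -(exp (-k * x) / k)) (f' := fun x : ℝ => exp (-k * x)) ?_
    (Continuous.intervalIntegrable (by fun_prop) _ _)
  · rw [this]
    have : 0 ≤ exp (-k * 1) / k := by positivity
    simp at this ⊢; linarith
  · intro x _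
    have := ((((hasDerivAt_id x).const_mul (-k)).exp).div_const k).fun_neg
    refine this.congr_deriv ?_
    simp; field_simp

theorem int_x_exp_le {k : ℝ} (hk : 0 < k) : ∫ x in (0:ℝ)..1, x * exp (-k * x ^ 2) ≤ 1 / (2 * k) := by
  have := intervalIntegral.integral_eq_sub_of_hasDerivAt (a := 0) (b := 1)
    (f := fun x : ℝ => -(exp (-k * x ^ 2) / (2 * k))) (f' := fun x : ℝ => x * exp (-k * x ^ 2)) ?_
    (Continuous.intervalIntegrable (by fun_prop) _ _)
  · rw [this]
    have : 0 ≤ exp (-k * 1) / (2 * k) := by positivity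
    simp at this ⊢; linarith
  · intro x _
    have := ((((hasDerivAt_pow 2 x).const_mul (-k)).exp).div_const (2 * k)).fun_neg
    refine this.congr_deriv ?_
    simp; field_simp

theorem sp_half {A φ φ' : ℂ → ℂ} {lam a : ℝ} (hl : 0 < lam)
    (hA : DifferentiableOn ℂ A (Metric.ball 0 2))
    (hφ : ∀ z ∈ Metric.ball (0:ℂ) 2, HasDerivAt φ (φ' z) z)
    (hφ' : ∀ z ∈ Metric.ball (0:ℂ) 2, ‖φ' z - lam * z‖ ≤ lam / 8 * ‖z‖ ^ 2)
    (hAl : ∀ z ∈ Metric.ball (0:ℂ) 2, ‖A z - A 0‖ ≤ a * ‖z‖) (hA0 : ‖A 0‖ ≤ a)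
    (hre0 : (φ 0).im = 0) (hre : (φ 1).im = 0) :
    ‖(∫ x in (0:ℝ)..1, A x * Complex.exp (Complex.I * φ x)) -
      A 0 * Complex.exp (Complex.I * φ 0) * ((1 + Complex.I) * (√(π / lam) / 2 : ℝ))‖ ≤ 20 * a / lam := by
  have ha : 0 ≤ a := (norm_nonneg _).trans hA0
  set F : ℂ → ℂ := fun z => A z * Complex.exp (Complex.I * φ z) with hF
  have dφ : DifferentiableOn ℂ φ (Metric.ball 0 2) := fun z hz =>
    (hφ z hz).differentiableAt.differentiableWithinAt
  have dF : DifferentiableOn ℂ F (Metric.ball 0 2) :=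
    hA.mul ((dφ.const_mul Complex.I).cexp)
  obtain ⟨G, hG⟩ := dF.isExactOn_ball
  have cF := dF.continuousOn
  have sq2 : √2 ≤ 1.5 := by
    rw [Real.sqrt_le_left (by norm_num)]; norm_num
  have n1I : ‖(1 + Complex.I : ℂ)‖ = √2 := by
    rw [← Real.sqrt_sq (norm_nonneg _), Complex.sq_norm, Complex.normSq_apply]
    norm_num
  have inball : ∀ {z : ℂ}, ‖z‖ < 2 → z ∈ Metric.ball (0:ℂ) 2 := fun h => by simpa using h
  -- segments
  have s1 := seg_ftc hG cF (p := 0) (v := 1) (by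
    intro x hx; apply inball; simp; rw [abs_of_nonneg hx.1]; linarith [hx.2])
  have nv : ∀ x ∈ Set.Icc (0:ℝ) 1, ‖(1 + x * Complex.I : ℂ)‖ ^ 2 ≤ 2 := by
    intro x hx
    rw [Complex.sq_norm, Complex.normSq_apply]
    simp; nlinarith [hx.1, hx.2]
  have nv' : ∀ x ∈ Set.Icc (0:ℝ) 1, ‖(1 + x * Complex.I : ℂ)‖ < 2 := by
    intro x hx
    have := nv x hx
    nlinarith [norm_nonneg (1 + x * Complex.I : ℂ)]
  have s2 := seg_ftc hG cF (p := 1) (v := Complex.I) (by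
    intro x hx; exact inball (nv' x hx))
  have nd : ∀ x ∈ Set.Icc (0:ℝ) 1, ‖(x * (1 + Complex.I) : ℂ)‖ = x * √2 := by
    intro x hx
    rw [norm_mul, n1I, Complex.norm_real, Real.norm_of_nonneg hx.1]
  have nd' : ∀ x ∈ Set.Icc (0:ℝ) 1, (x * (1 + Complex.I) : ℂ) ∈ Metric.ball (0:ℂ) 2 := by
    intro x hx
    apply inball
    rw [nd x hx]
    have := mul_le_mul hx.2 sq2 (sqrt_nonneg _) zero_le_one
    linarith
  have s3 := seg_ftc hG cF (p := 0) (v := 1 + Complex.I) (by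
    intro x hx; simpa using nd' x hx)
  simp only [zero_add, mul_one] at s1 s3
  rw [s1]
  -- vertical part
  have him : ∀ x ∈ Set.Icc (0:ℝ) 1, 3 / 4 * lam * x ≤ (φ (1 + x * Complex.I)).im := by
    intro x hx
    have hder : ∀ y ∈ Set.Icc (0:ℝ) 1, HasDerivAt (fun y : ℝ => (φ (1 + y * Complex.I)).im - 3 / 4 * lam * y)
        ((φ' (1 + y * Complex.I)).re - 3 / 4 * lam) y := by
      intro y hy
      have h1 : HasDerivAt (fun x : ℝ => 1 + (x:ℂ) * Complex.I) Complex.I y := by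
        have := ((Complex.ofRealCLM.hasDerivAt (x := y)).mul_const Complex.I).const_add 1
        simpa using this
      have h2 := (hφ _ (inball (nv' y hy))).comp_of_eq y h1 rfl
      have h3 := (Complex.imCLM.hasFDerivAt.comp_hasDerivAt y h2)
      have h4 := h3.sub ((hasDerivAt_id y).const_mul (3 / 4 * lam))
      refine h4.congr_deriv ?_
      simp
    have mono : MonotoneOn (fun y : ℝ => (φ (1 + y * Complex.I)).im - 3 / 4 * lam * y) (Set.Icc 0 1) := by
      apply monotoneOn_of_deriv_nonneg (convex_Icc 0 1)
      · exact fun y hy => (hder y hy).continuousAt.continuousWithinAt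
      · exact fun y hy => (hder y (interior_subset hy)).differentiableAt.differentiableWithinAt
      · intro y hy
        have hy := interior_subset hy
        rw [(hder y hy).deriv]
        have h1 := hφ' _ (inball (nv' y hy))
        have h2 := (Complex.abs_re_le_norm _).trans h1
        have h3 := nv y hy
        rw [Complex.sub_re, abs_le] at h2
        have h4 : ((lam:ℂ) * (1 + y * Complex.I)).re = lam := by simp
        rw [h4] at h2
        nlinarith [h2.1]
    have := mono ⟨le_rfl, zero_le_one⟩ hx hx.1
    simp [hre] at this
    linarith
  have A3 : ∀ z ∈ Metric.ball (0:ℂ) 2, ‖A z‖ ≤ 3 * a := by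
    intro z hz
    have h1 := hAl z hz
    have h2 : ‖z‖ < 2 := by simpa using hz
    have h3 : ‖A z‖ ≤ ‖A z - A 0‖ + ‖A 0‖ := by
      simpa using norm_add_le (A z - A 0) (A 0)
    nlinarith
  have b2 : ‖G (1 + Complex.I) - G 1‖ ≤ 4 * a / lam := by
    rw [← s2]
    have hi : IntervalIntegrable (fun x : ℝ => 3 * a * exp (-(3 / 4 * lam) * x)) volume 0 1 :=
      Continuous.intervalIntegrable (by fun_prop) _ _
    have h1 := intervalIntegral.norm_integral_le_of_norm_le (zero_le_one (α := ℝ)) (f := fun x : ℝ =>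
      F (1 + x * Complex.I) * Complex.I) (g := fun x : ℝ => 3 * a * exp (-(3 / 4 * lam) * x)) (μ := volume) ?_ hi
    · refine h1.trans ?_
      rw [intervalIntegral.integral_const_mul]
      have := mul_le_mul_of_nonneg_left (int_exp_le (k := 3 / 4 * lam) (by positivity)) (by positivity : 0 ≤ 3 * a)
      refine this.trans (le_of_eq ?_)
      field_simp
    · refine Filter.Eventually.of_forall fun x hx' => ?_
      have hx : x ∈ Set.Icc (0:ℝ) 1 := ⟨hx'.1.le, hx'.2⟩
      simp only [hF, norm_mul, Complex.norm_I, mul_one, Complex.norm_exp]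
      apply mul_le_mul (A3 _ (inball (nv' x hx))) _ (exp_pos _).le (by positivity)
      apply exp_le_exp.2
      have := him x hx
      simp
      linarith
  -- diagonal part
  set B : ℂ := A 0 * Complex.exp (Complex.I * φ 0) with hB
  have nB : ‖B‖ ≤ a := by
    simpa [hB, Complex.norm_exp, hre0] using hA0
  have hR : ∀ z ∈ Metric.ball (0:ℂ) 2, ‖φ z - φ 0 - lam * z ^ 2 / 2‖ ≤ lam / 8 * ‖z‖ ^ 3 := by
    intro z hz
    have hsub : Metric.closedBall (0:ℂ) ‖z‖ ⊆ Metric.ball 0 2 :=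
      Metric.closedBall_subset_ball (by simpa using hz)
    have := (convex_closedBall (0:ℂ) ‖z‖).norm_image_sub_le_of_norm_hasDerivWithin_le
      (f := fun w => φ w - lam * w ^ 2 / 2) (f' := fun w => φ' w - lam * w) (C := lam / 8 * ‖z‖ ^ 2)
      (x := 0) (y := z) ?_ ?_ (by simp) (by simp)
    · simp only [sub_zero] at this
      convert this using 1
      · congr 1; simp; ring
      · ring
    · intro w hw
      have h1 := (hφ w (hsub hw)).sub (((hasDerivAt_pow 2 w).const_mul (lam:ℂ)).div_const 2)
      refine (h1.congr_deriv ?_).hasDerivWithinAt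
      simp; ring
    · intro w hw
      refine (hφ' w (hsub hw)).trans ?_
      have : ‖w‖ ≤ ‖z‖ := by simpa using hw
      gcongr
  have hdiag : ∀ x ∈ Set.Icc (0:ℝ) 1, ‖F (x * (1 + Complex.I)) - B * (exp (-lam * x ^ 2) : ℝ)‖ ≤
      2 * a * (x * exp (-(lam / 4) * x ^ 2)) := by
    intro x hx
    set z : ℂ := x * (1 + Complex.I) with hz
    have zb := nd' x hx
    have nz : ‖z‖ = x * √2 := nd x hx
    set R : ℂ := φ z - φ 0 - lam * z ^ 2 / 2 with hRd
    have h1 : ‖R‖ ≤ lam / 2 * x ^ 2 := by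
      refine (hR z zb).trans ?_
      rw [nz, mul_pow]
      have e1 : √2 ^ 3 = 2 * √2 := by
        rw [pow_succ, Real.sq_sqrt (by norm_num)]
      rw [e1]
      have : x ^ 3 ≤ x ^ 2 := by nlinarith [hx.1, hx.2, sq_nonneg x, mul_nonneg (sq_nonneg x) (sub_nonneg.2 hx.2)]
      have h3 : x ^ 3 * (2 * √2) ≤ x ^ 2 * 4 := by
        apply mul_le_mul this (by linarith) (by positivity) (by positivity)
      nlinarith
    have h1' : ‖R‖ ≤ lam / 2 * x ^ 3 := by
      refine (hR z zb).trans ?_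
      rw [nz, mul_pow]
      have e1 : √2 ^ 3 = 2 * √2 := by
        rw [pow_succ, Real.sq_sqrt (by norm_num)]
      rw [e1]
      have h0 : 0 ≤ x ^ 3 := pow_nonneg hx.1 3
      have h3 : x ^ 3 * (2 * √2) ≤ x ^ 3 * 4 := by
        apply mul_le_mul_of_nonneg_left (by linarith) h0
      nlinarith
    have ephi : Complex.exp (Complex.I * φ z) = Complex.exp (Complex.I * φ 0) *
        (exp (-lam * x ^ 2) : ℝ) * Complex.exp (Complex.I * R) := by
      push_cast
      rw [← Complex.exp_add, ← Complex.exp_add]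
      congr 1
      have e2 : z ^ 2 = 2 * Complex.I * x ^ 2 := by
        rw [hz]; ring_nf; rw [Complex.I_sq]; ring
      rw [hRd, e2]
      ring_nf; rw [Complex.I_sq]; ring
    have e3 : F z - B * (exp (-lam * x ^ 2) : ℝ) =
        (Complex.exp (Complex.I * φ 0) * (exp (-lam * x ^ 2) : ℝ)) *
        ((A z - A 0) * Complex.exp (Complex.I * R) + A 0 * (Complex.exp (Complex.I * R) - 1)) := by
      simp only [hF, hB]; rw [ephi]; ring
    rw [e3, norm_mul, norm_mul, Complex.norm_exp, Complex.norm_real]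
    have nIR : ‖Complex.I * R‖ = ‖R‖ := by simp
    have h4 : ‖Complex.exp (Complex.I * R)‖ ≤ exp (lam / 2 * x ^ 2) := by
      rw [Complex.norm_exp]
      apply exp_le_exp.2
      exact ((Complex.re_le_norm _).trans nIR.le).trans h1
    have h5 : ‖Complex.exp (Complex.I * R) - 1‖ ≤ lam / 2 * x ^ 3 * exp (lam / 2 * x ^ 2) := by
      refine (norm_cexp_sub_one_le _).trans ?_
      rw [nIR]
      exact mul_le_mul h1' (exp_le_exp.2 h1) (exp_pos _).le ((norm_nonneg _).trans h1')
    have h6 : ‖(A z - A 0) * Complex.exp (Complex.I * R) + A 0 * (Complex.exp (Complex.I * R) - 1)‖ ≤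
        (a * (x * √2)) * exp (lam / 2 * x ^ 2) + a * (lam / 2 * x ^ 3 * exp (lam / 2 * x ^ 2)) := by
      refine (norm_add_le _ _).trans ?_
      rw [norm_mul, norm_mul]
      apply add_le_add
      · have := hAl z zb
        rw [nz] at this
        exact mul_le_mul this h4 (norm_nonneg _) ((norm_nonneg _).trans this)
      · exact mul_le_mul hA0 h5 (norm_nonneg _) ha
    have h7 : exp (-lam * x ^ 2) * exp (lam / 2 * x ^ 2) = exp (-(lam / 4) * x ^ 2) * exp (-(lam / 4) * x ^ 2) := by
      rw [← exp_add, ← exp_add]; congr 1; ring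
    have h8 : (√2 + lam / 2 * x ^ 2) * exp (-(lam / 4) * x ^ 2) ≤ 2 := by
      have h9 : 1 + lam / 4 * x ^ 2 ≤ exp (lam / 4 * x ^ 2) := by
        have := add_one_le_exp (lam / 4 * x ^ 2); linarith
      have h10 : √2 + lam / 2 * x ^ 2 ≤ 2 * exp (lam / 4 * x ^ 2) := by linarith
      calc _ ≤ 2 * exp (lam / 4 * x ^ 2) * exp (-(lam / 4) * x ^ 2) := by gcongr
        _ = 2 := by rw [mul_assoc, ← exp_add]; simp
    simp only [Complex.mul_re, Complex.I_re, Complex.I_im, hre0]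
    simp only [zero_mul, one_mul, sub_zero, exp_zero, mul_zero]
    rw [Real.norm_of_nonneg (exp_pos _).le]
    calc exp (-lam * x ^ 2) * _ ≤ exp (-lam * x ^ 2) * _ := mul_le_mul_of_nonneg_left h6 (exp_pos _).le
      _ = a * x * (√2 + lam / 2 * x ^ 2) * (exp (-lam * x ^ 2) * exp (lam / 2 * x ^ 2)) := by ring
      _ = a * x * ((√2 + lam / 2 * x ^ 2) * exp (-(lam / 4) * x ^ 2)) * exp (-(lam / 4) * x ^ 2) := by
          rw [h7]; ring
      _ ≤ a * x * 2 * exp (-(lam / 4) * x ^ 2) := by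
          have := hx.1
          gcongr
      _ = _ := by ring
  have b3 : ‖(∫ x in (0:ℝ)..1, F (x * (1 + Complex.I))) - B * (∫ x in (0:ℝ)..1, exp (-lam * x ^ 2) : ℝ)‖ ≤
      4 * a / lam := by
    have i1 : IntervalIntegrable (fun x : ℝ => F (x * (1 + Complex.I))) volume 0 1 := by
      apply ContinuousOn.intervalIntegrable
      rw [Set.uIcc_of_le zero_le_one]
      apply cF.comp (by fun_prop)
      intro x hx; exact nd' x hx
    have i2 : IntervalIntegrable (fun x : ℝ => B * (exp (-lam * x ^ 2) : ℝ)) volume 0 1 :=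
      Continuous.intervalIntegrable (by fun_prop) _ _
    have e1 : B * ((∫ x in (0:ℝ)..1, exp (-lam * x ^ 2) : ℝ) : ℂ) =
        ∫ x in (0:ℝ)..1, B * ((exp (-lam * x ^ 2) : ℝ) : ℂ) := by
      rw [intervalIntegral.integral_const_mul, intervalIntegral.integral_ofReal]
    rw [e1, ← intervalIntegral.integral_sub i1 i2]
    have hi : IntervalIntegrable (fun x : ℝ => 2 * a * (x * exp (-(lam / 4) * x ^ 2))) volume 0 1 :=
      Continuous.intervalIntegrable (by fun_prop) _ _
    refine (intervalIntegral.norm_integral_le_of_norm_le (zero_le_one (α := ℝ)) ?_ hi).trans ?_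
    · exact Filter.Eventually.of_forall fun x hx' => hdiag x ⟨hx'.1.le, hx'.2⟩
    · rw [intervalIntegral.integral_const_mul]
      have := mul_le_mul_of_nonneg_left (int_x_exp_le (k := lam / 4) (by positivity)) (by positivity : 0 ≤ 2 * a)
      refine this.trans (le_of_eq ?_)
      field_simp
  rw [intervalIntegral.integral_mul_const] at s3
  have e5 : G 1 - G 0 - B * ((1 + Complex.I) * ((√(π / lam) / 2 : ℝ) : ℂ)) =
      -(G (1 + Complex.I) - G 1) + ((∫ x in (0:ℝ)..1, F (x * (1 + Complex.I))) -
        B * ((∫ x in (0:ℝ)..1, exp (-lam * x ^ 2) : ℝ) : ℂ)) * (1 + Complex.I) +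
      B * (1 + Complex.I) * (((∫ x in (0:ℝ)..1, exp (-lam * x ^ 2)) - √(π / lam) / 2 : ℝ) : ℂ) := by
    rw [sub_mul, s3]; push_cast; ring
  rw [e5]
  refine (norm_add_le _ _).trans ?_
  have t1 := norm_add_le (-(G (1 + Complex.I) - G 1)) (((∫ x in (0:ℝ)..1, F (x * (1 + Complex.I))) -
        B * ((∫ x in (0:ℝ)..1, exp (-lam * x ^ 2) : ℝ) : ℂ)) * (1 + Complex.I))
  rw [norm_neg, norm_mul _ (1 + Complex.I), n1I] at t1
  have t2 : ‖B * (1 + Complex.I) * (((∫ x in (0:ℝ)..1, exp (-lam * x ^ 2)) - √(π / lam) / 2 : ℝ) : ℂ)‖ ≤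
      a * 1.5 * (1 / lam) := by
    rw [norm_mul, norm_mul, n1I, Complex.norm_real, Real.norm_eq_abs]
    exact mul_le_mul (mul_le_mul nB sq2 (sqrt_nonneg _) ha) (gauss_tail hl) (abs_nonneg _) (by positivity)
  have t3 := mul_le_mul b3 sq2 (sqrt_nonneg _) (by positivity)
  have e6 : 20 * a / lam = 20 * (a / lam) := by ring
  have e7 : 4 * a / lam = 4 * (a / lam) := by ring
  have e8 : a * 1.5 * (1 / lam) = 1.5 * (a / lam) := by ring
  have e9 : 0 ≤ a / lam := by positivity
  rw [e6]; rw [e7] at b2 t3; rw [e8] at t2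
  linarith
end Atk

namespace Atk

theorem sp_one {Ac φc φ' : ℂ → ℂ} {A φ : ℝ → ℝ} {x0 v φ2 a : ℝ} (hv : v ≠ 0) (hφ2 : 0 < φ2) (ha : 0 < a)
    (hA : DifferentiableOn ℂ Ac (Metric.ball (x0:ℂ) (2 * |v|)))
    (hφ : ∀ z ∈ Metric.ball (x0:ℂ) (2 * |v|), HasDerivAt φc (φ' z) z)
    (hφ' : ∀ z ∈ Metric.ball (x0:ℂ) (2 * |v|), ‖φ' z - φ2 * (z - x0)‖ ≤ φ2 / (8 * |v|) * ‖z - x0‖ ^ 2)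
    (hAb : ∀ z ∈ Metric.ball (x0:ℂ) (2 * |v|), ‖Ac z‖ ≤ a)
    (rA : ∀ x : ℝ, |x - x0| ≤ |v| → Ac x = A x) (rφ : ∀ x : ℝ, |x - x0| ≤ |v| → φc x = φ x) :
    |(∫ x in (0:ℝ)..1, A (x0 + v * x) * sin (φ (x0 + v * x))) -
      A x0 * (√(π / (φ2 * v ^ 2)) / 2) * (sin (φ x0) + cos (φ x0))| ≤ 30 * a / (φ2 * v ^ 2) := by
  have hv' : 0 < |v| := abs_pos.2 hv
  have hb : ∀ z ∈ Metric.ball (0:ℂ) 2, (x0 + v * z : ℂ) ∈ Metric.ball (x0:ℂ) (2 * |v|) := by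
    intro z hz
    have : ‖z‖ < 2 := by simpa using hz
    simp only [Metric.mem_ball, dist_self_add_left, norm_mul, Complex.norm_real, Real.norm_eq_abs]
    nlinarith
  have hd : ∀ z : ℂ, HasDerivAt (fun z : ℂ => (x0 + v * z : ℂ)) (v:ℂ) z := by
    intro z
    simpa using ((hasDerivAt_id z).const_mul (v:ℂ)).const_add (x0:ℂ)
  have hl : 0 < φ2 * v ^ 2 := by positivity
  have hx0 : (x0:ℂ) ∈ Metric.ball (x0:ℂ) (2 * |v|) := Metric.mem_ball_self (by positivity)
  have hschwarz : ∀ z ∈ Metric.ball (x0:ℂ) (2 * |v|), ‖Ac z - Ac x0‖ ≤ 3 * a / (2 * |v|) * ‖z - x0‖ := by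
    intro z hz
    have := Complex.dist_le_div_mul_dist_of_mapsTo_ball (f := Ac) (c := x0) (R₁ := 2 * |v|) (R₂ := 3 * a)
      (z := z) hA ?_ hz
    · simpa [dist_eq_norm] using this
    · intro w hw
      have h1 := norm_sub_le (Ac w) (Ac x0)
      have h2 := hAb w hw
      have h3 := hAb x0 hx0
      rw [Metric.mem_closedBall, dist_eq_norm]
      linarith
  have r0 : φc x0 = φ x0 := rφ x0 (by simp)
  have key := sp_half (A := fun z => Ac (x0 + v * z)) (φ := fun z => φc (x0 + v * z))
    (φ' := fun z => φ' (x0 + v * z) * v) (lam := φ2 * v ^ 2) (a := 1.5 * a) hl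
    (hA.comp (fun z _ => (hd z).differentiableAt.differentiableWithinAt) (fun z hz => hb z hz))
    (fun z hz => (hφ _ (hb z hz)).comp z (hd z))
    (by
      intro z hz
      have h1 := hφ' _ (hb z hz)
      have e1 : φ' (x0 + v * z) * v - ((φ2 * v ^ 2 : ℝ) : ℂ) * z =
        v * (φ' (x0 + v * z) - φ2 * (x0 + v * z - x0)) := by push_cast; ring
      rw [e1, norm_mul, Complex.norm_real, Real.norm_eq_abs]
      refine (mul_le_mul_of_nonneg_left h1 hv'.le).trans (le_of_eq ?_)
      simp only [add_sub_cancel_left, norm_mul, Complex.norm_real, Real.norm_eq_abs, mul_pow, sq_abs]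
      field_simp)
    (by
      intro z hz
      have h1 := hschwarz _ (hb z hz)
      simp only [mul_zero, add_zero]
      refine h1.trans (le_of_eq ?_)
      simp only [add_sub_cancel_left, norm_mul, Complex.norm_real, Real.norm_eq_abs]
      field_simp; ring)
    (by simp only [mul_zero, add_zero]; linarith [hAb x0 hx0])
    (by simp [r0])
    (by
      have := rφ (x0 + v) (by simp)
      push_cast at this
      simp [this])
  simp only [mul_zero, add_zero] at key
  have e1 : ∫ x in (0:ℝ)..1, Ac (x0 + v * x) * Complex.exp (Complex.I * φc (x0 + v * x)) =
     ∫ x in (0:ℝ)..1, ((A (x0 + v * x) : ℝ) : ℂ) * Complex.exp (Complex.I * (φ (x0 + v * x) : ℝ)) := by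
    apply intervalIntegral.integral_congr
    intro x hx
    rw [Set.uIcc_of_le zero_le_one] at hx
    have h1 : |x0 + v * x - x0| ≤ |v| := by
      rw [add_sub_cancel_left, abs_mul, abs_of_nonneg hx.1]
      nlinarith [hx.2]
    have h2 := rA _ h1
    have h3 := rφ _ h1
    push_cast at h2 h3
    simp only [h2, h3]
  rw [e1] at key
  have cA : ContinuousOn (fun x : ℝ => Ac (x0 + v * x)) (Set.Icc 0 1) := by
    apply hA.continuousOn.comp (by fun_prop)
    intro x hx
    apply hb
    simp [abs_of_nonneg hx.1]; linarith [hx.2]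
  have cφ : ContinuousOn (fun x : ℝ => φc (x0 + v * x)) (Set.Icc 0 1) := by
    have : ContinuousOn φc (Metric.ball (x0:ℂ) (2 * |v|)) := fun z hz => (hφ z hz).continuousAt.continuousWithinAt
    apply this.comp (by fun_prop)
    intro x hx
    apply hb
    simp [abs_of_nonneg hx.1]; linarith [hx.2]
  have hintg : IntervalIntegrable (fun x : ℝ => ((A (x0 + v * x) : ℝ) : ℂ) * Complex.exp (Complex.I * (φ (x0 + v * x) : ℝ))) volume 0 1 := by
    have : ContinuousOn (fun x : ℝ => Ac (x0 + v * x) * Complex.exp (Complex.I * φc (x0 + v * x))) (Set.Icc 0 1) :=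
      cA.mul ((cφ.const_smul Complex.I).cexp)
    apply ContinuousOn.intervalIntegrable
    rw [Set.uIcc_of_le zero_le_one]
    apply this.congr
    intro x hx
    have h1 : |x0 + v * x - x0| ≤ |v| := by
      rw [add_sub_cancel_left, abs_mul, abs_of_nonneg hx.1]
      nlinarith [hx.2]
    have h2 := rA _ h1
    have h3 := rφ _ h1
    push_cast at h2 h3
    simp only [h2, h3]
  have key2 := (Complex.abs_im_le_norm _).trans key
  have e2 : (∫ x in (0:ℝ)..1, ((A (x0 + v * x) : ℝ) : ℂ) * Complex.exp (Complex.I * (φ (x0 + v * x) : ℝ))).im =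
      ∫ x in (0:ℝ)..1, A (x0 + v * x) * sin (φ (x0 + v * x)) := by
    have := (Complex.imCLM.intervalIntegral_comp_comm hintg)
    simp only [Complex.imCLM_apply] at this
    rw [← this]
    apply intervalIntegral.integral_congr
    intro x _
    simp only [Complex.im_ofReal_mul]
    rw [mul_comm Complex.I, Complex.exp_ofReal_mul_I_im]
  rw [Complex.sub_im, e2, rA x0 (by simp), r0, mul_comm Complex.I, Complex.exp_mul_I,
    ← Complex.ofReal_cos, ← Complex.ofReal_sin] at key2
  have e3 : ((A x0 : ℂ) * ((cos (φ x0) : ℝ) + (sin (φ x0) : ℝ) * Complex.I) * ((1 + Complex.I) * ((√(π / (φ2 * v ^ 2)) / 2 : ℝ) : ℂ))).im =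
     A x0 * (√(π / (φ2 * v ^ 2)) / 2) * (sin (φ x0) + cos (φ x0)) := by
    simp only [Complex.mul_im, Complex.mul_re, Complex.add_im, Complex.add_re, Complex.ofReal_re, Complex.ofReal_im,
      Complex.I_re, Complex.I_im, Complex.one_re, Complex.one_im]
    ring
  rw [e3] at key2
  refine key2.trans (le_of_eq ?_)
  ring

theorem sp {Ac φc φ' : ℂ → ℂ} {A φ : ℝ → ℝ} {x0 δ φ2 a : ℝ} (hδ : 0 < δ) (hφ2 : 0 < φ2) (ha : 0 < a)
    (hA : DifferentiableOn ℂ Ac (Metric.ball (x0:ℂ) (2 * δ)))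
    (hφ : ∀ z ∈ Metric.ball (x0:ℂ) (2 * δ), HasDerivAt φc (φ' z) z)
    (hφ' : ∀ z ∈ Metric.ball (x0:ℂ) (2 * δ), ‖φ' z - φ2 * (z - x0)‖ ≤ φ2 / (8 * δ) * ‖z - x0‖ ^ 2)
    (hAb : ∀ z ∈ Metric.ball (x0:ℂ) (2 * δ), ‖Ac z‖ ≤ a)
    (rA : ∀ x : ℝ, |x - x0| ≤ δ → Ac x = A x) (rφ : ∀ x : ℝ, |x - x0| ≤ δ → φc x = φ x)
    (cA : ContinuousOn A (Set.Icc (x0 - δ) (x0 + δ))) (cφ : ContinuousOn φ (Set.Icc (x0 - δ) (x0 + δ))) :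
    |(∫ x in (x0 - δ)..(x0 + δ), A x * sin (φ x)) -
      A x0 * √(2 * π / φ2) * sin (φ x0 + π / 4)| ≤ 60 * a / (φ2 * δ) := by
  have habs : |δ| = δ := abs_of_pos hδ
  have habs' : |-δ| = δ := by rw [abs_neg, habs]
  have k1 := sp_one (v := δ) (Ac := Ac) (φc := φc) (φ' := φ') (A := A) (φ := φ) (x0 := x0) (φ2 := φ2) (a := a)
    hδ.ne' hφ2 ha (by rwa [habs]) (by rwa [habs]) (by rwa [habs])
    (by rwa [habs]) (by rwa [habs]) (by rwa [habs])
  have k2 := sp_one (v := -δ) (Ac := Ac) (φc := φc) (φ' := φ') (A := A) (φ := φ) (x0 := x0) (φ2 := φ2) (a := a)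
    (neg_ne_zero.2 hδ.ne') hφ2 ha (by rwa [habs']) (by rwa [habs']) (by rwa [habs'])
    (by rwa [habs']) (by rwa [habs']) (by rwa [habs'])
  have j1 := intervalIntegral.smul_integral_comp_add_mul (a := 0) (b := 1) (fun x => A x * sin (φ x)) δ x0
  have j2 := intervalIntegral.smul_integral_comp_add_mul (a := 0) (b := 1) (fun x => A x * sin (φ x)) (-δ) x0
  simp only [smul_eq_mul, mul_zero, add_zero, mul_one] at j1 j2
  have cc : ContinuousOn (fun x => A x * sin (φ x)) (Set.Icc (x0 - δ) (x0 + δ)) :=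
    cA.mul (continuous_sin.comp_continuousOn cφ)
  have hsum : (∫ x in (x0 - δ)..(x0 + δ), A x * sin (φ x)) =
     δ * (∫ x in (0:ℝ)..1, A (x0 + δ * x) * sin (φ (x0 + δ * x))) +
     δ * (∫ x in (0:ℝ)..1, A (x0 + -δ * x) * sin (φ (x0 + -δ * x))) := by
    rw [j1]
    have : δ * (∫ x in (0:ℝ)..1, A (x0 + -δ * x) * sin (φ (x0 + -δ * x))) = ∫ x in (x0 + -δ)..x0, A x * sin (φ x) := by
      rw [intervalIntegral.integral_symm (a := x0) (b := x0 + -δ), ← j2]; ring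
    rw [this, add_comm (∫ x in x0..x0 + δ, A x * sin (φ x)), ← sub_eq_add_neg]
    symm
    apply intervalIntegral.integral_add_adjacent_intervals
    · apply ContinuousOn.intervalIntegrable
      rw [Set.uIcc_of_le (by linarith)]
      exact cc.mono (Set.Icc_subset_Icc le_rfl (by linarith))
    · apply ContinuousOn.intervalIntegrable
      rw [Set.uIcc_of_le (by linarith)]
      exact cc.mono (Set.Icc_subset_Icc (by linarith) le_rfl)
  rw [neg_sq] at k2
  have e1 : A x0 * √(2 * π / φ2) * sin (φ x0 + π / 4) =
     2 * (δ * (A x0 * (√(π / (φ2 * δ ^ 2)) / 2) * (sin (φ x0) + cos (φ x0)))) := by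
    rw [sin_add, cos_pi_div_four, sin_pi_div_four]
    have h1 : √(π / (φ2 * δ ^ 2)) = √(π / φ2) / δ := by
      rw [← div_div, Real.sqrt_div' _ (by positivity), Real.sqrt_sq hδ.le]
    have h2 : √(2 * π / φ2) = √2 * √(π / φ2) := by
      rw [mul_div_assoc, Real.sqrt_mul (by norm_num)]
    rw [h1, h2]
    have h3 : √2 * √2 = 2 := Real.mul_self_sqrt (by norm_num)
    field_simp
    linear_combination (A x0 * (sin (φ x0) + cos (φ x0))) * h3
  rw [hsum, e1]
  have e2 : 60 * a / (φ2 * δ) = 2 * (δ * (30 * a / (φ2 * δ ^ 2))) := by field_simp; norm_num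
  rw [e2]
  rw [abs_le] at k1 k2 ⊢
  have := mul_le_mul_of_nonneg_left k1.1 hδ.le
  have := mul_le_mul_of_nonneg_left k1.2 hδ.le
  have := mul_le_mul_of_nonneg_left k2.1 hδ.le
  have := mul_le_mul_of_nonneg_left k2.2 hδ.le
  constructor <;> linarith
end Atk

namespace Atk

/-- Data for the abstract oscillating sums. -/
structure Osc (A A1 A2 ℓ g g1 : ℝ → ℝ) (α B a : ℝ) : Prop where
  hα : 0 < α
  ha : 1 ≤ a
  dA : ∀ x, α ≤ x → HasDerivAt A (A1 x) x
  dA1 : ∀ x, α ≤ x → HasDerivAt A1 (A2 x) x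
  cA2 : ContinuousOn A2 (Set.Ici α)
  A0 : ∀ x, α ≤ x → 0 ≤ A x
  Aa : ∀ x, α ≤ x → A x ≤ a
  A1n : ∀ x, α ≤ x → A1 x ≤ 0
  A1a : ∀ x, α ≤ x → |A1 x| ≤ a
  A2a : ∀ x, α ≤ x → |A2 x| ≤ a
  dl : ∀ x, α ≤ x → HasDerivAt ℓ (g x) x
  dg : ∀ x, α ≤ x → HasDerivAt g (g1 x) x
  cg1 : ContinuousOn g1 (Set.Ici α)
  g0 : ∀ x, α ≤ x → 0 < g x
  ga : ∀ x, α ≤ x → g x ≤ a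
  g1n : ∀ x, α ≤ x → g1 x ≤ 0
  g1a : ∀ x, α ≤ x → |g1 x| ≤ a
  g1l : ∀ x, α ≤ x → x ≤ B → g1 x ≤ - (1 / a)

namespace Osc
variable {A A1 A2 ℓ g g1 : ℝ → ℝ} {α B a : ℝ}

theorem anti (H : Osc A A1 A2 ℓ g g1 α B a) {x y : ℝ} (hx : α ≤ x) (hxy : x ≤ y) : g y ≤ g x := by
  have : AntitoneOn g (Set.Ici α) := by
    apply antitoneOn_of_deriv_nonpos (convex_Ici α)
    · exact fun x hx => (H.dg x hx).continuousAt.continuousWithinAt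
    · exact fun x hx => (H.dg x (interior_subset hx)).differentiableAt.differentiableWithinAt
    · intro x hx
      rw [(H.dg x (interior_subset hx)).deriv]
      exact H.g1n x (interior_subset hx)
  exact this hx (hx.trans hxy) hxy

theorem strict (H : Osc A A1 A2 ℓ g g1 α B a) {x y : ℝ} (hx : α ≤ x) (hxy : x ≤ y) (hy : y ≤ B) :
    (y - x) / a ≤ g x - g y := by
  have ha := H.ha
  have : AntitoneOn (fun x => g x + x / a) (Set.Icc α B) := by
    have hd : ∀ x, α ≤ x → HasDerivAt (fun x => g x + x / a) (g1 x + 1 / a) x := by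
      intro x hx
      exact (H.dg x hx).add ((hasDerivAt_id x).div_const a)
    apply antitoneOn_of_deriv_nonpos (convex_Icc α B)
    · exact fun x hx => (hd x hx.1).continuousAt.continuousWithinAt
    · exact fun x hx => (hd x (interior_subset hx).1).differentiableAt.differentiableWithinAt
    · intro x hx
      have hx := interior_subset hx
      rw [(hd x hx.1).deriv]
      linarith [H.g1l x hx.1 hx.2]
  have := this ⟨hx, hxy.trans hy⟩ ⟨hx.trans hxy, hy⟩ hxy
  simp only at this
  rw [sub_div]; linarith

theorem fdt_use (H : Osc A A1 A2 ℓ g g1 α B a) {T ν μ x y : ℝ} (hT : 0 < T) (hμ : 0 < μ)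
    (hx : α ≤ x) (hxy : x ≤ y)
    (hs : μ ≤ ν - T * g x ∨ ν - T * g y ≤ -μ) :
    |∫ t in x..y, A t * sin (ν * t - T * ℓ t)| ≤ 4 * a / μ := by
  have hm : ∀ t ∈ Set.Icc x y, α ≤ t := fun t ht => hx.trans ht.1
  have := fdt (A := A) (A1 := A1) (φ := fun t => ν * t - T * ℓ t) (φ1 := fun t => ν - T * g t)
    (φ2 := fun t => - (T * g1 t)) hxy hμ (fun t ht => H.dA t (hm t ht))
    (fun t ht => by
      exact (((hasDerivAt_id t).const_mul ν).sub ((H.dl t (hm t ht)).const_mul T)).congr_deriv (by simp))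
    (fun t ht => by
      simpa using ((H.dg t (hm t ht)).const_mul T).const_sub ν)
    (fun t ht => (H.dA1 t (hm t ht)).continuousAt.continuousWithinAt)
    ((continuousOn_const.mul (H.cg1.mono fun t ht => hm t ht)).neg)
    (fun t ht => H.A0 t (hm t ht)) (fun t ht => H.A1n t (hm t ht))
    (fun t ht => by
      have := H.g1n t (hm t ht)
      nlinarith)
    (by
      rcases hs with h | h
      · left; intro t ht
        have := mul_le_mul_of_nonneg_left (H.anti hx ht.1) hT.le
        linarith
      · right; intro t ht
        have := mul_le_mul_of_nonneg_left (H.anti (hm t ht) ht.2) hT.le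
        linarith)
  refine this.trans ?_
  have := H.Aa x hx
  gcongr

theorem contint (H : Osc A A1 A2 ℓ g g1 α B a) (T ν : ℝ) :
    ContinuousOn (fun t => A t * sin (ν * t - T * ℓ t)) (Set.Ici α) := by
  apply ContinuousOn.mul
  · exact fun x hx => (H.dA x hx).continuousAt.continuousWithinAt
  · apply continuous_sin.comp_continuousOn
    apply ContinuousOn.sub (by fun_prop)
    apply continuousOn_const.mul
    exact fun x hx => (H.dl x hx).continuousAt.continuousWithinAt

theorem intble (H : Osc A A1 A2 ℓ g g1 α B a) (T ν : ℝ) {x y : ℝ} (hx : α ≤ x) (hy : α ≤ y) :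
    IntervalIntegrable (fun t => A t * sin (ν * t - T * ℓ t)) volume x y := by
  apply ContinuousOn.intervalIntegrable
  apply (H.contint T ν).mono
  intro t ht
  exact (le_min hx hy).trans ht.1

theorem trivbd (H : Osc A A1 A2 ℓ g g1 α B a) (T ν : ℝ) {x y : ℝ} (hx : α ≤ x) (hxy : x ≤ y) :
    |∫ t in x..y, A t * sin (ν * t - T * ℓ t)| ≤ a * (y - x) := by
  have := intervalIntegral.norm_integral_le_of_norm_le_const (a := x) (b := y) (C := a)
    (f := fun t => A t * sin (ν * t - T * ℓ t)) ?_
  · rwa [abs_of_nonneg (by linarith), Real.norm_eq_abs] at this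
  · intro t ht
    rw [Set.uIoc_of_le hxy] at ht
    have h1 : α ≤ t := hx.trans ht.1.le
    rw [Real.norm_eq_abs, abs_mul, abs_of_nonneg (H.A0 t h1)]
    have := mul_le_mul (H.Aa t h1) (abs_sin_le_one (ν * t - T * ℓ t)) (abs_nonneg _) (by linarith [H.ha])
    linarith

theorem plus (H : Osc A A1 A2 ℓ g g1 α B a) {T ν x y : ℝ} (hT : 0 < T) (hν : 0 < ν)
    (hx : α ≤ x) (hxy : x ≤ y) :
    |∫ t in x..y, A t * sin (ν * t + T * ℓ t)| ≤ 4 * a / ν := by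
  have hm : ∀ t ∈ Set.Icc x y, α ≤ t := fun t ht => hx.trans ht.1
  have := fdt (A := A) (A1 := A1) (φ := fun t => -(ν * t + T * ℓ t)) (φ1 := fun t => -(ν + T * g t))
    (φ2 := fun t => - (T * g1 t)) hxy hν (fun t ht => H.dA t (hm t ht))
    (fun t ht => by
      exact (((hasDerivAt_id t).const_mul ν).add ((H.dl t (hm t ht)).const_mul T)).neg.congr_deriv (by simp))
    (fun t ht => by
      exact (((H.dg t (hm t ht)).const_mul T).const_add ν).neg)
    (fun t ht => (H.dA1 t (hm t ht)).continuousAt.continuousWithinAt)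
    ((continuousOn_const.mul (H.cg1.mono fun t ht => hm t ht)).neg)
    (fun t ht => H.A0 t (hm t ht)) (fun t ht => H.A1n t (hm t ht))
    (fun t ht => by
      have := H.g1n t (hm t ht)
      nlinarith)
    (by
      right; intro t ht
      have := mul_pos hT (H.g0 t (hm t ht))
      linarith)
  simp only [sin_neg, mul_neg, intervalIntegral.integral_neg, abs_neg] at this
  refine this.trans ?_
  have := H.Aa x hx
  gcongr

theorem right (H : Osc A A1 A2 ℓ g g1 α B a) {T ν b Z : ℝ} (hT : 1 ≤ T)
    (hb : α ≤ b) (hbZ : b ≤ Z) (hB : b + 1 ≤ B) (hν : T * g b ≤ ν) :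
    |∫ t in b..Z, A t * sin (ν * t - T * ℓ t)| ≤ 5 * a ^ 2 / √T ∧
    |∫ t in b..Z, A t * sin (ν * t - T * ℓ t)| * (ν - T * g b) ≤ 5 * a ^ 2 := by
  have ha := H.ha
  have hT0 : 0 < T := by linarith
  have hsT : 1 ≤ √T := by rwa [Real.one_le_sqrt]
  have hsT0 : 0 < √T := by linarith
  have haa : a ≤ a ^ 2 := by nlinarith
  constructor
  · set τ := 1 / √T with hτ
    have hτ0 : 0 < τ := by positivity
    have hτ1 : τ ≤ 1 := by rw [hτ, div_le_one hsT0]; exact hsT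
    have e5 : 5 * a ^ 2 / √T = 5 * a ^ 2 * τ := by rw [hτ]; ring
    rw [e5]
    rcases le_total Z (b + τ) with h | h
    · refine (H.trivbd T ν hb hbZ).trans ?_
      have : a * (Z - b) ≤ a * τ := by gcongr; linarith
      have : a * τ ≤ a ^ 2 * τ := by gcongr
      have : 0 ≤ a ^ 2 * τ := by positivity
      linarith
    · have hbt : α ≤ b + τ := by linarith
      have h1 := H.trivbd T ν hb (y := b + τ) (by linarith)
      have h2 := H.fdt_use (T := T) (ν := ν) (μ := √T / a) (x := b + τ) (y := Z) hT0 (by positivity) hbt h (by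
        left
        have h3 := H.strict hb (y := b + τ) (by linarith) (by linarith)
        have h4 := mul_le_mul_of_nonneg_left h3 hT0.le
        have e1 : T * ((b + τ - b) / a) = √T / a := by
          have : T = √T * √T := (Real.mul_self_sqrt hT0.le).symm
          rw [add_sub_cancel_left, hτ]
          field_simp
          nlinarith
        rw [e1] at h4
        linarith)
      rw [← intervalIntegral.integral_add_adjacent_intervals (H.intble T ν hb hbt) (H.intble T ν hbt (hbt.trans h))]
      refine (abs_add_le _ _).trans ?_
      have e2 : 4 * a / (√T / a) = 4 * a ^ 2 * τ := by rw [hτ]; field_simp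
      rw [e2] at h2
      rw [add_sub_cancel_left] at h1
      have : a * τ ≤ a ^ 2 * τ := by gcongr
      linarith
  · rcases hν.eq_or_lt with h | h
    · rw [h, sub_self, mul_zero]; positivity
    · have h0 : 0 < ν - T * g b := by linarith
      have h2 := H.fdt_use (T := T) (ν := ν) (μ := ν - T * g b) (x := b) (y := Z) hT0 h0 hb hbZ (Or.inl le_rfl)
      rw [le_div_iff₀ h0] at h2
      nlinarith

theorem left (H : Osc A A1 A2 ℓ g g1 α B a) {T ν b : ℝ} (hT : 1 ≤ T)
    (hb : α ≤ b) (hB : b ≤ B) (hν : ν ≤ T * g b) :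
    |∫ t in α..b, A t * sin (ν * t - T * ℓ t)| ≤ 5 * a ^ 2 / √T ∧
    |∫ t in α..b, A t * sin (ν * t - T * ℓ t)| * (T * g b - ν) ≤ 5 * a ^ 2 := by
  have ha := H.ha
  have hT0 : 0 < T := by linarith
  have hsT : 1 ≤ √T := by rwa [Real.one_le_sqrt]
  have hsT0 : 0 < √T := by linarith
  have haa : a ≤ a ^ 2 := by nlinarith
  constructor
  · set τ := 1 / √T with hτ
    have hτ0 : 0 < τ := by positivity
    have e5 : 5 * a ^ 2 / √T = 5 * a ^ 2 * τ := by rw [hτ]; ring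
    rw [e5]
    rcases le_total (b - τ) α with h | h
    · refine (H.trivbd T ν le_rfl hb).trans ?_
      have : a * (b - α) ≤ a * τ := by gcongr; linarith
      have : a * τ ≤ a ^ 2 * τ := by gcongr
      have : 0 ≤ a ^ 2 * τ := by positivity
      linarith
    · have h1 := H.trivbd T ν h (y := b) (by linarith)
      have h2 := H.fdt_use (T := T) (ν := ν) (μ := √T / a) (x := α) (y := b - τ) hT0 (by positivity) le_rfl h (by
        right
        have h3 := H.strict h (y := b) (by linarith) (by linarith)
        have h4 := mul_le_mul_of_nonneg_left h3 hT0.le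
        have e1 : T * ((b - (b - τ)) / a) = √T / a := by
          have : T = √T * √T := (Real.mul_self_sqrt hT0.le).symm
          rw [sub_sub_cancel, hτ]
          field_simp
          nlinarith
        rw [e1] at h4
        linarith)
      rw [← intervalIntegral.integral_add_adjacent_intervals (H.intble T ν le_rfl h) (H.intble T ν h hb)]
      refine (abs_add_le _ _).trans ?_
      have e2 : 4 * a / (√T / a) = 4 * a ^ 2 * τ := by rw [hτ]; field_simp
      rw [e2] at h2
      rw [sub_sub_cancel] at h1
      have : a * τ ≤ a ^ 2 * τ := by gcongr
      linarith
  · rcases hν.eq_or_lt with h | h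
    · rw [h, sub_self, mul_zero]; positivity
    · have h0 : 0 < T * g b - ν := by linarith
      have h2 := H.fdt_use (T := T) (ν := ν) (μ := T * g b - ν) (x := α) (y := b) hT0 h0 le_rfl hb (Or.inr (by linarith))
      rw [le_div_iff₀ h0] at h2
      nlinarith

theorem full (H : Osc A A1 A2 ℓ g g1 α B a) {T ν Z x0 δ μ m ε : ℝ} (hT : 0 < T) (hμ : 0 < μ)
    (hδ : 0 ≤ δ) (h1 : α ≤ x0 - δ) (h2 : x0 + δ ≤ Z)
    (hl : ν - T * g (x0 - δ) ≤ -μ) (hr : μ ≤ ν - T * g (x0 + δ))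
    (hm : |(∫ t in (x0 - δ)..(x0 + δ), A t * sin (ν * t - T * ℓ t)) - m| ≤ ε) :
    |(∫ t in α..Z, A t * sin (ν * t - T * ℓ t)) - m| ≤ ε + 8 * a / μ := by
  have i1 := H.fdt_use (T := T) (ν := ν) hT hμ le_rfl h1 (Or.inr hl)
  have i2 := H.fdt_use (T := T) (ν := ν) hT hμ (x := x0 + δ) (by linarith) h2 (Or.inl hr)
  rw [← intervalIntegral.integral_add_adjacent_intervals (H.intble T ν le_rfl h1)
    (H.intble T ν h1 (by linarith : α ≤ Z)),
    ← intervalIntegral.integral_add_adjacent_intervals (a := x0 - δ) (H.intble T ν h1 (by linarith : α ≤ x0 + δ))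
    (H.intble T ν (by linarith) (by linarith))]
  have e : 8 * a / μ = 4 * a / μ + 4 * a / μ := by ring
  rw [e]
  rw [abs_le] at *
  constructor <;> linarith [i1.1, i1.2, i2.1, i2.2, hm.1, hm.2]
end Osc
end Atk

namespace Atk

/-- sawtooth -/
noncomputable def psi (t : ℝ) : ℝ := Int.fract t - 1 / 2
/-- its primitive, half of the second periodic Bernoulli function -/
noncomputable def Psi (t : ℝ) : ℝ := (Int.fract t ^ 2 - Int.fract t + 1 / 6) / 2
noncomputable def psiL (L : ℕ) (t : ℝ) : ℝ := - ∑ l ∈ Finset.Icc 1 L, sin (2 * π * l * t) / (π * l)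
noncomputable def PsiL (L : ℕ) (t : ℝ) : ℝ := ∑ l ∈ Finset.Icc 1 L, cos (2 * π * l * t) / (2 * π ^ 2 * l ^ 2)

theorem Psi_cont : Continuous Psi := by
  have := ContinuousOn.comp_fract'' (α := ℝ) (f := fun x : ℝ => (x ^ 2 - x + 1 / 6) / 2) (by fun_prop) (by norm_num)
  exact this

theorem psi_abs (t : ℝ) : |psi t| ≤ 1 / 2 := by
  unfold psi
  have := Int.fract_nonneg t
  have := Int.fract_lt_one t
  rw [abs_le]; constructor <;> linarith

theorem psi_meas : Measurable psi := by
  unfold psi; fun_prop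

theorem psi_int (a b : ℝ) : IntervalIntegrable psi volume a b := by
  apply IntervalIntegrable.mono_fun (g := psi) (f := fun _ => (1/2:ℝ)) (by simp) psi_meas.aestronglyMeasurable
  refine Filter.Eventually.of_forall fun t => ?_
  simpa [abs_of_pos] using psi_abs t

theorem Psi_deriv (x : ℝ) : HasDerivWithinAt Psi (psi x) (Set.Ioi x) x := by
  have h1 : HasDerivAt (fun t : ℝ => ((t - ⌊x⌋) ^ 2 - (t - ⌊x⌋) + 1 / 6) / 2) (psi x) x := by
    have h0 : HasDerivAt (fun t : ℝ => t - (⌊x⌋:ℝ)) 1 x := (hasDerivAt_id x).sub_const _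
    have := (((h0.pow 2).sub h0).add_const (1/6)).div_const 2
    refine this.congr_deriv ?_
    rw [psi, ← Int.self_sub_floor]; norm_num; ring
  refine h1.hasDerivWithinAt.congr_of_eventuallyEq ?_ ?_
  · have : Set.Iio ((⌊x⌋:ℝ) + 1) ∈ nhdsWithin x (Set.Ioi x) :=
      mem_nhdsWithin_of_mem_nhds (Iio_mem_nhds (Int.lt_floor_add_one x))
    filter_upwards [this, self_mem_nhdsWithin] with t ht ht'
    have : ⌊t⌋ = ⌊x⌋ := by
      rw [Int.floor_eq_iff]
      exact ⟨(Int.floor_le x).trans (le_of_lt ht'), ht⟩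
    rw [Psi, ← Int.self_sub_floor, this]
  · rw [Psi, ← Int.self_sub_floor]

theorem PsiL_deriv (L : ℕ) (x : ℝ) : HasDerivAt (PsiL L) (psiL L x) x := by
  unfold PsiL psiL
  rw [← Finset.sum_neg_distrib]
  apply HasDerivAt.fun_sum
  intro l hl
  have hl0 : (l:ℝ) ≠ 0 := by
    have := (Finset.mem_Icc.1 hl).1; positivity
  have h0 : HasDerivAt (fun t : ℝ => 2 * π * l * t) (2 * π * l) x := by
    simpa using (hasDerivAt_id x).const_mul (2 * π * l)
  refine (h0.cos.div_const _).congr_deriv ?_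
  field_simp

theorem Psi_approx {L : ℕ} (hL : 1 ≤ L) (x : ℝ) : |Psi x - PsiL L x| ≤ 1 / L := by
  have hs := hasSum_one_div_nat_pow_mul_cos (k := 1) one_ne_zero (x := Int.fract x)
    ⟨Int.fract_nonneg x, (Int.fract_lt_one x).le⟩
  have e1 : (-1 : ℝ) ^ (1 + 1) * (2 * π) ^ (2 * 1) / 2 / ((2 * 1).factorial : ℝ) *
        (Polynomial.map (algebraMap ℚ ℝ) (Polynomial.bernoulli (2 * 1))).eval (Int.fract x) = 2 * π ^ 2 * Psi x := by
    have : (Polynomial.map (algebraMap ℚ ℝ) (Polynomial.bernoulli (2 * 1))).eval (Int.fract x) =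
      Int.fract x ^ 2 - Int.fract x + 1 / 6 := by
      simp [Polynomial.bernoulli_def, Finset.sum_range_succ, _root_.bernoulli_one, bernoulli_two]
      ring
    rw [this]
    simp [Psi, Nat.factorial]; ring
  rw [e1] at hs
  have hs' : HasSum (fun n : ℕ => cos (2 * π * n * x) / (2 * π ^ 2 * n ^ 2)) (Psi x) := by
    have h1 := hs.mul_left (1 / (2 * π ^ 2))
    have h2 : (fun n : ℕ => cos (2 * π * n * x) / (2 * π ^ 2 * n ^ 2)) =
        fun n : ℕ => 1 / (2 * π ^ 2) * (1 / (n:ℝ) ^ (2 * 1) * cos (2 * π * n * Int.fract x)) := by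
      funext n
      have : cos (2 * π * n * Int.fract x) = cos (2 * π * n * x) := by
        have : 2 * π * n * Int.fract x = 2 * π * n * x - (((n:ℤ) * ⌊x⌋ : ℤ) : ℝ) * (2 * π) := by
          rw [← Int.self_sub_floor]; push_cast; ring
        rw [this, cos_sub_int_mul_two_pi]
      rw [this]
      rw [div_eq_mul_inv, mul_inv]
      ring
    have h3 : 1 / (2 * π ^ 2) * (2 * π ^ 2 * Psi x) = Psi x := by
      have := pi_pos.ne'
      field_simp
    rw [h3] at h1
    rw [h2]
    exact h1
  have ht := hs'.tendsto_sum_nat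
  have ht' : Filter.Tendsto (fun n => |(∑ i ∈ Finset.range n, cos (2 * π * i * x) / (2 * π ^ 2 * i ^ 2)) - PsiL L x|)
    Filter.atTop (nhds |Psi x - PsiL L x|) := (ht.sub_const _).abs
  apply le_of_tendsto ht'
  filter_upwards [Filter.eventually_ge_atTop (L + 1)] with n hn
  have e2 : (∑ i ∈ Finset.range n, cos (2 * π * i * x) / (2 * π ^ 2 * i ^ 2)) - PsiL L x =
      ∑ i ∈ Finset.Ioc L (n - 1), cos (2 * π * i * x) / (2 * π ^ 2 * i ^ 2) := by
    rw [PsiL, sub_eq_iff_eq_add']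
    obtain ⟨k, rfl⟩ : ∃ k, n = k + 1 := ⟨n - 1, by omega⟩
    rw [Finset.sum_range_succ']
    simp only [Nat.add_sub_cancel]
    have e3 : ∀ f : ℕ → ℝ, ∑ i ∈ Finset.range k, f (i + 1) = ∑ i ∈ Finset.Icc 1 k, f i := by
      intro f
      rw [Finset.range_eq_Ico, Finset.sum_Ico_add' f 0 k 1]
      rfl
    have := e3 (fun i => cos (2 * π * i * x) / (2 * π ^ 2 * i ^ 2))
    rw [this]
    have hk : L ≤ k := by omega
    have := Finset.sum_Ioc_consecutive (fun i : ℕ => cos (2 * π * i * x) / (2 * π ^ 2 * i ^ 2)) (Nat.zero_le L) hk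
    have e4 : ∀ m : ℕ, Finset.Icc 1 m = Finset.Ioc 0 m := fun m => rfl
    rw [e4, e4, this]
    simp
  rw [e2]
  have hb := sum_Ioc_inv_sq_le_sub (α := ℝ) (k := L) (n := n - 1) (by omega) (by omega)
  calc |∑ i ∈ Finset.Ioc L (n - 1), cos (2 * π * i * x) / (2 * π ^ 2 * i ^ 2)| ≤
      ∑ i ∈ Finset.Ioc L (n - 1), |cos (2 * π * i * x) / (2 * π ^ 2 * i ^ 2)| := Finset.abs_sum_le_sum_abs _ _
    _ ≤ ∑ i ∈ Finset.Ioc L (n - 1), ((i:ℝ) ^ 2)⁻¹ := by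
        apply Finset.sum_le_sum
        intro i hi
        have hi0 : 0 < (i:ℝ) := by
          have := (Finset.mem_Ioc.1 hi).1
          have : 0 < i := by omega
          exact_mod_cast this
        rw [abs_div, abs_of_pos (by positivity : 0 < 2 * π ^ 2 * (i:ℝ) ^ 2), ← one_div]
        apply div_le_div₀ zero_le_one (abs_cos_le_one _) (by positivity)
        have : 1 ≤ 2 * π ^ 2 := by nlinarith [pi_gt_three]
        nlinarith [sq_nonneg (i:ℝ)]
    _ ≤ _ := hb
    _ ≤ 1 / L := by rw [one_div]; have : 0 ≤ ((n - 1 : ℕ):ℝ)⁻¹ := by positivity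
                    linarith

theorem harm_sum_le (L : ℕ) : ∑ l ∈ Finset.Icc 1 L, 1 / (l:ℝ) ≤ 1 + log L := by
  have := harmonic_le_one_add_log L
  rw [harmonic_eq_sum_Icc] at this
  push_cast at this
  simpa using this

theorem psiL_abs (L : ℕ) (t : ℝ) : |psiL L t| ≤ (1 + log L) / π := by
  unfold psiL
  rw [abs_neg]
  refine (Finset.abs_sum_le_sum_abs _ _).trans ?_
  calc _ ≤ ∑ l ∈ Finset.Icc 1 L, 1 / (l:ℝ) / π := by
        apply Finset.sum_le_sum
        intro l hl
        have hl0 : 0 < (l:ℝ) := by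
          have := (Finset.mem_Icc.1 hl).1; positivity
        rw [abs_div, abs_of_pos (by positivity : 0 < π * (l:ℝ)), div_div, mul_comm (l:ℝ)]
        gcongr
        exact abs_sin_le_one _
    _ ≤ _ := by
        rw [← Finset.sum_div]
        have := harm_sum_le L
        gcongr

theorem poisson {F F1 F2 : ℝ → ℝ} {a b : ℝ} {L : ℕ} (hL : 1 ≤ L) (ha : 0 ≤ a) (hab : a ≤ b)
    (hF : ∀ x ∈ Set.Icc a b, HasDerivAt F (F1 x) x)
    (hF1 : ∀ x ∈ Set.Icc a b, HasDerivAt F1 (F2 x) x) (cF2 : ContinuousOn F2 (Set.Icc a b)) :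
    |(∑ k ∈ Finset.Ioc ⌊a⌋₊ ⌊b⌋₊, F k) - (∫ x in a..b, F x) -
      2 * ∑ l ∈ Finset.Icc 1 L, ∫ x in a..b, F x * cos (2 * π * l * x)| ≤
    (1 + log L) * (|F a| + |F b|) + 1 / L * (|F1 a| + |F1 b| + ∫ x in a..b, |F2 x|) := by
  have hu : Set.uIcc a b = Set.Icc a b := Set.uIcc_of_le hab
  have cF : ContinuousOn F (Set.Icc a b) := fun x hx => (hF x hx).continuousAt.continuousWithinAt
  have cF1 : ContinuousOn F1 (Set.Icc a b) := fun x hx => (hF1 x hx).continuousAt.continuousWithinAt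
  have iF1 : IntervalIntegrable F1 volume a b := by
    apply ContinuousOn.intervalIntegrable; rwa [hu]
  have iF2 : IntervalIntegrable F2 volume a b := by
    apply ContinuousOn.intervalIntegrable; rwa [hu]
  -- Euler summation
  have e1 : (∑ k ∈ Finset.Ioc ⌊a⌋₊ ⌊b⌋₊, F k) = F b * (⌊b⌋₊ + 1) - F a * (⌊a⌋₊ + 1) -
      ∫ t in a..b, F1 t * (⌊t⌋₊ + 1) := by
    have := sum_mul_eq_sub_sub_integral_mul (fun _ => (1:ℝ)) (f := F) ha hab
      (fun t ht => (hF t ht).differentiableAt) (by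
        apply (ContinuousOn.integrableOn_compact isCompact_Icc)
        apply cF1.congr
        intro t ht; exact (hF t ht).deriv)
    simp only [mul_one, Finset.sum_const, Nat.card_Icc, nsmul_eq_mul, Nat.sub_zero, Nat.cast_add, Nat.cast_one] at this
    rw [this, intervalIntegral.integral_of_le hab]
    congr 1
    apply setIntegral_congr_fun measurableSet_Ioc
    intro t ht
    simp only [(hF t ⟨ht.1.le, ht.2⟩).deriv]
  have e2 : ∫ x in a..b, F x = b * F b - a * F a - ∫ x in a..b, F1 x * x := by
    have := intervalIntegral.integral_mul_deriv_eq_deriv_mul (u := F) (u' := F1) (v := fun x => x) (v' := fun _ => 1)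
      (a := a) (b := b) (fun x hx => hF x (hu ▸ hx)) (fun x _ => hasDerivAt_id x) iF1 (by simp)
    simp only [mul_one] at this
    rw [this]; ring
  have fl : ∀ t, 0 ≤ t → (⌊t⌋₊ : ℝ) + 1 = t - psi t + 1 / 2 := by
    intro t ht
    rw [psi, Int.fract, natCast_floor_eq_intCast_floor ht]; ring
  have ipsi : IntervalIntegrable (fun t => F1 t * psi t) volume a b :=
    (psi_int a b).continuousOn_mul (by rwa [hu])
  have e3 : ∫ t in a..b, F1 t * (⌊t⌋₊ + 1) = (∫ t in a..b, F1 t * t) - (∫ t in a..b, F1 t * psi t) +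
      1 / 2 * (F b - F a) := by
    have h1 : ∫ t in a..b, F1 t * (⌊t⌋₊ + 1) = ∫ t in a..b, (F1 t * t - F1 t * psi t + F1 t * (1 / 2)) := by
      apply intervalIntegral.integral_congr
      intro t ht
      rw [hu] at ht
      simp only
      rw [fl t (ha.trans ht.1)]; ring
    have i3 : IntervalIntegrable (fun t => F1 t * t) volume a b :=
      iF1.mul_continuousOn (by fun_prop)
    rw [h1, intervalIntegral.integral_add (i3.sub ipsi) (iF1.mul_const _), intervalIntegral.integral_sub i3 ipsi,
      intervalIntegral.integral_mul_const, intervalIntegral.integral_eq_sub_of_hasDerivAt (fun x hx => hF x (hu ▸ hx)) iF1]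
    ring
  have e4 : (∑ k ∈ Finset.Ioc ⌊a⌋₊ ⌊b⌋₊, F k) - (∫ x in a..b, F x) =
      - F b * psi b + F a * psi a + ∫ t in a..b, F1 t * psi t := by
    rw [e1, e2, e3, fl a ha, fl b (ha.trans hab)]; ring
  -- Fourier side
  have cpsiL : Continuous (psiL L) := by unfold psiL; fun_prop
  have e5 : 2 * ∑ l ∈ Finset.Icc 1 L, ∫ x in a..b, F x * cos (2 * π * l * x) =
      - F b * psiL L b + F a * psiL L a + ∫ t in a..b, F1 t * psiL L t := by
    have h1 : 2 * ∑ l ∈ Finset.Icc 1 L, ∫ x in a..b, F x * cos (2 * π * l * x) =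
      ∫ x in a..b, F x * (∑ l ∈ Finset.Icc 1 L, 2 * cos (2 * π * l * x)) := by
      simp only [Finset.mul_sum]
      rw [intervalIntegral.integral_finset_sum]
      · apply Finset.sum_congr rfl
        intro l _
        rw [← intervalIntegral.integral_const_mul]
        apply intervalIntegral.integral_congr
        intro x _; simp only; ring
      · intro l _
        apply ContinuousOn.intervalIntegrable
        rw [hu]
        exact cF.mul (by fun_prop)
    have hd : ∀ x, HasDerivAt (fun x => - psiL L x) (∑ l ∈ Finset.Icc 1 L, 2 * cos (2 * π * l * x)) x := by
      intro x
      simp only [psiL, neg_neg]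
      apply HasDerivAt.fun_sum
      intro l hl
      have hl0 : (l:ℝ) ≠ 0 := by
        have := (Finset.mem_Icc.1 hl).1; positivity
      have h0 : HasDerivAt (fun t : ℝ => 2 * π * l * t) (2 * π * l) x := by
        simpa using (hasDerivAt_id x).const_mul (2 * π * l)
      refine (h0.sin.div_const _).congr_deriv ?_
      field_simp
    rw [h1, intervalIntegral.integral_mul_deriv_eq_deriv_mul (u := F) (u' := F1) (v := fun x => - psiL L x)
      (fun x hx => hF x (hu ▸ hx)) (fun x _ => hd x) iF1 (Continuous.intervalIntegrable (by fun_prop) _ _)]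
    simp only [mul_neg, intervalIntegral.integral_neg]
    ring
  have ipsiL : IntervalIntegrable (fun t => F1 t * psiL L t) volume a b :=
    iF1.mul_continuousOn cpsiL.continuousOn
  have e6 : (∫ t in a..b, F1 t * psi t) - (∫ t in a..b, F1 t * psiL L t) =
     F1 b * (Psi b - PsiL L b) - F1 a * (Psi a - PsiL L a) - ∫ t in a..b, F2 t * (Psi t - PsiL L t) := by
    rw [← intervalIntegral.integral_sub ipsi ipsiL]
    have cPL : Continuous (PsiL L) := by unfold PsiL; fun_prop
    rw [← intervalIntegral.integral_mul_deriv_eq_deriv_mul_of_hasDeriv_right (u := F1) (u' := F2)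
      (v := fun t => Psi t - PsiL L t) (v' := fun t => psi t - psiL L t) (by rwa [hu])
      (Psi_cont.sub cPL).continuousOn]
    · apply intervalIntegral.integral_congr
      intro t _; simp only; ring
    · intro x hx
      rw [min_eq_left hab, max_eq_right hab] at hx
      exact (hF1 x ⟨hx.1.le, hx.2.le⟩).hasDerivWithinAt
    · intro x hx
      exact (Psi_deriv x).sub (PsiL_deriv L x).hasDerivWithinAt
    · exact iF2
    · exact (psi_int a b).sub (cpsiL.intervalIntegrable _ _)
  have b1 : |∫ t in a..b, F2 t * (Psi t - PsiL L t)| ≤ 1 / L * ∫ t in a..b, |F2 t| := by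
    rw [← intervalIntegral.integral_const_mul]
    have := intervalIntegral.norm_integral_le_of_norm_le hab (f := fun t => F2 t * (Psi t - PsiL L t))
      (g := fun t => 1 / L * |F2 t|) (μ := volume) ?_ (iF2.abs.const_mul _)
    · simpa using this
    · refine Filter.Eventually.of_forall fun x _ => ?_
      rw [norm_mul, Real.norm_eq_abs, Real.norm_eq_abs, mul_comm]
      exact mul_le_mul_of_nonneg_right (Psi_approx hL x) (abs_nonneg _)
  have hlog : 0 ≤ log L := log_natCast_nonneg L
  have b2 : ∀ t, |psi t - psiL L t| ≤ 1 + log L := by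
    intro t
    have h1 := abs_sub (psi t) (psiL L t)
    have h2 := psi_abs t
    have h3 := psiL_abs L t
    have h4 : (1 + log L) / π ≤ (1 + log L) / 3 := by
      apply div_le_div_of_nonneg_left (by linarith) (by norm_num) pi_gt_three.le
    linarith
  have e7 : (∑ k ∈ Finset.Ioc ⌊a⌋₊ ⌊b⌋₊, F k) - (∫ x in a..b, F x) -
      2 * ∑ l ∈ Finset.Icc 1 L, ∫ x in a..b, F x * cos (2 * π * l * x) =
      - (F b * (psi b - psiL L b)) + F a * (psi a - psiL L a) + F1 b * (Psi b - PsiL L b) - F1 a * (Psi a - PsiL L a) -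
       ∫ t in a..b, F2 t * (Psi t - PsiL L t) := by
    rw [e4, e5]; linarith [e6]
  rw [e7]
  have mm : ∀ {x y c : ℝ}, |y| ≤ c → |x * y| ≤ c * |x| := by
    intro x y c h
    rw [abs_mul, mul_comm]; exact mul_le_mul_of_nonneg_right h (abs_nonneg _)
  have m1 := mm (x := F b) (b2 b)
  have m2 := mm (x := F a) (b2 a)
  have m3 := mm (x := F1 b) (Psi_approx hL b)
  have m4 := mm (x := F1 a) (Psi_approx hL a)
  rw [mul_add, mul_add, mul_add]
  rw [abs_le] at *
  constructor <;> linarith [m1.1, m1.2, m2.1, m2.2, m3.1, m3.2, m4.1, m4.2, b1.1, b1.2]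
end Atk

namespace Atk

theorem sum_dist_le (h : ℕ → ℝ) (h0 : ∀ i, 0 ≤ h i) (K k : ℕ) (hk : k ≤ K) :
    ∑ l ∈ Finset.Icc 1 K, h (if l ≤ k then k - l else l - k) ≤ 2 * ∑ i ∈ Finset.range (K + 1), h i := by
  have h1 : ∀ l ∈ Finset.Icc 1 K, h (if l ≤ k then k - l else l - k) ≤
      ∑ i ∈ Finset.range (K + 1), ((if l = k + i then h i else 0) + (if l + i = k then h i else 0)) := by
    intro l hl
    have hl := Finset.mem_Icc.1 hl
    have nn : ∀ i ∈ Finset.range (K+1), 0 ≤ ((if l = k + i then h i else 0) + (if l + i = k then h i else 0)) := by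
      intro i _
      have := h0 i
      split_ifs <;> linarith
    split_ifs with hlk
    · have := Finset.single_le_sum nn (Finset.mem_range.2 (by omega : k - l < K + 1))
      refine le_trans ?_ this
      have e1 : l + (k - l) = k := by omega
      rw [if_pos e1]
      have := h0 (k - l)
      split_ifs <;> linarith
    · have := Finset.single_le_sum nn (Finset.mem_range.2 (by omega : l - k < K + 1))
      refine le_trans ?_ this
      have e1 : l = k + (l - k) := by omega
      rw [if_pos e1]
      have := h0 (l - k)
      split_ifs <;> linarith
  refine (Finset.sum_le_sum h1).trans ?_
  rw [Finset.sum_comm, Finset.mul_sum]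
  apply Finset.sum_le_sum
  intro i _
  rw [Finset.sum_add_distrib]
  have a1 : ∑ l ∈ Finset.Icc 1 K, (if l = k + i then h i else 0) ≤ h i := by
    rw [Finset.sum_ite_eq']
    split_ifs
    · exact le_rfl
    · exact h0 i
  have a2 : ∑ l ∈ Finset.Icc 1 K, (if l + i = k then h i else 0) ≤ h i := by
    have : ∀ l ∈ Finset.Icc 1 K, (if l + i = k then h i else 0) ≤ (if l = k - i then h i else 0) := by
      intro l _
      have := h0 i
      split_ifs <;> first | exact le_rfl | omega | exact this
    refine (Finset.sum_le_sum this).trans ?_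
    rw [Finset.sum_ite_eq']
    split_ifs
    · exact le_rfl
    · exact h0 i
  linarith

theorem inner_sum {N V : ℝ} {K q : ℕ} (hq : 1 ≤ q) (hN : 0 ≤ N) (hV : 0 < V) (hK : N ≤ K) (hK1 : 1 ≤ K) :
    ∑ l ∈ Finset.Icc 1 K, 1 / max V |(q:ℝ) * l - N| ≤ 4 / V + 4 * (1 + log K) / q := by
  have hq0 : (0:ℝ) < q := by exact_mod_cast hq
  have hq1 : (1:ℝ) ≤ q := by exact_mod_cast hq
  set x := N / q with hx
  have hx0 : 0 ≤ x := by positivity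
  set k := ⌊x⌋₊
  have k1 : (k:ℝ) ≤ x := Nat.floor_le hx0
  have k2 : x < k + 1 := Nat.lt_floor_add_one x
  have hkK : k ≤ K := by
    have : (k:ℝ) ≤ K := k1.trans ((div_le_self hN hq1).trans hK)
    exact_mod_cast this
  set h : ℕ → ℝ := fun i => if i ≤ 1 then 1 / V else 2 / (q * i) with hh
  have h0 : ∀ i, 0 ≤ h i := by
    intro i; simp only [hh]; split_ifs <;> positivity
  have b1 : ∀ l ∈ Finset.Icc 1 K, 1 / max V |(q:ℝ) * l - N| ≤ h (if l ≤ k then k - l else l - k) := by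
    intro l _
    have hV' : 1 / max V |(q:ℝ) * l - N| ≤ 1 / V := one_div_le_one_div_of_le hV (le_max_left _ _)
    have key : ∀ i : ℕ, 2 ≤ i → (i:ℝ) - 1 ≤ |(l:ℝ) - x| → 1 / max V |(q:ℝ) * l - N| ≤ 2 / (q * i) := by
      intro i hi hh
      have hi2 : (2:ℝ) ≤ i := by exact_mod_cast hi
      have e : |(q:ℝ) * l - N| = q * |(l:ℝ) - x| := by
        rw [← abs_of_pos hq0, ← abs_mul, abs_of_pos hq0, mul_sub, hx, mul_div_cancel₀ _ hq0.ne']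
      have : q * i / 2 ≤ max V |(q:ℝ) * l - N| := by
        refine le_trans ?_ (le_max_right _ _)
        rw [e]
        have : (i:ℝ) / 2 ≤ |(l:ℝ) - x| := by linarith
        nlinarith
      refine (one_div_le_one_div_of_le (by positivity) this).trans (le_of_eq ?_)
      field_simp
    have p : ∀ i : ℕ, (2 ≤ i → (i:ℝ) - 1 ≤ |(l:ℝ) - x|) → 1 / max V |(q:ℝ) * l - N| ≤ h i := by
      intro i hi
      simp only [hh]
      split_ifs with h1
      · exact hV'
      · exact key i (by omega) (hi (by omega))
    split_ifs with hlk
    · apply p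
      intro _
      rw [Nat.cast_sub hlk]
      have := neg_abs_le ((l:ℝ) - x)
      linarith
    · apply p
      intro _
      rw [Nat.cast_sub (by omega)]
      have := le_abs_self ((l:ℝ) - x)
      linarith
  refine (Finset.sum_le_sum b1).trans ((sum_dist_le h h0 K k hkK).trans ?_)
  have b2 : ∑ i ∈ Finset.range (K + 1), h i ≤ 2 / V + 2 / q * (1 + log K) := by
    obtain ⟨K, rfl⟩ : ∃ j, K = j + 1 := ⟨K - 1, by omega⟩
    rw [Finset.sum_range_succ']
    have e0 : h 0 = 1 / V := by simp [hh]
    rw [e0]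
    have e1 : ∑ i ∈ Finset.range (K + 1), h (i + 1) ≤ ∑ i ∈ Finset.range (K + 1), ((if i = 0 then 1 / V else 0) + 2 / q * (1 / ((i + 1 : ℕ) : ℝ))) := by
      apply Finset.sum_le_sum
      intro i _
      simp only [hh]
      rcases Nat.eq_zero_or_pos i with rfl | hi
      · simp; positivity
      · rw [if_neg (by omega), if_neg (by omega)]
        apply le_of_eq
        have : ((i + 1 : ℕ) : ℝ) ≠ 0 := by positivity
        field_simp
        ring
    rw [Finset.sum_add_distrib, Finset.sum_ite_eq', ← Finset.mul_sum] at e1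
    have e2 : ∑ i ∈ Finset.range (K + 1), 1 / ((i + 1 : ℕ) : ℝ) = ∑ i ∈ Finset.Icc 1 (K+1), 1 / (i:ℝ) := by
      rw [Finset.range_eq_Ico, Finset.sum_Ico_add' (fun i : ℕ => 1 / (i:ℝ)) 0 (K + 1) 1]
      rfl
    rw [e2, if_pos (by simp)] at e1
    have e3 := mul_le_mul_of_nonneg_left (harm_sum_le (K + 1)) (by positivity : 0 ≤ 2 / (q:ℝ))
    have e4 : 2 / V = 1 / V + 1 / V := by ring
    linarith
  have : 4 / V + 4 * (1 + log K) / q = 2 * (2 / V + 2 / q * (1 + log K)) := by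
    field_simp
    ring
  linarith

theorem div_sum {N V : ℝ} {R L : ℕ} (hN : 1 ≤ N) (hV : 0 < V) (hR : 1 ≤ R) (hL : 1 ≤ L) :
    ∑ q ∈ Finset.Icc 1 R, ∑ l ∈ Finset.Icc 1 L, 1 / max V |(q:ℝ) * l - N| ≤
      2 * ((1 + log R) * (1 + log L)) + 2 * (4 * √(2 * N) / V + 4 * (1 + log (2 * N)) ^ 2) := by
  set t : ℕ → ℕ → ℝ := fun q l => 1 / max V |(q:ℝ) * l - N| with ht
  have t0 : ∀ q l, 0 ≤ t q l := by
    intro q l; simp only [ht]; have : 0 < max V |(q:ℝ) * l - N| := lt_max_of_lt_left hV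
    positivity
  have tc : ∀ q l, t q l = t l q := by
    intro q l; simp only [ht]; rw [mul_comm (q:ℝ)]
  set P : ℕ → ℕ → ℝ := fun q l => if (q:ℝ) * l ≤ 2 * N ∧ q ≤ l then t q l else 0 with hP
  set K := ⌊2 * N⌋₊
  set Q := ⌊√(2 * N)⌋₊
  have hK1 : 1 ≤ K := Nat.le_floor (by push_cast; linarith)
  have hKN : (K:ℝ) ≤ 2 * N := Nat.floor_le (by linarith)
  have hNK : N ≤ K := by
    have := Nat.lt_floor_add_one (2 * N)
    have : 2 * N < K + 1 := this
    linarith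
  have hs1 : 1 ≤ √(2 * N) := by rw [Real.one_le_sqrt]; linarith
  have hQ1 : 1 ≤ Q := Nat.le_floor (by push_cast; linarith)
  have hQN : (Q:ℝ) ≤ √(2 * N) := Nat.floor_le (by positivity)
  have hsN : √(2 * N) ≤ 2 * N := by
    rw [Real.sqrt_le_left (by linarith)]; nlinarith
  have logK : log K ≤ log (2 * N) := log_le_log (by exact_mod_cast hK1) hKN
  have logQ : log Q ≤ log (2 * N) := log_le_log (by exact_mod_cast hQ1) (hQN.trans hsN)
  have logK0 : 0 ≤ log (K:ℝ) := log_natCast_nonneg K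
  have logQ0 : 0 ≤ log (Q:ℝ) := log_natCast_nonneg Q
  have core : ∀ R L : ℕ, ∑ q ∈ Finset.Icc 1 R, ∑ l ∈ Finset.Icc 1 L, P q l ≤ 4 * √(2 * N) / V + 4 * (1 + log (2 * N)) ^ 2 := by
    intro R L
    have s1 : ∑ q ∈ Finset.Icc 1 R, ∑ l ∈ Finset.Icc 1 L, P q l ≤ ∑ q ∈ Finset.Icc 1 Q, ∑ l ∈ Finset.Icc 1 K, t q l := by
      rw [← Finset.sum_product', ← Finset.sum_product']
      simp only [hP]
      rw [← Finset.sum_filter (fun x : ℕ × ℕ => (x.1:ℝ) * x.2 ≤ 2 * N ∧ x.1 ≤ x.2) (fun x => t x.1 x.2)]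
      apply Finset.sum_le_sum_of_subset_of_nonneg
      · rintro ⟨q, l⟩ hx
        simp only [Finset.mem_filter, Finset.mem_product, Finset.mem_Icc] at hx ⊢
        obtain ⟨⟨⟨hq, _⟩, ⟨hl, _⟩⟩, h1, h2⟩ := hx
        have hq' : (1:ℝ) ≤ q := by exact_mod_cast hq
        have hl' : (1:ℝ) ≤ l := by exact_mod_cast hl
        have h2' : (q:ℝ) ≤ l := by exact_mod_cast h2
        refine ⟨⟨hq, Nat.le_floor ?_⟩, hl, Nat.le_floor ?_⟩
        · apply Real.le_sqrt_of_sq_le; nlinarith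
        · nlinarith
      · intro _ _ _; exact t0 _ _
    refine s1.trans ?_
    calc _ ≤ ∑ q ∈ Finset.Icc 1 Q, (4 / V + 4 * (1 + log K) * (1 / q)) := by
          apply Finset.sum_le_sum
          intro q hq
          have := inner_sum (Finset.mem_Icc.1 hq).1 (by linarith : 0 ≤ N) hV hNK hK1
          rw [mul_one_div]; exact this
      _ = Q * (4 / V) + 4 * (1 + log K) * ∑ q ∈ Finset.Icc 1 Q, 1 / (q:ℝ) := by
          rw [Finset.sum_add_distrib, ← Finset.mul_sum]; simp
      _ ≤ √(2 * N) * (4 / V) + 4 * (1 + log (2 * N)) * (1 + log (2 * N)) := by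
          have := (harm_sum_le Q).trans (add_le_add_right logQ 1)
          have : 0 ≤ log (2 * N) := logK0.trans logK
          gcongr
      _ = _ := by ring
  have b1 : ∀ q ∈ Finset.Icc 1 R, ∀ l ∈ Finset.Icc 1 L, t q l ≤ 2 * (1 / (q:ℝ) * (1 / l)) + P q l + P l q := by
    intro q hq l hl
    have hq' : (1:ℝ) ≤ q := by exact_mod_cast (Finset.mem_Icc.1 hq).1
    have hl' : (1:ℝ) ≤ l := by exact_mod_cast (Finset.mem_Icc.1 hl).1
    have c0 : 0 ≤ 2 * (1 / (q:ℝ) * (1 / l)) := by positivity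
    have p0 : ∀ q l, 0 ≤ P q l := by
      intro q l; simp only [hP]; split_ifs
      · exact t0 _ _
      · exact le_rfl
    by_cases h1 : (q:ℝ) * l ≤ 2 * N
    · rcases le_total q l with h | h
      · have : P q l = t q l := by simp only [hP]; rw [if_pos ⟨h1, h⟩]
        linarith [p0 l q]
      · have : P l q = t q l := by simp only [hP]; rw [if_pos ⟨by linarith, h⟩, tc]
        linarith [p0 q l]
    · push Not at h1
      have : t q l ≤ 2 * (1 / (q:ℝ) * (1 / l)) := by
        simp only [ht]
        have h2 : (q:ℝ) * l / 2 ≤ max V |(q:ℝ) * l - N| := by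
          refine le_trans ?_ (le_max_right _ _)
          refine le_trans ?_ (le_abs_self _)
          linarith
        refine (one_div_le_one_div_of_le (by positivity) h2).trans (le_of_eq ?_)
        field_simp
      linarith [p0 q l, p0 l q]
  refine (Finset.sum_le_sum fun q hq => Finset.sum_le_sum fun l hl => b1 q hq l hl).trans ?_
  simp only [Finset.sum_add_distrib]
  have c1 := core R L
  have c2 := core L R
  rw [Finset.sum_comm] at c2
  have c3 : ∑ q ∈ Finset.Icc 1 R, ∑ l ∈ Finset.Icc 1 L, 2 * (1 / (q:ℝ) * (1 / l)) ≤ 2 * ((1 + log R) * (1 + log L)) := by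
    simp only [← Finset.mul_sum]
    rw [← Finset.sum_mul]
    have := harm_sum_le R
    have := harm_sum_le L
    have := log_natCast_nonneg R
    have : 0 ≤ ∑ l ∈ Finset.Icc 1 L, 1 / (l:ℝ) := Finset.sum_nonneg fun _ _ => by positivity
    gcongr
  linarith
end Atk

namespace Atk

theorem div_count {n R L : ℕ} (hn : 1 ≤ n) (hR : n ≤ R) (hL : n ≤ L) (x : ℝ) :
    (n.divisors.card : ℝ) * x = ∑ q ∈ Finset.Icc 1 R, ∑ l ∈ Finset.Icc 1 L, if q * l = n then x else 0 := by
  have h1 : ∀ q ∈ Finset.Icc 1 R, (∑ l ∈ Finset.Icc 1 L, if q * l = n then x else 0) = if q ∣ n then x else 0 := by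
    intro q hq
    have hq1 := (Finset.mem_Icc.1 hq).1
    split_ifs with h
    · obtain ⟨l, rfl⟩ := h
      have hl : 1 ≤ l := Nat.pos_of_ne_zero (by rintro rfl; simp at hn)
      have : l ≤ L := le_trans (Nat.le_mul_of_pos_left l hq1) hL
      rw [Finset.sum_eq_single l]
      · simp
      · intro j _ hj
        rw [if_neg]
        intro h
        exact hj (Nat.eq_of_mul_eq_mul_left hq1 h)
      · intro h
        exact absurd (Finset.mem_Icc.2 ⟨hl, this⟩) h
    · apply Finset.sum_eq_zero
      intro l _
      rw [if_neg]
      rintro rfl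
      exact h (Dvd.intro l rfl)
  rw [Finset.sum_congr rfl h1, ← Finset.sum_filter, Finset.sum_const, nsmul_eq_mul]
  congr 3
  ext d
  simp only [Nat.mem_divisors, Finset.mem_filter, Finset.mem_Icc]
  constructor
  · rintro ⟨h, _⟩
    exact ⟨⟨Nat.pos_of_dvd_of_pos h hn, (Nat.le_of_dvd hn h).trans hR⟩, h⟩
  · rintro ⟨_, h⟩
    exact ⟨h, by omega⟩

theorem div_reindex {K R L : ℕ} (hR : K ≤ R) (hL : K ≤ L) (m : ℕ → ℝ) :
    ∑ n ∈ Finset.Icc 1 K, (n.divisors.card : ℝ) * m n =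
      ∑ q ∈ Finset.Icc 1 R, ∑ l ∈ Finset.Icc 1 L, if q * l ≤ K then m (q * l) else 0 := by
  have h1 : ∀ n ∈ Finset.Icc 1 K, (n.divisors.card : ℝ) * m n =
      ∑ q ∈ Finset.Icc 1 R, ∑ l ∈ Finset.Icc 1 L, if q * l = n then m n else 0 := by
    intro n hn
    have := Finset.mem_Icc.1 hn
    exact div_count this.1 (this.2.trans hR) (this.2.trans hL) _
  rw [Finset.sum_congr rfl h1, Finset.sum_comm]
  apply Finset.sum_congr rfl
  intro q hq
  rw [Finset.sum_comm]
  apply Finset.sum_congr rfl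
  intro l hl
  have hq1 := (Finset.mem_Icc.1 hq).1
  have hl1 := (Finset.mem_Icc.1 hl).1
  rw [Finset.sum_ite_eq]
  have : 1 ≤ q * l := Nat.mul_pos hq1 hl1
  simp only [Finset.mem_Icc, this, true_and]

namespace Osc
variable {A A1 A2 ℓ g g1 : ℝ → ℝ} {α B a : ℝ}

theorem one_q (H : Osc A A1 A2 ℓ g g1 α B a) {T b M : ℝ} {q L W : ℕ} (hT : 1 ≤ T) (hb : α ≤ b) (hq : 1 ≤ q)
    (hL : 1 ≤ L) (hM : 1 ≤ M) (hW : b * q ≤ W) (hWM : (W:ℝ) ≤ M) :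
    |(∑ j ∈ Finset.Ioc ⌊b * q⌋₊ W, (1 / (q:ℝ)) * (A (j / q) * sin (T * ℓ (j / q)))) -
      (∫ t in b..(W / q : ℝ), A t * sin (T * ℓ t)) -
      2 * ∑ l ∈ Finset.Icc 1 L, ∫ t in b..(W / q : ℝ), A t * sin (T * ℓ t) * cos (2 * π * (q * l) * t)| ≤
    2 * a * (1 + log L) * (1 / q) + 9 * a ^ 3 * T ^ 2 * M / L := by
  have hα := H.hα
  have ha := H.ha
  have hq0 : (0:ℝ) < q := by exact_mod_cast hq
  have hq1 : (1:ℝ) ≤ q := by exact_mod_cast hq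
  have hL0 : (0:ℝ) < L := by exact_mod_cast hL
  set G : ℝ → ℝ := fun s => A s * sin (T * ℓ s) with hG
  set G1 : ℝ → ℝ := fun s => A1 s * sin (T * ℓ s) + A s * (cos (T * ℓ s) * (T * g s)) with hG1
  set G2 : ℝ → ℝ := fun s => A2 s * sin (T * ℓ s) + A1 s * (cos (T * ℓ s) * (T * g s)) +
    (A1 s * (cos (T * ℓ s) * (T * g s)) + A s * ((-sin (T * ℓ s) * (T * g s)) * (T * g s) + cos (T * ℓ s) * (T * g1 s))) with hG2
  have dG : ∀ s, α ≤ s → HasDerivAt G (G1 s) s := by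
    intro s hs
    exact (H.dA s hs).mul ((H.dl s hs).const_mul T).sin
  have dG1 : ∀ s, α ≤ s → HasDerivAt G1 (G2 s) s := by
    intro s hs
    have h1 := ((H.dl s hs).const_mul T).sin
    have h2 := ((H.dl s hs).const_mul T).cos
    exact ((H.dA1 s hs).mul h1).add ((H.dA s hs).mul (h2.mul ((H.dg s hs).const_mul T)))
  have cG2 : ContinuousOn G2 (Set.Ici α) := by
    have cA : ContinuousOn A (Set.Ici α) := fun x hx => (H.dA x hx).continuousAt.continuousWithinAt
    have cA1 : ContinuousOn A1 (Set.Ici α) := fun x hx => (H.dA1 x hx).continuousAt.continuousWithinAt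
    have cl : ContinuousOn ℓ (Set.Ici α) := fun x hx => (H.dl x hx).continuousAt.continuousWithinAt
    have cg : ContinuousOn g (Set.Ici α) := fun x hx => (H.dg x hx).continuousAt.continuousWithinAt
    have cA2 := H.cA2
    have cg1 := H.cg1
    have cs : ContinuousOn (fun s => sin (T * ℓ s)) (Set.Ici α) := continuous_sin.comp_continuousOn (continuousOn_const.mul cl)
    have cc : ContinuousOn (fun s => cos (T * ℓ s)) (Set.Ici α) := continuous_cos.comp_continuousOn (continuousOn_const.mul cl)
    simp only [hG2]
    fun_prop
  have bG : ∀ s, α ≤ s → |G s| ≤ a := by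
    intro s hs
    simp only [hG, abs_mul]
    have := mul_le_mul (H.Aa s hs) (abs_sin_le_one (T * ℓ s)) (abs_nonneg _) (by linarith)
    rw [abs_of_nonneg (H.A0 s hs)]; linarith
  have mm : ∀ {x y X Y : ℝ}, |x| ≤ X → |y| ≤ Y → |x * y| ≤ X * Y := by
    intro x y X Y h1 h2
    rw [abs_mul]; exact mul_le_mul h1 h2 (abs_nonneg _) ((abs_nonneg _).trans h1)
  have bA : ∀ s, α ≤ s → |A s| ≤ a := fun s hs => by rw [abs_of_nonneg (H.A0 s hs)]; exact H.Aa s hs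
  have bg : ∀ s, α ≤ s → |T * g s| ≤ T * a := fun s hs => by
    rw [abs_of_nonneg (mul_nonneg (by linarith) (H.g0 s hs).le)]
    exact mul_le_mul_of_nonneg_left (H.ga s hs) (by linarith)
  have bg1 : ∀ s, α ≤ s → |T * g1 s| ≤ T * a := fun s hs => mm (by rw [abs_of_pos]; linarith) (H.g1a s hs)
  have haT : 1 ≤ a * T := by nlinarith
  have bG1 : ∀ s, α ≤ s → |G1 s| ≤ 2 * a ^ 2 * T := by
    intro s hs
    have h1 := mm (H.A1a s hs) (abs_sin_le_one (T * ℓ s))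
    have h2 := mm (bA s hs) (mm (abs_cos_le_one (T * ℓ s)) (bg s hs))
    refine (abs_add_le _ _).trans ((add_le_add h1 h2).trans ?_)
    nlinarith
  have bG2 : ∀ s, α ≤ s → |G2 s| ≤ 5 * a ^ 3 * T ^ 2 := by
    intro s hs
    have h1 := mm (H.A2a s hs) (abs_sin_le_one (T * ℓ s))
    have h2 := mm (H.A1a s hs) (mm (abs_cos_le_one (T * ℓ s)) (bg s hs))
    have hsn : |-sin (T * ℓ s)| ≤ 1 := by rw [abs_neg]; exact abs_sin_le_one _
    have h3 := mm (mm hsn (bg s hs)) (bg s hs)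
    have h4 := mm (abs_cos_le_one (T * ℓ s)) (bg1 s hs)
    have h5 := mm (bA s hs) ((abs_add_le _ _).trans (add_le_add h3 h4))
    refine (abs_add_le _ _).trans ((add_le_add ((abs_add_le _ _).trans (add_le_add h1 h2)) ((abs_add_le _ _).trans (add_le_add h2 h5))).trans ?_)
    set u := a * T
    have e1 : a * 1 + a * (1 * (T * a)) + (a * (1 * (T * a)) + a * (1 * (T * a) * (T * a) + 1 * (T * a))) = a * (1 + 3 * u + u ^ 2) := by
      simp only [u]; ring
    have e2 : 5 * a ^ 3 * T ^ 2 = a * (5 * u ^ 2) := by simp only [u]; ring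
    rw [e1, e2]
    apply mul_le_mul_of_nonneg_left _ (by linarith)
    nlinarith
  -- scaled function
  have hmem : ∀ x ∈ Set.Icc (b * q) (W:ℝ), α ≤ x / q := by
    intro x hx
    rw [le_div_iff₀ hq0]
    exact (mul_le_mul_of_nonneg_right hb hq0.le).trans hx.1
  have hdiv : ∀ x : ℝ, HasDerivAt (fun x : ℝ => x / q) (1 / q) x := fun x => (hasDerivAt_id x).div_const _
  have dF : ∀ x ∈ Set.Icc (b * q) (W:ℝ), HasDerivAt (fun x => 1 / (q:ℝ) * G (x / q)) (1 / (q:ℝ) * (G1 (x / q) * (1 / q))) x := by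
    intro x hx
    exact ((dG _ (hmem x hx)).comp x (hdiv x)).const_mul _
  have dF1 : ∀ x ∈ Set.Icc (b * q) (W:ℝ), HasDerivAt (fun x => 1 / (q:ℝ) * (G1 (x / q) * (1 / q))) (1 / (q:ℝ) * (G2 (x / q) * (1 / q) * (1 / q))) x := by
    intro x hx
    exact (((dG1 _ (hmem x hx)).comp x (hdiv x)).mul_const _).const_mul _
  have cF2 : ContinuousOn (fun x => 1 / (q:ℝ) * (G2 (x / q) * (1 / q) * (1 / q))) (Set.Icc (b * q) (W:ℝ)) := by
    have : ContinuousOn (fun x => G2 (x / q)) (Set.Icc (b * q) (W:ℝ)) := cG2.comp (by fun_prop) (fun x hx => hmem x hx)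
    exact continuousOn_const.mul ((this.mul continuousOn_const).mul continuousOn_const)
  have hP := poisson hL (by have := hα.le.trans hb; positivity) hW dF dF1 cF2
  have hfl : ⌊(W:ℝ)⌋₊ = W := Nat.floor_natCast W
  rw [hfl] at hP
  have hWq : (W:ℝ) = (W / q : ℝ) * q := by field_simp
  have sub : ∀ f : ℝ → ℝ, ∫ x in (b * q)..(W:ℝ), f x = q * ∫ t in b..(W / q : ℝ), f (t * q) := by
    intro f
    rw [intervalIntegral.integral_comp_mul_right f hq0.ne', ← hWq, smul_eq_mul, ← mul_assoc, mul_inv_cancel₀ hq0.ne', one_mul]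
  have e1 : ∫ x in (b * q)..(W:ℝ), 1 / (q:ℝ) * G (x / q) = ∫ t in b..(W / q : ℝ), G t := by
    rw [sub, ← intervalIntegral.integral_const_mul]
    apply intervalIntegral.integral_congr
    intro t _
    simp only [mul_div_cancel_right₀ _ hq0.ne']
    rw [← mul_assoc, mul_one_div_cancel hq0.ne', one_mul]
  have e2 : ∀ l : ℕ, ∫ x in (b * q)..(W:ℝ), 1 / (q:ℝ) * G (x / q) * cos (2 * π * l * x) =
      ∫ t in b..(W / q : ℝ), G t * cos (2 * π * (q * l) * t) := by
    intro l
    rw [sub, ← intervalIntegral.integral_const_mul]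
    apply intervalIntegral.integral_congr
    intro t _
    simp only [mul_div_cancel_right₀ _ hq0.ne']
    rw [← mul_assoc, ← mul_assoc, mul_one_div_cancel hq0.ne', one_mul]
    congr 2
    ring
  rw [e1] at hP
  simp only [e2] at hP
  refine hP.trans ?_
  have hl0 : 0 ≤ log (L:ℝ) := log_natCast_nonneg L
  have hu1 : 1 / (q:ℝ) ≤ 1 := by rw [div_le_one hq0]; exact hq1
  have hu0 : 0 < 1 / (q:ℝ) := by positivity
  set u := 1 / (q:ℝ)
  have hin : b * q ∈ Set.Icc (b * q) (W:ℝ) := ⟨le_rfl, hW⟩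
  have hin' : (W:ℝ) ∈ Set.Icc (b * q) (W:ℝ) := ⟨hW, le_rfl⟩
  have f0 : ∀ x ∈ Set.Icc (b * q) (W:ℝ), |u * G (x / q)| ≤ u * a := fun x hx => by
    apply mm (by rw [abs_of_pos hu0]) (bG _ (hmem x hx))
  have f1 : ∀ x ∈ Set.Icc (b * q) (W:ℝ), |u * (G1 (x / q) * u)| ≤ 2 * a ^ 2 * T := fun x hx => by
    have hu : |u| ≤ 1 := by rw [abs_of_pos hu0]; exact hu1
    have := mm hu (mm (bG1 _ (hmem x hx)) hu)
    linarith
  have f2 : ∀ x ∈ Set.Icc (b * q) (W:ℝ), |u * (G2 (x / q) * u * u)| ≤ 5 * a ^ 3 * T ^ 2 := fun x hx => by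
    have hu : |u| ≤ 1 := by rw [abs_of_pos hu0]; exact hu1
    have := mm hu (mm (mm (bG2 _ (hmem x hx)) hu) hu)
    linarith
  have f3 : ∫ x in (b * q)..(W:ℝ), |u * (G2 (x / q) * u * u)| ≤ 5 * a ^ 3 * T ^ 2 * M := by
    have := intervalIntegral.integral_mono_on (μ := volume) hW (f := fun x => |u * (G2 (x / q) * u * u)|) (g := fun _ => 5 * a ^ 3 * T ^ 2)
      (by apply ContinuousOn.intervalIntegrable; rw [Set.uIcc_of_le hW]; exact cF2.abs) (by simp) f2
    refine this.trans ?_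
    rw [intervalIntegral.integral_const, smul_eq_mul]
    have : 0 ≤ b * q := by have := hα.le.trans hb; positivity
    have : (W:ℝ) - b * q ≤ M := by linarith
    rw [mul_comm]
    exact mul_le_mul_of_nonneg_left this (by positivity)
  have g1 := f0 _ hin
  have g2 := f0 _ hin'
  have g3 := f1 _ hin
  have g4 := f1 _ hin'
  have t1 : (1 + log L) * (|u * G (b * q / q)| + |u * G (W / q)|) ≤ (1 + log L) * (2 * (u * a)) :=
    mul_le_mul_of_nonneg_left (by linarith) (by linarith)
  have t2 : 4 * a ^ 2 * T + 5 * a ^ 3 * T ^ 2 * M ≤ 9 * a ^ 3 * T ^ 2 * M := by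
    have : a ^ 2 * T ≤ a ^ 3 * T ^ 2 * M := by
      have h1 : a ^ 2 * T * 1 ≤ a ^ 2 * T * (a * T * M) := by
        apply mul_le_mul_of_nonneg_left _ (by positivity)
        nlinarith
      calc _ = a ^ 2 * T * 1 := by ring
        _ ≤ _ := h1
        _ = _ := by ring
    linarith
  have t3 : 1 / (L:ℝ) * (|u * (G1 (b * q / q) * u)| + |u * (G1 (W / q) * u)| + ∫ x in (b * q)..(W:ℝ), |u * (G2 (x / q) * u * u)|) ≤
     1 / (L:ℝ) * (9 * a ^ 3 * T ^ 2 * M) := mul_le_mul_of_nonneg_left (by linarith) (by positivity)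
  have t4 : 1 / (L:ℝ) * (9 * a ^ 3 * T ^ 2 * M) = 9 * a ^ 3 * T ^ 2 * M / L := by ring
  linarith

theorem osc_sum (H : Osc A A1 A2 ℓ g g1 α B a) {T b C0 M : ℝ} {R L : ℕ} {W : ℕ → ℕ} {m : ℕ → ℝ}
    (hT : 1 ≤ T) (hb : α ≤ b) (hB : b + 1 ≤ B) (hC0 : 0 ≤ C0) (hR : 1 ≤ R) (hL : 1 ≤ L) (hM : 1 ≤ M)
    (hRM : (R:ℝ) ≤ M) (hML : M ^ 2 * T ^ 2 ≤ L)
    (hW : ∀ q ∈ Finset.Icc 1 R, b * q ≤ W q ∧ (W q:ℝ) ≤ M)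
    (hN1 : 1 ≤ T * g b / (2 * π)) (hNR : T * g b / (2 * π) ≤ R) (hNL : T * g b / (2 * π) ≤ L)
    (hsad : ∀ q ∈ Finset.Icc 1 R, ∀ n : ℕ, q ≤ n → (n:ℝ) ≤ T * g b / (2 * π) →
      |(∫ t in α..(W q / q : ℝ), A t * sin (2 * π * n * t - T * ℓ t)) - m n| ≤ C0 / n) :
    |(∑ q ∈ Finset.Icc 1 R, ((∑ j ∈ Finset.Ioc ⌊b * q⌋₊ (W q), (1 / (q:ℝ)) * (A (j / q) * sin (T * ℓ (j / q)))) -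
      (∫ t in b..(W q / q : ℝ), A t * sin (T * ℓ t)))) +
      ∑ n ∈ Finset.Icc 1 ⌊T * g b / (2 * π)⌋₊, (n.divisors.card : ℝ) * m n| ≤
    (3 * a + C0) * ((1 + log R) * (1 + log L)) + 9 * a ^ 3 + 5 * a ^ 2 *
    (2 * ((1 + log R) * (1 + log L)) + 2 * (4 * √(2 * (T * g b / (2 * π))) / √T + 4 * (1 + log (2 * (T * g b / (2 * π)))) ^ 2)) := by
  have ha := H.ha
  have hα := H.hα
  have hT0 : 0 < T := by linarith
  have hsT : 0 < √T := Real.sqrt_pos.2 hT0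
  set N := T * g b / (2 * π) with hN
  have hTg : T * g b = 2 * π * N := by rw [hN]; field_simp
  have hL0 : (0:ℝ) < L := by exact_mod_cast hL
  set S : ℕ → ℝ := fun q => (∑ j ∈ Finset.Ioc ⌊b * q⌋₊ (W q), (1 / (q:ℝ)) * (A (j / q) * sin (T * ℓ (j / q)))) -
      (∫ t in b..(W q / q : ℝ), A t * sin (T * ℓ t)) with hS
  have hKN : ∀ n : ℕ, n ≤ ⌊N⌋₊ ↔ (n:ℝ) ≤ N := fun n => Nat.le_floor_iff (by linarith)
  have hfR : ⌊N⌋₊ ≤ R := by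
    have : ((⌊N⌋₊ : ℕ) : ℝ) ≤ R := (Nat.floor_le (by linarith)).trans hNR
    exact_mod_cast this
  have hfL : ⌊N⌋₊ ≤ L := by
    have : ((⌊N⌋₊ : ℕ) : ℝ) ≤ L := (Nat.floor_le (by linarith)).trans hNL
    exact_mod_cast this
  rw [div_reindex hfR hfL m]
  -- per (q,l) estimate
  have key : ∀ q ∈ Finset.Icc 1 R, ∀ l ∈ Finset.Icc 1 L,
      |2 * (∫ t in b..(W q / q : ℝ), A t * sin (T * ℓ t) * cos (2 * π * (q * l) * t)) +
        (if q * l ≤ ⌊N⌋₊ then m (q * l) else 0)| ≤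
      (a + C0) * (1 / (q:ℝ) * (1 / l)) + 5 * a ^ 2 * (1 / max (√T) |(q:ℝ) * l - N|) := by
    intro q hq l hl
    have hq1 := (Finset.mem_Icc.1 hq).1
    have hl1 := (Finset.mem_Icc.1 hl).1
    have hq0 : (0:ℝ) < q := by exact_mod_cast hq1
    have hl0 : (0:ℝ) < l := by exact_mod_cast hl1
    obtain ⟨hW1, hW2⟩ := hW q hq
    have hbZ : b ≤ (W q / q : ℝ) := by rwa [le_div_iff₀ hq0]
    set Z := (W q / q : ℝ)
    set ν : ℝ := 2 * π * (q * l) with hν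
    have hν0 : 0 < ν := by positivity
    have i1 := H.plus hT0 hν0 hb hbZ
    have ci1 : IntervalIntegrable (fun t => A t * sin (ν * t + T * ℓ t)) volume b Z := by
      have := H.intble (-T) ν hb (hb.trans hbZ)
      simpa only [neg_mul, sub_neg_eq_add] using this
    have split : 2 * (∫ t in b..Z, A t * sin (T * ℓ t) * cos (ν * t)) =
        (∫ t in b..Z, A t * sin (ν * t + T * ℓ t)) - ∫ t in b..Z, A t * sin (ν * t - T * ℓ t) := by
      rw [← intervalIntegral.integral_sub ci1 (H.intble T ν hb (hb.trans hbZ)), ← intervalIntegral.integral_const_mul]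
      apply intervalIntegral.integral_congr
      intro t _
      simp only [sin_add, sin_sub]
      ring
    rw [split]
    have i1' : 4 * a / ν ≤ a * (1 / (q:ℝ) * (1 / l)) := by
      rw [hν, div_le_iff₀ hν0]
      have : a * (1 / (q:ℝ) * (1 / l)) * ν = a * (2 * π) := by rw [hν]; field_simp
      rw [this]
      nlinarith [pi_gt_three]
    have mx : ∀ {x d : ℝ}, |x| ≤ 5 * a ^ 2 / √T → |x| * d ≤ 5 * a ^ 2 → 2 * π * |(q:ℝ) * l - N| ≤ d →
        |x| ≤ 5 * a ^ 2 * (1 / max (√T) |(q:ℝ) * l - N|) := by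
      intro x d h1 h2 h3
      rw [mul_one_div, le_div_iff₀ (lt_max_of_lt_left hsT)]
      rcases max_cases (√T) |(q:ℝ) * l - N| with h | h
      · rw [h.1]; rwa [le_div_iff₀ hsT] at h1
      · rw [h.1]
        refine le_trans (mul_le_mul_of_nonneg_left ?_ (abs_nonneg x)) h2
        refine le_trans ?_ h3
        nlinarith [pi_gt_three, abs_nonneg ((q:ℝ) * l - N)]
    have hc : (a + C0) * (1 / (q:ℝ) * (1 / l)) = a * (1 / (q:ℝ) * (1 / l)) + C0 / (q * l : ℝ) := by
      field_simp
    have hc0 : 0 ≤ C0 / (q * l : ℝ) := by positivity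
    rw [hc]
    have hcast : ((q * l : ℕ) : ℝ) = q * l := by push_cast; ring
    by_cases hn : q * l ≤ ⌊N⌋₊
    · rw [if_pos hn]
      rw [hKN, hcast] at hn
      have hν' : ν ≤ T * g b := by
        rw [hTg, hν]; exact mul_le_mul_of_nonneg_left hn (by positivity)
      have s1 := hsad q hq (q * l) (Nat.le_mul_of_pos_right q hl1) (by rw [hcast]; exact hn)
      rw [hcast] at s1
      have s2 := H.left hT hb (by linarith) hν'
      have s3 := mx s2.1 s2.2 (by rw [hTg, hν, ← mul_sub, abs_of_nonpos (by linarith)]; simp)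
      have s4 := intervalIntegral.integral_add_adjacent_intervals (H.intble T ν le_rfl hb) (H.intble T ν hb (hb.trans hbZ))
      rw [← s4] at s1
      rw [abs_le] at s1 s3 i1 ⊢
      constructor <;> linarith [s1.1, s1.2, s3.1, s3.2, i1.1, i1.2]
    · rw [if_neg hn]
      rw [hKN, hcast] at hn
      push Not at hn
      have hν' : T * g b ≤ ν := by
        rw [hTg, hν]; exact mul_le_mul_of_nonneg_left hn.le (by positivity)
      have s2 := H.right hT hb hbZ hB hν'
      have s3 := mx s2.1 s2.2 (by rw [hTg, hν, ← mul_sub, abs_of_pos (by linarith)])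
      rw [abs_le] at s3 i1 ⊢
      constructor <;> linarith [s3.1, s3.2, i1.1, i1.2]
  have perq : ∀ q ∈ Finset.Icc 1 R, |S q + ∑ l ∈ Finset.Icc 1 L, (if q * l ≤ ⌊N⌋₊ then m (q * l) else 0)| ≤
      2 * a * (1 + log L) * (1 / q) + 9 * a ^ 3 * T ^ 2 * M / L +
      ∑ l ∈ Finset.Icc 1 L, ((a + C0) * (1 / (q:ℝ) * (1 / l)) + 5 * a ^ 2 * (1 / max (√T) |(q:ℝ) * l - N|)) := by
    intro q hq
    have h1 := H.one_q hT hb (Finset.mem_Icc.1 hq).1 hL hM (hW q hq).1 (hW q hq).2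
    have h2 := (Finset.abs_sum_le_sum_abs _ _).trans (Finset.sum_le_sum (key q hq))
    rw [Finset.sum_add_distrib, ← Finset.mul_sum] at h2
    rw [abs_le] at h1 h2 ⊢
    simp only [hS]
    constructor <;> linarith [h1.1, h1.2, h2.1, h2.2]
  rw [← Finset.sum_add_distrib]
  refine (Finset.abs_sum_le_sum_abs _ _).trans ((Finset.sum_le_sum perq).trans ?_)
  simp only [Finset.sum_add_distrib, ← Finset.mul_sum]
  rw [← Finset.sum_mul]
  have d1 := div_sum (R := R) (L := L) hN1 hsT hR hL
  have l1 := harm_sum_le R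
  have l2 := harm_sum_le L
  have lR := log_natCast_nonneg R
  have lL := log_natCast_nonneg L
  have p1 : 0 ≤ ∑ l ∈ Finset.Icc 1 L, 1 / (l:ℝ) := Finset.sum_nonneg fun _ _ => by positivity
  have q1 : 2 * a * (1 + log L) * ∑ q ∈ Finset.Icc 1 R, 1 / (q:ℝ) ≤ 2 * a * (1 + log L) * (1 + log R) := by gcongr
  have q2 : ∑ q ∈ Finset.Icc 1 R, 9 * a ^ 3 * T ^ 2 * M / L ≤ 9 * a ^ 3 := by
    rw [Finset.sum_const, Nat.card_Icc, nsmul_eq_mul, Nat.add_sub_cancel, ← mul_div_assoc, div_le_iff₀ hL0]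
    have : (R:ℝ) * (9 * a ^ 3 * T ^ 2 * M) ≤ M * (9 * a ^ 3 * T ^ 2 * M) := by gcongr
    have : M * (9 * a ^ 3 * T ^ 2 * M) = 9 * a ^ 3 * (M ^ 2 * T ^ 2) := by ring
    have : 9 * a ^ 3 * (M ^ 2 * T ^ 2) ≤ 9 * a ^ 3 * L := by gcongr
    linarith
  have q3 : (a + C0) * ((∑ q ∈ Finset.Icc 1 R, 1 / (q:ℝ)) * ∑ l ∈ Finset.Icc 1 L, 1 / (l:ℝ)) ≤ (a + C0) * ((1 + log R) * (1 + log L)) := by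
    gcongr
  have q4 := mul_le_mul_of_nonneg_left d1 (by positivity : 0 ≤ 5 * a ^ 2)
  have : (3 * a + C0) * ((1 + log R) * (1 + log L)) = 2 * a * (1 + log L) * (1 + log R) + (a + C0) * ((1 + log R) * (1 + log L)) := by ring
  linarith
end Osc
end Atk

namespace Atk

noncomputable def fA (s : ℝ) : ℝ := exp (-(1/2) * log s) / log s
noncomputable def fA1 (s : ℝ) : ℝ := fA s * (-(1/2) * s⁻¹ - s⁻¹ * (log s)⁻¹)
noncomputable def fA2 (s : ℝ) : ℝ := fA1 s * (-(1/2) * s⁻¹ - s⁻¹ * (log s)⁻¹) +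
  fA s * ((1/2) * (s⁻¹ * s⁻¹) + (s⁻¹ * s⁻¹) * (log s)⁻¹ + (s⁻¹ * s⁻¹) * ((log s)⁻¹ * (log s)⁻¹))

theorem far_osc {α B : ℝ} (hα : 1 < α) (hB : 1 ≤ B) :
    ∃ a, Osc fA fA1 fA2 log (fun s => s⁻¹) (fun s => -(s⁻¹ * s⁻¹)) α B a := by
  have hl : 0 < log α := log_pos hα
  set v := (log α)⁻¹ with hv
  have hv0 : 0 < v := by positivity
  -- the uniform constant
  set a := 1 + v + v * (1/2 + v) + (v * (1/2 + v) * (1/2 + v) + v * (1/2 + v + v * v)) + B * B with ha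
  have s0 : ∀ s, α ≤ s → 0 < s := fun s hs => by linarith
  have si0 : ∀ s, α ≤ s → 0 < s⁻¹ := fun s hs => inv_pos.2 (s0 s hs)
  have si1 : ∀ s, α ≤ s → s⁻¹ ≤ 1 := fun s hs => inv_le_one_of_one_le₀ (by linarith)
  have ls : ∀ s, α ≤ s → log α ≤ log s := fun s hs => log_le_log (by linarith) hs
  have l0 : ∀ s, α ≤ s → 0 < log s := fun s hs => hl.trans_le (ls s hs)
  have w0 : ∀ s, α ≤ s → 0 < (log s)⁻¹ := fun s hs => inv_pos.2 (l0 s hs)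
  have w1 : ∀ s, α ≤ s → (log s)⁻¹ ≤ v := fun s hs => inv_anti₀ hl (ls s hs)
  have bA0 : ∀ s, α ≤ s → 0 ≤ fA s := fun s hs => by
    have := l0 s hs
    unfold fA; positivity
  have bA : ∀ s, α ≤ s → fA s ≤ v := fun s hs => by
    have h1 : exp (-(1/2) * log s) ≤ 1 := by
      rw [exp_le_one_iff]; nlinarith [l0 s hs]
    calc fA s = exp (-(1/2) * log s) * (log s)⁻¹ := div_eq_mul_inv _ _
      _ ≤ 1 * v := mul_le_mul h1 (w1 s hs) (w0 s hs).le zero_le_one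
      _ = v := one_mul v
  have dA : ∀ s, α ≤ s → HasDerivAt fA (fA1 s) s := fun s hs => by
    have h1 := hasDerivAt_log (s0 s hs).ne'
    have h2 := (h1.const_mul (-(1/2))).exp.div h1 (l0 s hs).ne'
    refine h2.congr_deriv ?_
    have := (l0 s hs).ne'
    have := (s0 s hs).ne'
    unfold fA1 fA
    field_simp
  have dk : ∀ s, α ≤ s → HasDerivAt (fun s => -(1/2) * s⁻¹ - s⁻¹ * (log s)⁻¹)
      ((1/2) * (s⁻¹ * s⁻¹) + (s⁻¹ * s⁻¹) * (log s)⁻¹ + (s⁻¹ * s⁻¹) * ((log s)⁻¹ * (log s)⁻¹)) s := fun s hs => by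
    have h0 := hasDerivAt_inv (s0 s hs).ne'
    have h1 := (hasDerivAt_log (s0 s hs).ne').inv (l0 s hs).ne'
    refine ((h0.const_mul (-(1/2))).sub (h0.mul h1)).congr_deriv ?_
    have := (l0 s hs).ne'
    have := (s0 s hs).ne'
    simp only [Pi.inv_apply]
    field_simp
    ring
  have dA1 : ∀ s, α ≤ s → HasDerivAt fA1 (fA2 s) s := fun s hs => (dA s hs).mul (dk s hs)
  have bk : ∀ s, α ≤ s → |-(1/2) * s⁻¹ - s⁻¹ * (log s)⁻¹| ≤ 1/2 + v := fun s hs => by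
    have h1 := si0 s hs
    have h2 := si1 s hs
    have h3 := w0 s hs
    have h4 := w1 s hs
    have : s⁻¹ * (log s)⁻¹ ≤ 1 * v := mul_le_mul h2 h4 h3.le zero_le_one
    have : 0 < s⁻¹ * (log s)⁻¹ := by positivity
    rw [abs_le]; constructor <;> linarith
  have bk2 : ∀ s, α ≤ s → |(1/2) * (s⁻¹ * s⁻¹) + (s⁻¹ * s⁻¹) * (log s)⁻¹ + (s⁻¹ * s⁻¹) * ((log s)⁻¹ * (log s)⁻¹)| ≤ 1/2 + v + v * v := fun s hs => by
    have h1 := si0 s hs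
    have h2 := si1 s hs
    have h3 := w0 s hs
    have h4 := w1 s hs
    have e1 : s⁻¹ * s⁻¹ ≤ 1 * 1 := mul_le_mul h2 h2 h1.le zero_le_one
    have e2 : (log s)⁻¹ * (log s)⁻¹ ≤ v * v := mul_le_mul h4 h4 h3.le hv0.le
    have e3 : s⁻¹ * s⁻¹ * (log s)⁻¹ ≤ 1 * 1 * v := mul_le_mul e1 h4 h3.le (by norm_num)
    have e4 : s⁻¹ * s⁻¹ * ((log s)⁻¹ * (log s)⁻¹) ≤ 1 * 1 * (v * v) := mul_le_mul e1 e2 (by positivity) (by norm_num)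
    rw [abs_of_nonneg (by positivity)]
    linarith
  have mm : ∀ {x y X Y : ℝ}, |x| ≤ X → |y| ≤ Y → |x * y| ≤ X * Y := by
    intro x y X Y h1 h2
    rw [abs_mul]; exact mul_le_mul h1 h2 (abs_nonneg _) ((abs_nonneg _).trans h1)
  have bA' : ∀ s, α ≤ s → |fA s| ≤ v := fun s hs => by rw [abs_of_nonneg (bA0 s hs)]; exact bA s hs
  have bA1 : ∀ s, α ≤ s → |fA1 s| ≤ v * (1/2 + v) := fun s hs => mm (bA' s hs) (bk s hs)
  have bA2 : ∀ s, α ≤ s → |fA2 s| ≤ v * (1/2 + v) * (1/2 + v) + v * (1/2 + v + v * v) := fun s hs =>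
    (abs_add_le _ _).trans (add_le_add (mm (bA1 s hs) (bk s hs)) (mm (bA' s hs) (bk2 s hs)))
  have p1 : 0 ≤ v * (1/2 + v) := by positivity
  have p2 : 0 ≤ v * (1/2 + v) * (1/2 + v) + v * (1/2 + v + v * v) := by positivity
  have p3 : 0 ≤ B * B := by positivity
  refine ⟨a, ⟨by linarith, by linarith, dA, dA1, ?_, bA0, fun s hs => (bA s hs).trans (by linarith), ?_, fun s hs => (bA1 s hs).trans (by linarith),
    fun s hs => (bA2 s hs).trans (by linarith), fun s hs => hasDerivAt_log (s0 s hs).ne', ?_, ?_, si0, fun s hs => (si1 s hs).trans (by linarith), ?_, ?_, ?_⟩⟩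
  · have cA : ContinuousOn fA (Set.Ici α) := fun x hx => (dA x hx).continuousAt.continuousWithinAt
    have cA1 : ContinuousOn fA1 (Set.Ici α) := fun x hx => (dA1 x hx).continuousAt.continuousWithinAt
    have ci : ContinuousOn (fun s : ℝ => s⁻¹) (Set.Ici α) := continuousOn_id.inv₀ fun x hx => (s0 x hx).ne'
    have cl : ContinuousOn (fun s : ℝ => (log s)⁻¹) (Set.Ici α) :=
      (continuousOn_id.log fun x hx => (s0 x hx).ne').inv₀ fun x hx => (l0 x hx).ne'
    unfold fA2
    fun_prop
  · intro s hs
    have h1 := si0 s hs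
    have h3 := w0 s hs
    apply mul_nonpos_of_nonneg_of_nonpos (bA0 s hs)
    have : 0 < s⁻¹ * (log s)⁻¹ := by positivity
    linarith
  · intro s hs
    exact (hasDerivAt_inv (s0 s hs).ne').congr_deriv (by rw [sq, mul_inv])
  · have ci : ContinuousOn (fun s : ℝ => s⁻¹) (Set.Ici α) := continuousOn_id.inv₀ fun x hx => (s0 x hx).ne'
    exact (ci.mul ci).neg
  · intro s hs
    have := si0 s hs
    have : 0 < s⁻¹ * s⁻¹ := by positivity
    linarith
  · intro s hs
    have h1 := si0 s hs
    have h2 := si1 s hs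
    rw [abs_neg, abs_of_pos (by positivity)]
    nlinarith
  · intro s hs hsB
    have h1 := s0 s hs
    have : 1 / a ≤ s⁻¹ * s⁻¹ := by
      rw [← mul_inv, ← one_div]
      apply one_div_le_one_div_of_le (by positivity)
      nlinarith
    linarith

theorem far_saddle {α η B a T s0 Z : ℝ} {n : ℕ} {A1 A2 : ℝ → ℝ} (hα : 1 < α) (hη0 : 0 < η) (hη : η ≤ 1/10)
    (H : Osc fA A1 A2 log (fun s => s⁻¹) (fun s => -(s⁻¹ * s⁻¹)) α B a) (hn : 1 ≤ n) (hT : 0 < T)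
    (hs : s0 = T / (2 * π * n)) (h1 : α ≤ (1 - 2 * η) * s0) (hZ : 2 * s0 ≤ Z) :
    |(∫ t in α..Z, fA t * sin (2 * π * n * t - T * log t)) -
      fA s0 * √(2 * π / (T / s0 ^ 2)) * sin (2 * π * n * s0 - T * log s0 + π / 4)| ≤
      (10 / log α / η + 8 * a / η) / n := by
  have hn0 : (0:ℝ) < n := by exact_mod_cast hn
  have hs0 : 0 < s0 := by rw [hs]; positivity
  have hlα : 0 < log α := log_pos hα
  have hTn : T = 2 * π * n * s0 := by rw [hs]; field_simp
  have ha := H.ha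
  have hball : ∀ z ∈ Metric.ball (s0:ℂ) (2 * (η * s0)), α ≤ z.re ∧ α ≤ ‖z‖ ∧ 8 * (η * s0) ≤ ‖z‖ := by
    intro z hz
    rw [mem_ball_iff_norm] at hz
    have h2 : |(z - s0).re| ≤ ‖z - s0‖ := Complex.abs_re_le_norm _
    have h3 : z.re ≤ ‖z‖ := (le_abs_self _).trans (Complex.abs_re_le_norm z)
    rw [Complex.sub_re, Complex.ofReal_re, abs_le] at h2
    refine ⟨by nlinarith, by nlinarith, by nlinarith⟩
  have hslit : ∀ z ∈ Metric.ball (s0:ℂ) (2 * (η * s0)), z ∈ Complex.slitPlane := fun z hz =>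
    Or.inl (by linarith [(hball z hz).1])
  have hlog : ∀ z ∈ Metric.ball (s0:ℂ) (2 * (η * s0)), log α ≤ ‖Complex.log z‖ := fun z hz => by
    have h2 : (Complex.log z).re ≤ ‖Complex.log z‖ := (le_abs_self _).trans (Complex.abs_re_le_norm _)
    rw [Complex.log_re] at h2
    exact (log_le_log (by linarith) (hball z hz).2.1).trans h2
  have hlog0 : ∀ z ∈ Metric.ball (s0:ℂ) (2 * (η * s0)), Complex.log z ≠ 0 := fun z hz => by
    rw [← norm_pos_iff]; linarith [hlog z hz]
  have hpos : ∀ x : ℝ, |x - s0| ≤ η * s0 → 0 < x := fun x hx => by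
    rw [abs_le] at hx; nlinarith
  have hIcc : ∀ x ∈ Set.Icc (s0 - η * s0) (s0 + η * s0), α ≤ x := fun x hx => by
    have := hx.1; nlinarith
  have key := sp (Ac := fun z => Complex.exp (-(1/2) * Complex.log z) / Complex.log z)
    (φc := fun z => (2 * π * n : ℝ) * z - (T:ℂ) * Complex.log z) (φ' := fun z => (2 * π * n : ℝ) - (T:ℂ) * z⁻¹)
    (A := fA) (φ := fun t => 2 * π * n * t - T * log t) (x0 := s0) (δ := η * s0) (φ2 := T / s0 ^ 2) (a := (log α)⁻¹)
    (by positivity) (by positivity) (by positivity) ?_ ?_ ?_ ?_ ?_ ?_ ?_ ?_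
  · have f1 := H.full (T := T) (ν := 2 * π * n) (Z := Z) (x0 := s0) (δ := η * s0) (μ := n * η) hT (by positivity) (by positivity)
      (by nlinarith) (by nlinarith) ?_ ?_ key
    · refine f1.trans ?_
      rw [add_div]
      apply add_le_add
      · have e1 : T / s0 ^ 2 * (η * s0) = 2 * π * n * η := by rw [hTn]; field_simp
        rw [e1, div_le_div_iff₀ (by positivity) hn0]
        have e2 : 10 / log α / η * (2 * π * n * η) = (log α)⁻¹ * n * (20 * π) := by field_simp; ring
        rw [e2]
        have : 0 < (log α)⁻¹ * n := by positivity
        nlinarith [pi_gt_three]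
      · apply le_of_eq; field_simp
    · have h3 : 0 < 1 - η := by linarith
      have e1 : 2 * π * n - T * (s0 - η * s0)⁻¹ = -(2 * π * n * (η / (1 - η))) := by
        rw [hTn]
        have : s0 - η * s0 = s0 * (1 - η) := by ring
        rw [this]; field_simp; ring
      rw [e1, neg_le_neg_iff]
      have : η ≤ η / (1 - η) := by rw [le_div_iff₀ h3]; nlinarith
      have h5 : 1 * n * η ≤ 2 * π * n * (η / (1 - η)) := by
        gcongr
        nlinarith [pi_gt_three]
      linarith
    · have h3 : 0 < 1 + η := by linarith
      have e1 : 2 * π * n - T * (s0 + η * s0)⁻¹ = (2 * π * n * (η / (1 + η))) := by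
        rw [hTn]
        have : s0 + η * s0 = s0 * (1 + η) := by ring
        rw [this]; field_simp; ring
      rw [e1]
      have : η / 2 ≤ η / (1 + η) := by gcongr; linarith
      have h5 : 2 * n * (η / 2) ≤ 2 * π * n * (η / (1 + η)) := by
        gcongr
        nlinarith [pi_gt_three]
      linarith
  · intro z hz
    have h2 : DifferentiableAt ℂ Complex.log z := (Complex.differentiableAt_log (hslit z hz))
    exact ((h2.const_mul _).cexp.div h2 (hlog0 z hz)).differentiableWithinAt
  · intro z hz
    have h2 := Complex.hasDerivAt_log (hslit z hz)
    exact (((hasDerivAt_id z).const_mul _).sub (h2.const_mul (T:ℂ))).congr_deriv (by simp)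
  · intro z hz
    have hz0 : z ≠ 0 := by
      rw [← norm_pos_iff]; linarith [(hball z hz).2.1]
    have hs0' : (s0:ℂ) ≠ 0 := by exact_mod_cast hs0.ne'
    have e1 : ((2 * π * n : ℝ) : ℂ) - (T:ℂ) * z⁻¹ - ((T / s0 ^ 2 : ℝ) : ℂ) * (z - s0) =
        -(((T / s0 ^ 2 : ℝ) : ℂ) * (z - s0) ^ 2 * z⁻¹) := by
      have : ((2 * π * n : ℝ) : ℂ) = T / s0 := by
        rw [eq_div_iff hs0']
        exact_mod_cast hTn.symm
      rw [this]
      push_cast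
      field_simp
      ring
    rw [e1, norm_neg, norm_mul, norm_mul, norm_pow, norm_inv, Complex.norm_real, Real.norm_eq_abs, abs_of_pos (by positivity)]
    have h3 : ‖z‖⁻¹ ≤ (8 * (η * s0))⁻¹ := inv_anti₀ (by positivity) (hball z hz).2.2
    calc _ ≤ T / s0 ^ 2 * ‖z - s0‖ ^ 2 * (8 * (η * s0))⁻¹ := by gcongr
      _ = _ := by ring
  · intro z hz
    rw [norm_div, Complex.norm_exp]
    have h2 := hlog z hz
    have h3 : (-(1/2) * Complex.log z).re ≤ 0 := by
      have : (-(1/2) * Complex.log z).re = -(1/2) * log ‖z‖ := by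
        have : (-(1/2) : ℂ) = ((-(1/2) : ℝ) : ℂ) := by push_cast; ring
        rw [this, Complex.re_ofReal_mul, Complex.log_re]
      rw [this]
      have := log_le_log (by linarith) (hball z hz).2.1
      linarith
    rw [← one_div]
    exact div_le_div₀ zero_le_one (exp_le_one_iff.2 h3) hlα h2
  · intro x hx
    have := (hpos x hx).le
    simp only [fA]
    rw [← Complex.ofReal_log this]
    push_cast
    rfl
  · intro x hx
    have := (hpos x hx).le
    rw [← Complex.ofReal_log this]
    push_cast
    rfl
  · exact fun x hx => (H.dA x (hIcc x hx)).continuousAt.continuousWithinAt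
  · have : ContinuousOn log (Set.Icc (s0 - η * s0) (s0 + η * s0)) := fun x hx => (H.dl x (hIcc x hx)).continuousAt.continuousWithinAt
    fun_prop
end Atk

namespace Atk

noncomputable def nl (y : ℝ) : ℝ := log y - log (1 + y)
noncomputable def ng (y : ℝ) : ℝ := (y * (1 + y))⁻¹
noncomputable def ng1 (y : ℝ) : ℝ := -((2 * y + 1) * ng y * ng y)
noncomputable def nA (y : ℝ) : ℝ := exp (-(1/2) * (log y + log (1 + y))) / (log (1 + y) - log y)
noncomputable def nk (y : ℝ) : ℝ := (log (1 + y) - log y)⁻¹ - (2 * y + 1) / 2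
noncomputable def nA1 (y : ℝ) : ℝ := nA y * (nk y * ng y)
noncomputable def nA2 (y : ℝ) : ℝ := nA1 y * (nk y * ng y) + nA y * ((nA y ^ 2 - 1) * ng y + nk y * ng1 y)

theorem nL_lower {y : ℝ} (hy : 0 < y) : 2 / (2 * y + 1) ≤ log (1 + y) - log y := by
  have := Real.le_log_one_add_of_nonneg (x := 1 / y) (by positivity)
  have e1 : log (1 + y) - log y = log (1 + 1 / y) := by
    rw [← log_div (by positivity) hy.ne']
    congr 1; field_simp; ring
  have e2 : 2 * (1 / y) / (1 / y + 2) = 2 / (2 * y + 1) := by field_simp; ring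
  rw [e1, ← e2]; exact this

theorem nL_upper {y : ℝ} (hy : 0 < y) : log (1 + y) - log y ≤ 1 / y := by
  have e1 : log (1 + y) - log y = log (1 + 1 / y) := by
    rw [← log_div (by positivity) hy.ne']
    congr 1; field_simp; ring
  rw [e1]
  have := log_le_sub_one_of_pos (show 0 < 1 + 1 / y by positivity)
  linarith

theorem nA_sq {y : ℝ} (hy : 0 < y) : nA y ^ 2 = ng y * ((log (1 + y) - log y)⁻¹ * (log (1 + y) - log y)⁻¹) := by
  unfold nA ng
  rw [div_pow, ← exp_nat_mul]
  have : ((2:ℕ):ℝ) * (-(1/2) * (log y + log (1 + y))) = -log (y * (1 + y)) := by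
    rw [log_mul hy.ne' (by positivity)]; push_cast; ring
  rw [this, exp_neg, exp_log (by positivity)]
  rw [div_eq_mul_inv, sq, mul_inv (log (1 + y) - log y)]

theorem near_osc {α B : ℝ} (hα : 0 < α) (hB : 1 ≤ B) :
    ∃ a, Osc nA nA1 nA2 nl ng ng1 α B a := by
  set p := (α * (1 + α))⁻¹ with hp
  have hp0 : 0 < p := by positivity
  set r := 2 / α with hr
  have hr0 : 0 < r := by positivity
  -- the uniform constant
  set X := (1 + p) * (1 / 2 * p) with hX
  set a := 1 + p + X + (X * (1 / 2 * p) + (1 + p) * (((1 + p) ^ 2 + 1) * p + 1 / 2 * (r * p))) + r * p + (B * (1 + B)) ^ 2 with ha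
  have s0 : ∀ s, α ≤ s → 0 < s := fun s hs => by linarith
  have Ll : ∀ s, α ≤ s → 2 / (2 * s + 1) ≤ log (1 + s) - log s := fun s hs => nL_lower (s0 s hs)
  have L0 : ∀ s, α ≤ s → 0 < log (1 + s) - log s := fun s hs => by
    have := s0 s hs
    exact (by positivity : 0 < 2 / (2 * s + 1)).trans_le (Ll s hs)
  have Lu : ∀ s, α ≤ s → log (1 + s) - log s ≤ 1 / s := fun s hs => nL_upper (s0 s hs)
  have w1 : ∀ s, α ≤ s → (log (1 + s) - log s)⁻¹ ≤ (2 * s + 1) / 2 := fun s hs => by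
    have := s0 s hs
    have := inv_anti₀ (by positivity) (Ll s hs)
    rwa [inv_div] at this
  have w2 : ∀ s, α ≤ s → s ≤ (log (1 + s) - log s)⁻¹ := fun s hs => by
    have := inv_anti₀ (L0 s hs) (Lu s hs)
    rwa [one_div, inv_inv] at this
  have g0 : ∀ s, α ≤ s → 0 < ng s := fun s hs => by
    have := s0 s hs
    unfold ng; positivity
  have gp : ∀ s, α ≤ s → ng s ≤ p := fun s hs => by
    have := s0 s hs
    apply inv_anti₀ (by positivity)
    gcongr
  have bA0 : ∀ s, α ≤ s → 0 ≤ nA s := fun s hs => by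
    have := L0 s hs
    unfold nA; positivity
  have bA : ∀ s, α ≤ s → nA s ≤ 1 + p := fun s hs => by
    have h0 := s0 s hs
    have h1 : nA s ^ 2 ≤ (1 + p) ^ 2 := by
      rw [nA_sq h0]
      have hw := w1 s hs
      have hw0 : 0 < (log (1 + s) - log s)⁻¹ := inv_pos.2 (L0 s hs)
      have h2 : ng s * ((log (1 + s) - log s)⁻¹ * (log (1 + s) - log s)⁻¹) ≤ ng s * ((2 * s + 1) / 2 * ((2 * s + 1) / 2)) := by
        have := g0 s hs
        gcongr
      have h3 : ng s * ((2 * s + 1) / 2 * ((2 * s + 1) / 2)) = 1 + ng s / 4 := by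
        unfold ng
        field_simp
        ring
      have h4 := gp s hs
      nlinarith
    exact le_of_sq_le_sq h1 (by positivity)
  have dL : ∀ s, α ≤ s → HasDerivAt (fun s => log (1 + s) - log s) (-ng s) s := fun s hs => by
    have h0 := s0 s hs
    have h1 := hasDerivAt_log h0.ne'
    have h2 : HasDerivAt (fun s : ℝ => log (1 + s)) (1 / (1 + s)) s :=
      ((hasDerivAt_id s).const_add 1).log (by simp; positivity)
    refine (h2.sub h1).congr_deriv ?_
    unfold ng
    field_simp
    ring
  have dl : ∀ s, α ≤ s → HasDerivAt nl (ng s) s := fun s hs => by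
    have := (dL s hs).neg
    refine (this.congr_deriv (neg_neg _)).congr_of_eventuallyEq ?_
    refine Filter.Eventually.of_forall fun x => ?_
    simp [nl]
  have dg : ∀ s, α ≤ s → HasDerivAt ng (ng1 s) s := fun s hs => by
    have h0 := s0 s hs
    have h1 := ((hasDerivAt_id s).mul ((hasDerivAt_id s).const_add 1)).inv (by simp; constructor <;> positivity)
    refine h1.congr_deriv ?_
    unfold ng1 ng
    simp
    field_simp
    ring
  have dA : ∀ s, α ≤ s → HasDerivAt nA (nA1 s) s := fun s hs => by
    have h0 := s0 s hs
    have h1 := hasDerivAt_log h0.ne'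
    have h2 : HasDerivAt (fun s : ℝ => log (1 + s)) (1 / (1 + s)) s :=
      ((hasDerivAt_id s).const_add 1).log (by simp; positivity)
    have h3 := ((h1.add h2).const_mul (-(1/2))).exp.div (dL s hs) (L0 s hs).ne'
    refine h3.congr_deriv ?_
    have := (L0 s hs).ne'
    unfold nA1 nA nk ng
    simp only [Pi.add_apply]
    field_simp
    ring
  have dk : ∀ s, α ≤ s → HasDerivAt nk (nA s ^ 2 - 1) s := fun s hs => by
    have h0 := s0 s hs
    have h1 := (dL s hs).inv (L0 s hs).ne'
    have h2 : HasDerivAt (fun s : ℝ => (2 * s + 1) / 2) 1 s :=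
      ((((hasDerivAt_id s).const_mul 2).add_const 1).div_const 2).congr_deriv (by norm_num)
    refine (h1.sub h2).congr_deriv ?_
    rw [nA_sq h0]
    have := (L0 s hs).ne'
    field_simp
  have dA1 : ∀ s, α ≤ s → HasDerivAt nA1 (nA2 s) s := fun s hs => (dA s hs).mul ((dk s hs).mul (dg s hs))
  have kn : ∀ s, α ≤ s → nk s ≤ 0 := fun s hs => by
    have := w1 s hs
    unfold nk; linarith
  have bk : ∀ s, α ≤ s → |nk s| ≤ 1/2 := fun s hs => by
    have := w2 s hs
    have := kn s hs
    rw [abs_of_nonpos this]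
    unfold nk; linarith
  have mm : ∀ {x y X Y : ℝ}, |x| ≤ X → |y| ≤ Y → |x * y| ≤ X * Y := by
    intro x y X Y h1 h2
    rw [abs_mul]; exact mul_le_mul h1 h2 (abs_nonneg _) ((abs_nonneg _).trans h1)
  have bg : ∀ s, α ≤ s → |ng s| ≤ p := fun s hs => by rw [abs_of_pos (g0 s hs)]; exact gp s hs
  have bA' : ∀ s, α ≤ s → |nA s| ≤ 1 + p := fun s hs => by rw [abs_of_nonneg (bA0 s hs)]; exact bA s hs
  have br : ∀ s, α ≤ s → |(2 * s + 1) * ng s| ≤ r := fun s hs => by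
    have h0 := s0 s hs
    have := g0 s hs
    rw [abs_of_pos (by positivity)]
    have e1 : (2 * s + 1) * ng s = 1 / s + 1 / (1 + s) := by unfold ng; field_simp; ring
    have e2 : 1 / s ≤ 1 / α := one_div_le_one_div_of_le hα hs
    have e3 : 1 / (1 + s) ≤ 1 / α := one_div_le_one_div_of_le hα (by linarith)
    have e4 : r = 1 / α + 1 / α := by rw [hr]; ring
    linarith
  have bg1 : ∀ s, α ≤ s → |ng1 s| ≤ r * p := fun s hs => by
    unfold ng1
    rw [abs_neg]
    exact mm (br s hs) (bg s hs)
  have bA1 : ∀ s, α ≤ s → |nA1 s| ≤ X := fun s hs => mm (bA' s hs) (mm (bk s hs) (bg s hs))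
  have bk1 : ∀ s, α ≤ s → |nA s ^ 2 - 1| ≤ (1 + p) ^ 2 + 1 := fun s hs => by
    have h1 := bA0 s hs
    have h2 := bA s hs
    have : nA s ^ 2 ≤ (1 + p) ^ 2 := by gcongr
    rw [abs_le]; constructor <;> nlinarith
  have bA2 : ∀ s, α ≤ s → |nA2 s| ≤ X * (1 / 2 * p) + (1 + p) * (((1 + p) ^ 2 + 1) * p + 1 / 2 * (r * p)) := fun s hs =>
    (abs_add_le _ _).trans (add_le_add (mm (bA1 s hs) (mm (bk s hs) (bg s hs)))
      (mm (bA' s hs) ((abs_add_le _ _).trans (add_le_add (mm (bk1 s hs) (bg s hs)) (mm (bk s hs) (bg1 s hs))))))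
  have p1 : 0 < X := by positivity
  have p2 : 0 < X * (1 / 2 * p) + (1 + p) * (((1 + p) ^ 2 + 1) * p + 1 / 2 * (r * p)) := by positivity
  have p3 : 0 < r * p := by positivity
  have p4 : 0 < (B * (1 + B)) ^ 2 := by positivity
  have cg : ContinuousOn ng (Set.Ici α) := fun x hx => (dg x hx).continuousAt.continuousWithinAt
  have cg1 : ContinuousOn ng1 (Set.Ici α) := by
    unfold ng1
    fun_prop
  refine ⟨a, ⟨hα, by linarith, dA, dA1, ?_, bA0, fun s hs => (bA s hs).trans (by linarith), ?_, fun s hs => (bA1 s hs).trans (by linarith),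
    fun s hs => (bA2 s hs).trans (by linarith), dl, dg, cg1, g0, fun s hs => (gp s hs).trans (by linarith), ?_, fun s hs => (bg1 s hs).trans (by linarith), ?_⟩⟩
  · have cA : ContinuousOn nA (Set.Ici α) := fun x hx => (dA x hx).continuousAt.continuousWithinAt
    have cA1 : ContinuousOn nA1 (Set.Ici α) := fun x hx => (dA1 x hx).continuousAt.continuousWithinAt
    have ck : ContinuousOn nk (Set.Ici α) := fun x hx => (dk x hx).continuousAt.continuousWithinAt
    unfold nA2
    fun_prop
  · intro s hs
    exact mul_nonpos_of_nonneg_of_nonpos (bA0 s hs) (mul_nonpos_of_nonpos_of_nonneg (kn s hs) (g0 s hs).le)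
  · intro s hs
    have := g0 s hs
    have := s0 s hs
    unfold ng1
    rw [neg_nonpos]; positivity
  · intro s hs hsB
    have h1 := s0 s hs
    have h2 : 1 / a ≤ 1 / (B * (1 + B)) ^ 2 := one_div_le_one_div_of_le p4 (by linarith)
    have h3 : 1 / (B * (1 + B)) ^ 2 ≤ 1 / (s * (1 + s)) ^ 2 := one_div_le_one_div_of_le (by positivity) (by gcongr)
    have h4 : 1 / (s * (1 + s)) ^ 2 = ng s * ng s := by unfold ng; field_simp
    have h5 : 1 * (ng s * ng s) ≤ (2 * s + 1) * (ng s * ng s) := by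
      have := g0 s hs
      gcongr
      linarith
    have h6 : ng1 s = -((2 * s + 1) * (ng s * ng s)) := by unfold ng1; ring
    linarith

theorem near_saddle {α B a T y0 Z : ℝ} {n : ℕ} {A1 A2 : ℝ → ℝ} (hα : 0 < α)
    (H : Osc nA A1 A2 nl ng ng1 α B a) (hn : 1 ≤ n) (hT : 0 < T)
    (hy : y0 * (1 + y0) = T / (2 * π * n)) (h1 : 2 * α ≤ y0) (hZ : 2 * y0 ≤ Z) :
    |(∫ t in α..Z, nA t * sin (2 * π * n * t - T * nl t)) -
      nA y0 * √(2 * π / (T * (2 * y0 + 1) / (y0 * (1 + y0)) ^ 2)) * sin (2 * π * n * y0 - T * nl y0 + π / 4)| ≤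
      (1440 * (1 + 1 / α) + 88 * a) / n := by
  have hn0 : (0:ℝ) < n := by exact_mod_cast hn
  have hy0 : 0 < y0 := by linarith
  have ha := H.ha
  set P0 := y0 * (1 + y0) with hP0
  have hP00 : 0 < P0 := by positivity
  have hTn : T = 2 * π * n * P0 := by rw [hy]; field_simp
  have hball : ∀ z ∈ Metric.ball (y0:ℂ) (2 * (y0 / 64)), 31 / 32 * y0 ≤ z.re ∧ ‖z‖ ≤ 33 / 32 * y0 := by
    intro z hz
    rw [mem_ball_iff_norm] at hz
    have h2 : |(z - y0).re| ≤ ‖z - y0‖ := Complex.abs_re_le_norm _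
    have h3 : ‖z‖ ≤ ‖z - y0‖ + ‖(y0:ℂ)‖ := by
      have := norm_add_le (z - y0) (y0:ℂ)
      simpa using this
    rw [Complex.norm_real, Real.norm_eq_abs, abs_of_pos hy0] at h3
    rw [Complex.sub_re, Complex.ofReal_re, abs_le] at h2
    exact ⟨by linarith [h2.1], by linarith⟩
  have hre : ∀ z : ℂ, z.re ≤ ‖z‖ := fun z => (le_abs_self _).trans (Complex.abs_re_le_norm z)
  have hnz : ∀ z ∈ Metric.ball (y0:ℂ) (2 * (y0 / 64)), 31 / 32 * y0 ≤ ‖z‖ := fun z hz => (hball z hz).1.trans (hre z)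
  have hnz1 : ∀ z ∈ Metric.ball (y0:ℂ) (2 * (y0 / 64)), 1 + 31 / 32 * y0 ≤ ‖1 + z‖ := fun z hz => by
    have := hre (1 + z)
    rw [Complex.add_re, Complex.one_re] at this
    linarith [(hball z hz).1]
  have hnz2 : ∀ z ∈ Metric.ball (y0:ℂ) (2 * (y0 / 64)), ‖1 + z‖ ≤ 1 + 33 / 32 * y0 := fun z hz => by
    have := norm_add_le 1 z
    rw [norm_one] at this
    linarith [(hball z hz).2]
  have hslit : ∀ z ∈ Metric.ball (y0:ℂ) (2 * (y0 / 64)), z ∈ Complex.slitPlane := fun z hz =>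
    Or.inl (by linarith [(hball z hz).1])
  have hslit1 : ∀ z ∈ Metric.ball (y0:ℂ) (2 * (y0 / 64)), 1 + z ∈ Complex.slitPlane := fun z hz =>
    Or.inl (by rw [Complex.add_re, Complex.one_re]; linarith [(hball z hz).1])
  have hlog : ∀ z ∈ Metric.ball (y0:ℂ) (2 * (y0 / 64)), 1 / (2 * ‖1 + z‖) ≤ ‖Complex.log (1 + z) - Complex.log z‖ := fun z hz => by
    have h2 := hre (Complex.log (1 + z) - Complex.log z)
    rw [Complex.sub_re, Complex.log_re, Complex.log_re] at h2
    refine le_trans ?_ h2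
    have z0 : 0 < ‖z‖ := by linarith [hnz z hz]
    have z1 : 0 < ‖1 + z‖ := by linarith [hnz1 z hz]
    have h3 := log_le_sub_one_of_pos (show 0 < ‖z‖ / ‖1 + z‖ by positivity)
    rw [log_div z0.ne' z1.ne'] at h3
    have h4 : 1 / (2 * ‖1 + z‖) ≤ 1 - ‖z‖ / ‖1 + z‖ := by
      have hsq : ‖1 + z‖ ^ 2 = ‖z‖ ^ 2 + 2 * z.re + 1 := by
        rw [Complex.sq_norm, Complex.sq_norm, Complex.normSq_apply, Complex.normSq_apply]
        simp; ring
      have h5 : 1 / 2 ≤ ‖1 + z‖ - ‖z‖ := by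
        have := (hball z hz).1
        have := (hball z hz).2
        have := hnz2 z hz
        nlinarith
      have e1 : 1 / (2 * ‖1 + z‖) = 1 / 2 / ‖1 + z‖ := by field_simp
      have e2 : 1 - ‖z‖ / ‖1 + z‖ = (‖1 + z‖ - ‖z‖) / ‖1 + z‖ := by field_simp
      rw [e1, e2]
      gcongr
    linarith
  have hlog0 : ∀ z ∈ Metric.ball (y0:ℂ) (2 * (y0 / 64)), Complex.log (1 + z) - Complex.log z ≠ 0 := fun z hz => by
    rw [← norm_pos_iff]
    have z1 : 0 < ‖1 + z‖ := by linarith [hnz1 z hz]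
    exact lt_of_lt_of_le (by positivity) (hlog z hz)
  have hpos : ∀ x : ℝ, |x - y0| ≤ y0 / 64 → 0 < x := fun x hx => by
    rw [abs_le] at hx; linarith
  have hIcc : ∀ x ∈ Set.Icc (y0 - y0 / 64) (y0 + y0 / 64), α ≤ x := fun x hx => by
    have := hx.1; linarith
  have key := sp (Ac := fun z => Complex.exp (-(1/2) * (Complex.log z + Complex.log (1 + z))) / (Complex.log (1 + z) - Complex.log z))
    (φc := fun z => (2 * π * n : ℝ) * z - (T:ℂ) * (Complex.log z - Complex.log (1 + z)))
    (φ' := fun z => (2 * π * n : ℝ) - (T:ℂ) * (z * (1 + z))⁻¹)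
    (A := nA) (φ := fun t => 2 * π * n * t - T * nl t) (x0 := y0) (δ := y0 / 64) (φ2 := T * (2 * y0 + 1) / P0 ^ 2) (a := 2 * (1 + 1 / α))
    (by positivity) (by positivity) (by positivity) ?_ ?_ ?_ ?_ ?_ ?_ ?_ ?_
  · have f1 := H.full (T := T) (ν := 2 * π * n) (Z := Z) (x0 := y0) (δ := y0 / 64) (μ := n / 11) hT (by positivity) (by positivity)
      (by linarith) (by linarith) ?_ ?_ key
    · refine f1.trans ?_
      rw [add_div]
      apply add_le_add
      · have e1 : n / 12 ≤ T * (2 * y0 + 1) / P0 ^ 2 * (y0 / 64) := by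
          have : T * (2 * y0 + 1) / P0 ^ 2 * (y0 / 64) = 2 * π * n * ((2 * y0 + 1) / (1 + y0)) / 64 := by
            rw [hTn, hP0]; field_simp
          rw [this]
          have : 1 ≤ (2 * y0 + 1) / (1 + y0) := by rw [le_div_iff₀ (by positivity)]; linarith
          have : 2 * π * n * 1 ≤ 2 * π * n * ((2 * y0 + 1) / (1 + y0)) := by gcongr
          nlinarith [pi_gt_three]
        calc 60 * (2 * (1 + 1 / α)) / (T * (2 * y0 + 1) / P0 ^ 2 * (y0 / 64)) ≤ 60 * (2 * (1 + 1 / α)) / (n / 12) := by gcongr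
          _ = 1440 * (1 + 1 / α) / n := by field_simp; ring
      · apply le_of_eq; field_simp; ring
    · simp only [ng]
      have e0 : (y0 - y0 / 64) * (1 + (y0 - y0 / 64)) ≤ 63 / 64 * P0 := by rw [hP0]; nlinarith
      have e00 : 0 < (y0 - y0 / 64) * (1 + (y0 - y0 / 64)) := mul_pos (by linarith) (by linarith)
      have e1 : T * (63 / 64 * P0)⁻¹ ≤ T * ((y0 - y0 / 64) * (1 + (y0 - y0 / 64)))⁻¹ := by gcongr
      have e2 : T * (63 / 64 * P0)⁻¹ = 2 * π * n * (64 / 63) := by rw [hTn]; field_simp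
      nlinarith [pi_gt_three]
    · simp only [ng]
      have e0 : 65 / 64 * P0 ≤ (y0 + y0 / 64) * (1 + (y0 + y0 / 64)) := by rw [hP0]; nlinarith
      have e1 : T * ((y0 + y0 / 64) * (1 + (y0 + y0 / 64)))⁻¹ ≤ T * (65 / 64 * P0)⁻¹ := by gcongr
      have e2 : T * (65 / 64 * P0)⁻¹ = 2 * π * n * (64 / 65) := by rw [hTn]; field_simp
      nlinarith [pi_gt_d2]
  · intro z hz
    have h2 : DifferentiableAt ℂ Complex.log z := (Complex.differentiableAt_log (hslit z hz))
    have h3 : DifferentiableAt ℂ (fun z => Complex.log (1 + z)) z :=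
      (differentiableAt_id.const_add 1).clog (hslit1 z hz)
    exact (((h2.add h3).const_mul _).cexp.div (h3.sub h2) (hlog0 z hz)).differentiableWithinAt
  · intro z hz
    have h2 := Complex.hasDerivAt_log (hslit z hz)
    have h3 : HasDerivAt (fun z => Complex.log (1 + z)) (1 / (1 + z)) z :=
      ((hasDerivAt_id z).const_add 1).clog (hslit1 z hz)
    have z0 : z ≠ 0 := Complex.slitPlane_ne_zero (hslit z hz)
    have z1 : 1 + z ≠ 0 := Complex.slitPlane_ne_zero (hslit1 z hz)
    refine (((hasDerivAt_id z).const_mul _).sub ((h2.sub h3).const_mul (T:ℂ))).congr_deriv ?_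
    field_simp
    ring
  · intro z hz
    have z0 : z ≠ 0 := Complex.slitPlane_ne_zero (hslit z hz)
    have z1 : 1 + z ≠ 0 := Complex.slitPlane_ne_zero (hslit1 z hz)
    have hy0' : (y0:ℂ) ≠ 0 := by exact_mod_cast hy0.ne'
    have hy1' : (1 + y0:ℂ) ≠ 0 := by
      have : 1 + y0 ≠ 0 := by positivity
      exact_mod_cast this
    have e1 : ((2 * π * n : ℝ) : ℂ) - (T:ℂ) * (z * (1 + z))⁻¹ - ((T * (2 * y0 + 1) / P0 ^ 2 : ℝ) : ℂ) * (z - y0) =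
        ((T / P0 ^ 2 : ℝ) : ℂ) * (z - y0) ^ 2 * ((((P0 - (2 * y0 + 1) ^ 2 : ℝ)) : ℂ) - (((2 * y0 + 1) : ℝ) : ℂ) * (z - y0)) * (z * (1 + z))⁻¹ := by
      have hP : (P0:ℂ) = y0 * (1 + y0) := by rw [hP0]; push_cast; ring
      have hP' : (P0:ℂ) ≠ 0 := by rw [hP]; exact mul_ne_zero hy0' hy1'
      have : ((2 * π * n : ℝ) : ℂ) = T / P0 := by
        rw [eq_div_iff hP']
        exact_mod_cast hTn.symm
      rw [this]
      push_cast
      rw [hP]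
      field_simp
      ring
    rw [e1, norm_mul, norm_mul, norm_mul, norm_pow, norm_inv, norm_mul, Complex.norm_real, Real.norm_eq_abs, abs_of_pos (by positivity)]
    have hzz : ‖z - y0‖ ≤ y0 / 32 := by
      rw [mem_ball_iff_norm] at hz; linarith
    have n1 : ‖(((P0 - (2 * y0 + 1) ^ 2 : ℝ)) : ℂ) - (((2 * y0 + 1) : ℝ) : ℂ) * (z - y0)‖ ≤ (3 * P0 + 1) + (2 * y0 + 1) * (y0 / 32) := by
      refine (norm_sub_le _ _).trans ?_
      rw [norm_mul, Complex.norm_real, Complex.norm_real, Real.norm_eq_abs, Real.norm_eq_abs, abs_of_pos (by positivity : 0 < 2 * y0 + 1)]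
      have : P0 - (2 * y0 + 1) ^ 2 = -(3 * P0 + 1) := by rw [hP0]; ring
      rw [this, abs_neg, abs_of_pos (by positivity)]
      gcongr
    have n2 : (‖z‖ * ‖1 + z‖)⁻¹ ≤ (9 / 10 * P0)⁻¹ := by
      apply inv_anti₀ (by positivity)
      have := mul_le_mul (hnz z hz) (hnz1 z hz) (by positivity) (norm_nonneg z)
      rw [hP0]
      nlinarith
    calc _ ≤ T / P0 ^ 2 * ‖z - y0‖ ^ 2 * ((3 * P0 + 1) + (2 * y0 + 1) * (y0 / 32)) * (9 / 10 * P0)⁻¹ := by gcongr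
      _ = T / P0 ^ 2 * ‖z - y0‖ ^ 2 * (((3 * P0 + 1) + (2 * y0 + 1) * (y0 / 32)) * (9 / 10 * P0)⁻¹) := by ring
      _ ≤ T / P0 ^ 2 * ‖z - y0‖ ^ 2 * ((2 * y0 + 1) / (8 * (y0 / 64))) := by
          apply mul_le_mul_of_nonneg_left _ (by positivity)
          rw [← div_eq_mul_inv, div_le_div_iff₀ (by positivity) (by positivity), hP0]
          nlinarith [mul_pos hy0 hy0, mul_pos hy0 (mul_pos hy0 hy0)]
      _ = _ := by ring
  · intro z hz
    rw [norm_div, Complex.norm_exp]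
    have h2 := hlog z hz
    have z0 : 0 < ‖z‖ := by linarith [hnz z hz]
    have z1 : 0 < ‖1 + z‖ := by linarith [hnz1 z hz]
    have e3 : (-(1/2) * (Complex.log z + Complex.log (1 + z))).re = -(1/2) * log (‖z‖ * ‖1 + z‖) := by
      have : (-(1/2) : ℂ) = ((-(1/2) : ℝ) : ℂ) := by push_cast; ring
      rw [this, Complex.re_ofReal_mul, Complex.add_re, Complex.log_re, Complex.log_re, log_mul z0.ne' z1.ne']
    rw [e3]
    set E := rexp (-(1/2) * log (‖z‖ * ‖1 + z‖)) with hE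
    have hE0 : 0 < E := exp_pos _
    have hE2 : E ^ 2 = (‖z‖ * ‖1 + z‖)⁻¹ := by
      rw [hE, ← exp_nat_mul]
      have : ((2:ℕ):ℝ) * (-(1/2) * log (‖z‖ * ‖1 + z‖)) = - log (‖z‖ * ‖1 + z‖) := by push_cast; ring
      rw [this, exp_neg, exp_log (by positivity)]
    have h4 : E / ‖Complex.log (1 + z) - Complex.log z‖ ≤ E * (2 * ‖1 + z‖) := by
      calc _ ≤ E / (1 / (2 * ‖1 + z‖)) := by gcongr
        _ = _ := by field_simp
    refine h4.trans ?_
    have hzα : α ≤ ‖z‖ := by linarith [hnz z hz]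
    apply le_of_sq_le_sq _ (by positivity)
    have e5 : (E * (2 * ‖1 + z‖)) ^ 2 = 4 * (‖1 + z‖ / ‖z‖) := by
      rw [mul_pow, hE2]; field_simp; ring
    have e6 : ‖1 + z‖ / ‖z‖ ≤ 1 + 1 / α := by
      have : ‖1 + z‖ ≤ 1 + ‖z‖ := by
        have := norm_add_le 1 z
        rwa [norm_one] at this
      calc _ ≤ (1 + ‖z‖) / ‖z‖ := by gcongr
        _ = 1 + 1 / ‖z‖ := by field_simp; ring
        _ ≤ _ := by gcongr
    rw [e5]
    have : 0 < 1 / α := by positivity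
    nlinarith
  · intro x hx
    have h0 := hpos x hx
    simp only [nA]
    have : (1 + (x:ℂ)) = ((1 + x : ℝ) : ℂ) := by push_cast; rfl
    rw [this, ← Complex.ofReal_log h0.le, ← Complex.ofReal_log (by linarith)]
    push_cast
    rfl
  · intro x hx
    have h0 := hpos x hx
    simp only [nl]
    have : (1 + (x:ℂ)) = ((1 + x : ℝ) : ℂ) := by push_cast; rfl
    rw [this, ← Complex.ofReal_log h0.le, ← Complex.ofReal_log (by linarith)]
    push_cast
    rfl
  · exact fun x hx => (H.dA x (hIcc x hx)).continuousAt.continuousWithinAt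
  · have : ContinuousOn nl (Set.Icc (y0 - y0 / 64) (y0 + y0 / 64)) := fun x hx => (H.dl x (hIcc x hx)).continuousAt.continuousWithinAt
    fun_prop
end Atk

namespace Atk

noncomputable def bC (a C0 D K : ℝ) : ℝ := ((3*a+C0) * (1 + 4 * K)^2 + 9 * a ^ 3 + 5 * a ^ 2 * (2 * (1 + 4 * K)^2 + 2 * (4 * (2 * D) + 4 * (2 * D + 1)^2)))

theorem bound_log {a C0 D K T M X : ℝ} {R L : ℕ} (ha : 1 ≤ a) (hC0 : 0 ≤ C0) (hD : 1 ≤ D) (hK : 1 ≤ K)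
    (hT : 1 ≤ log T) (hT1 : 1 ≤ T) (hR : 1 ≤ R) (hL : 1 ≤ L) (hRM : (R:ℝ) ≤ M) (hM : log M ≤ K * log T) (hLM : (L:ℝ) = M ^ 4)
    (hX1 : 1 ≤ X) (hX : X ≤ D * T) :
    (3*a+C0)*((1+log R)*(1+log L)) + 9*a^3 + 5*a^2*(2*((1+log R)*(1+log L)) + 2*(4*√(2*X)/√T + 4*(1+log (2*X))^2))
    ≤ bC a C0 D K * log T ^ 2 := by
  have hR' : (1:ℝ) ≤ R := by exact_mod_cast hR
  have hL' : (1:ℝ) ≤ L := by exact_mod_cast hL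
  have l1 : log R ≤ K * log T := (log_le_log (by linarith) hRM).trans hM
  have l2 : log L ≤ 4 * K * log T := by
    rw [hLM, log_pow]; push_cast; linarith
  have l1' := log_nonneg hR'
  have l2' := log_nonneg hL'
  have p : (1+log R)*(1+log L) ≤ (1 + 4 * K)^2 * log T ^ 2 := by
    have : (1+log R)*(1+log L) ≤ ((1 + 4 * K) * log T) * ((1 + 4 * K) * log T) := by
      apply mul_le_mul <;> nlinarith
    linarith
  have hT0 : 0 < T := by linarith
  have q1 : √(2*X)/√T ≤ 2 * D := by
    rw [div_le_iff₀ (by positivity)]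
    have : √(2*X) ≤ √((2*D)^2*T) := by
      apply sqrt_le_sqrt
      nlinarith
    rw [sqrt_mul (show 0 ≤ (2*D)^2 by positivity), sqrt_sq (by positivity)] at this
    exact this
  have q2 : log (2*X) ≤ 2 * D * log T := by
    have : log (2*X) ≤ log ((2 * D) * T) := log_le_log (by positivity) (by linarith)
    rw [log_mul (show 2 * D ≠ 0 by positivity) (by positivity)] at this
    have h3 := log_le_sub_one_of_pos (show 0 < 2 * D by positivity)
    nlinarith
  have q2' : 0 ≤ log (2*X) := log_nonneg (by linarith)
  have q3 : (1+log (2*X))^2 ≤ (2*D+1)^2 * log T^2 := by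
    rw [← mul_pow]
    apply pow_le_pow_left₀ (by positivity)
    linarith
  have h1 : 1 ≤ log T ^ 2 := by nlinarith
  have q4 : 4*√(2*X)/√T ≤ 4 * (2 * D) * log T ^ 2 := by
    rw [mul_div_assoc]; nlinarith
  unfold bC
  have t1 : (3*a+C0)*((1+log R)*(1+log L)) ≤ (3*a+C0)*((1 + 4 * K)^2 * log T ^ 2) := by gcongr
  have t2 : 9 * a ^ 3 ≤ 9 * a ^ 3 * log T ^ 2 := le_mul_of_one_le_right (by positivity) h1
  have t3 : 5*a^2*(2*((1+log R)*(1+log L)) + 2*(4*√(2*X)/√T + 4*(1+log (2*X))^2)) ≤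
     5*a^2*(2*((1 + 4 * K)^2 * log T ^ 2) + 2*(4 * (2 * D) * log T ^ 2 + 4*((2*D+1)^2 * log T^2))) := by gcongr
  linarith

noncomputable def y0 (T : ℝ) (n : ℕ) : ℝ := -(1/2) + √(1/4 + T / (2*π*n))
noncomputable def mn (T : ℝ) (n : ℕ) : ℝ :=
  nA (y0 T n)*√(2*π/(T*(2*y0 T n+1)/(y0 T n*(1+y0 T n))^2))*sin (2*π*n*y0 T n - T*nl (y0 T n) + π/4)
noncomputable def mf (T : ℝ) (n : ℕ) : ℝ :=
  fA (T/(2*π*n)) *√(2*π/(T/(T/(2*π*n))^2))*sin (2*π*n*(T/(2*π*n)) - T*log (T/(2*π*n)) + π/4)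

theorem y0_mul {T : ℝ} (hT : 0 ≤ T) (n : ℕ) : y0 T n * (1 + y0 T n) = T/(2*π*n) := by
  unfold y0
  have := sq_sqrt (show 0 ≤ 1/4 + T / (2*π*n) by positivity)
  nlinarith

theorem y0_nonneg {T : ℝ} (hT : 0 ≤ T) (n : ℕ) : 0 ≤ y0 T n := by
  unfold y0
  have : √((1/2)^2) ≤ √(1/4 + T / (2*π*n)) := by
    apply sqrt_le_sqrt
    have : 0 ≤ T / (2*π*n) := by positivity
    linarith
  rw [sqrt_sq (by norm_num)] at this
  linarith

set_option maxHeartbeats 1000000 in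
theorem near_final {Y1 Y2 K : ℝ} (hY1 : 0 < Y1) (hY : Y1 ≤ Y2) (hK : 1 ≤ K) :
    ∃ C, ∃ T0 : ℝ, ∀ T : ℝ, T0 ≤ T → ∀ Y, Y1 ≤ Y → Y ≤ Y2 → ∀ M : ℕ, T^2 ≤ M → log M ≤ K * log T →
    |(∑ q ∈ Finset.Icc 1 ⌊M/(1+Y)⌋₊, ((∑ j∈Finset.Ioc ⌊Y*q⌋₊ (M - q), (1/(q:ℝ))*(nA (j/q)*sin (T*nl (j/q))))
       - (∫ t in Y..((M-q:ℕ)/q:ℝ), nA t*sin (T*nl t)))) + ∑ n∈Finset.Icc 1 ⌊T*ng Y/(2*π)⌋₊, (n.divisors.card:ℝ)*mn T n|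
       ≤ C * log T ^ 2 := by
  obtain ⟨a, H⟩ := near_osc (α := Y1/2) (B := Y2+1) (by linarith) (by linarith)
  set D : ℝ := 1 + ng Y1 with hD
  have hD0 : 0 < ng Y1 := by unfold ng; positivity
  refine ⟨bC a (1440*(1+1/(Y1/2))+88*a) D K, max (exp 1) (2 * π / ng Y2 + (1 + Y2) * (D + 5)), ?_⟩
  · intro T hT Y hYa hYb M hM hMK
    have hT1 := (le_max_left _ _).trans hT
    have hT2 := (le_max_right _ _).trans hT
    have hng2 : 0 < ng Y2 := by unfold ng; have : 0 < Y2 := by linarith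
                                positivity
    have hlog : 1 ≤ log T := by
      rw [← log_exp 1]; exact log_le_log (exp_pos _) hT1
    have hTT : 1 ≤ T := le_trans (by linarith [add_one_le_exp 1]) hT1
    have hT3 : 2 * π / ng Y2 ≤ T := by
      have : 0 ≤ (1 + Y2) * (D + 5) := by
        have : 0 < Y2 := by linarith
        positivity
      linarith
    have hT4 : (1 + Y2) * (D + 5) ≤ T := by
      have : 0 ≤ 2 * π / ng Y2 := by positivity
      linarith
    have hYpos : 0 < Y := by linarith
    have m1 : ng Y ≤ ng Y1 := H.anti (by linarith) hYa
    have m2 : ng Y2 ≤ ng Y := H.anti (by linarith) hYb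
    have pi3 := pi_gt_three
    have X1 : 1 ≤ T * ng Y / (2 * π) := by
      rw [le_div_iff₀ (by positivity)]
      rw [div_le_iff₀ hng2] at hT3
      nlinarith
    have X2 : T * ng Y / (2 * π) ≤ D * T := by
      rw [div_le_iff₀ (by positivity)]
      have : T * ng Y ≤ T * D := by gcongr; linarith
      nlinarith [mul_pos (show 0 < T by linarith) (show 0 < D by linarith)]
    have hDT : (1 + Y2) * (D * T + 1) + 4 * T ≤ M := by
      have hY2 : 0 < Y2 := by linarith
      have : (1 + Y2) * (D + 5) * T ≤ T * T := by gcongr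
      nlinarith
    have hM1 : (1:ℝ) ≤ M := by nlinarith
    have hfl : (⌊M/(1+Y)⌋₊ : ℝ) ≤ M / (1 + Y) := Nat.floor_le (by positivity)
    have hfl2 : (M:ℝ) / (1 + Y) < ⌊M/(1+Y)⌋₊ + 1 := Nat.lt_floor_add_one _
    have hMY : (M:ℝ) / (1 + Y) ≤ M := by
      rw [div_le_iff₀ (by positivity)]; nlinarith
    have hRD : D * T ≤ (⌊M/(1+Y)⌋₊ : ℝ) := by
      have : D * T + 1 ≤ (M:ℝ) / (1 + Y) := by
        rw [le_div_iff₀ (by positivity)]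
        have : (1 + Y) * (D * T + 1) ≤ (1 + Y2) * (D * T + 1) := by gcongr
        linarith
      linarith
    have hDT1 : 1 ≤ D * T := X1.trans X2
    have hR1 : 1 ≤ ⌊(M:ℝ)/(1+Y)⌋₊ := by
      have : (1:ℝ) ≤ ⌊M/(1+Y)⌋₊ := by linarith
      exact_mod_cast this
    have hqM : ∀ q ∈ Finset.Icc 1 ⌊(M:ℝ)/(1+Y)⌋₊, (q:ℝ) * (1 + Y) ≤ M ∧ q ≤ M := by
      intro q hq
      have : (q:ℝ) ≤ M / (1 + Y) := (Nat.cast_le.2 (Finset.mem_Icc.1 hq).2).trans hfl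
      refine ⟨(le_div_iff₀ (by positivity)).1 this, ?_⟩
      exact_mod_cast this.trans hMY
    have hM4 : (M:ℝ) ≤ (M:ℝ)^4 := le_self_pow₀ hM1 (by norm_num)
    refine (H.osc_sum (T := T) (b := Y) (C0 := 1440*(1+1/(Y1/2))+88*a) (M := M) (R := ⌊(M:ℝ)/(1+Y)⌋₊) (L := M^4) (W := fun q => M - q) (m := mn T)
      hTT (by linarith) (by linarith) (by have := H.ha; positivity) hR1 (by exact_mod_cast hM1.trans hM4) hM1 (hfl.trans hMY) ?_ ?_ X1
      (X2.trans hRD) (X2.trans (hRD.trans ((hfl.trans hMY).trans (by push_cast; exact hM4)))) ?_).trans ?_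
    · push_cast
      have : T^2 ≤ (M:ℝ)^2 := by nlinarith
      nlinarith [sq_nonneg (M:ℝ)]
    · intro q hq
      obtain ⟨h1, h2⟩ := hqM q hq
      rw [Nat.cast_sub h2]
      constructor
      · linarith
      · have : (0:ℝ) ≤ q := by positivity
        linarith
    · intro q hq n hqn hn
      obtain ⟨h1, h2⟩ := hqM q hq
      have q1 : 1 ≤ q := (Finset.mem_Icc.1 hq).1
      have n1 : 1 ≤ n := q1.trans hqn
      have n1' : (1:ℝ) ≤ n := by exact_mod_cast n1
      have q1' : (1:ℝ) ≤ q := by exact_mod_cast q1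
      have hqn' : (q:ℝ) ≤ n := by exact_mod_cast hqn
      have hy := y0_mul (show 0 ≤ T by linarith) n
      have hyn := y0_nonneg (show 0 ≤ T by linarith) n
      have hb : Y ≤ y0 T n := by
        by_contra hcon
        push Not at hcon
        have h5 : y0 T n * (1 + y0 T n) < Y * (1 + Y) := by nlinarith
        rw [hy, div_lt_iff₀ (by positivity)] at h5
        unfold ng at hn
        rw [le_div_iff₀ (by positivity), ← div_eq_mul_inv, le_div_iff₀ (by positivity)] at hn
        linarith
      refine near_saddle (by linarith) H n1 (by linarith) hy (by linarith) ?_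
      rw [Nat.cast_sub h2, le_div_iff₀ (by positivity)]
      have h6 : y0 T n * n ≤ T := by
        have : y0 T n ≤ T / (2*π*n) := by rw [← hy]; nlinarith
        rw [le_div_iff₀ (by positivity)] at this
        have h7 : 0 ≤ y0 T n * n := by positivity
        nlinarith
      have h8 : y0 T n * q ≤ T := le_trans (by gcongr) h6
      have h9 : (q:ℝ) ≤ D * T := hqn'.trans (hn.trans X2)
      have : 3 * T + 1 * (D * T + 1) ≤ M := by
        have hY2 : 0 < Y2 := by linarith
        nlinarith
      linarith
    · have hDpos : 1 ≤ D := by linarith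
      exact bound_log H.ha (by have := H.ha; positivity) hDpos hK hlog hTT hR1 (by exact_mod_cast hM1.trans hM4) (hfl.trans hMY) hMK (by push_cast; rfl) X1 X2

set_option maxHeartbeats 1000000 in
theorem far_final {c1 c2 K : ℝ} (hc1 : 1 < c1) (hc : c1 ≤ c2) (hK : 1 ≤ K) :
    ∃ C, ∃ T0 : ℝ, ∀ T : ℝ, T0 ≤ T → ∀ c, c1 ≤ c → c ≤ c2 → ∀ M : ℕ, T^2 ≤ M → log M ≤ K * log T →
    |(∑ q ∈ Finset.Icc 1 ⌊M/c⌋₊, ((∑ j∈Finset.Ioc ⌊c*q⌋₊ M, (1/(q:ℝ))*(fA (j/q)*sin (T*log (j/q))))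
       - (∫ t in c..(M/q:ℝ), fA t*sin (T*log t)))) + ∑ n∈Finset.Icc 1 ⌊T*c⁻¹/(2*π)⌋₊, (n.divisors.card:ℝ)*mf T n|
       ≤ C * log T ^ 2 := by
  have hα : 1 < (1 + c1) / 2 := by linarith
  obtain ⟨a, H⟩ := far_osc (α := (1 + c1) / 2) (B := c2+1) hα (by linarith)
  obtain ⟨η, hη0, hη1, hη2⟩ : ∃ η : ℝ, 0 < η ∧ η ≤ 1/10 ∧ (1 + c1) / 2 ≤ (1 - 2 * η) * c1 := by
    refine ⟨min (1/10) ((c1 - 1) / (4 * c1)), lt_min (by norm_num) (div_pos (by linarith) (by linarith)), min_le_left _ _, ?_⟩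
    have : min (1/10) ((c1 - 1) / (4 * c1)) ≤ (c1 - 1) / (4 * c1) := min_le_right _ _
    rw [le_div_iff₀ (by linarith)] at this
    linarith
  have hlα : 0 < log ((1 + c1) / 2) := log_pos hα
  refine ⟨bC a (10 / log ((1 + c1) / 2) / η + 8 * a / η) 1 K, max (exp 1) (2 * π * c2 + c2 * 5), ?_⟩
  · intro T hT c hca hcb M hM hMK
    have hT1 := (le_max_left _ _).trans hT
    have hT2 := (le_max_right _ _).trans hT
    have pi3 := pi_gt_three
    have hlog : 1 ≤ log T := by
      rw [← log_exp 1]; exact log_le_log (exp_pos _) hT1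
    have hTT : 1 ≤ T := le_trans (by linarith [add_one_le_exp 1]) hT1
    have hT3 : 2 * π * c2 ≤ T := by nlinarith
    have hT4 : c2 * 5 ≤ T := by nlinarith
    have hcpos : 0 < c := by linarith
    have X1 : 1 ≤ T * c⁻¹ / (2 * π) := by
      rw [le_div_iff₀ (by positivity), ← div_eq_mul_inv, le_div_iff₀ hcpos]
      nlinarith
    have X2 : T * c⁻¹ / (2 * π) ≤ 1 * T := by
      rw [div_le_iff₀ (by positivity), ← div_eq_mul_inv, div_le_iff₀ hcpos]
      nlinarith [mul_pos (show 0 < T by linarith) hcpos]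
    have hDT : c2 * (1 * T + 1) + T ≤ M := by
      have : c2 * 5 * T ≤ T * T := by gcongr
      nlinarith
    have hM1 : (1:ℝ) ≤ M := by nlinarith
    have hfl : (⌊M/c⌋₊ : ℝ) ≤ M / c := Nat.floor_le (by positivity)
    have hfl2 : (M:ℝ) / c < ⌊M/c⌋₊ + 1 := Nat.lt_floor_add_one _
    have hMY : (M:ℝ) / c ≤ M := by
      rw [div_le_iff₀ (by positivity)]; nlinarith
    have hRD : 1 * T ≤ (⌊M/c⌋₊ : ℝ) := by
      have : 1 * T + 1 ≤ (M:ℝ) / c := by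
        rw [le_div_iff₀ (by positivity)]
        have : c * (1 * T + 1) ≤ c2 * (1 * T + 1) := by gcongr
        linarith
      linarith
    have hR1 : 1 ≤ ⌊(M:ℝ)/c⌋₊ := by
      have : (1:ℝ) ≤ ⌊M/c⌋₊ := by linarith
      exact_mod_cast this
    have hqM : ∀ q ∈ Finset.Icc 1 ⌊(M:ℝ)/c⌋₊, (q:ℝ) * c ≤ M := by
      intro q hq
      have : (q:ℝ) ≤ M / c := (Nat.cast_le.2 (Finset.mem_Icc.1 hq).2).trans hfl
      exact (le_div_iff₀ (by positivity)).1 this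
    have hM4 : (M:ℝ) ≤ (M:ℝ)^4 := le_self_pow₀ hM1 (by norm_num)
    have ha := H.ha
    refine (H.osc_sum (T := T) (b := c) (C0 := 10 / log ((1 + c1) / 2) / η + 8 * a / η) (M := M) (R := ⌊(M:ℝ)/c⌋₊) (L := M^4) (W := fun q => M) (m := mf T)
      hTT (by linarith) (by linarith) (by positivity) hR1 (by exact_mod_cast hM1.trans hM4) hM1 (hfl.trans hMY) ?_ ?_ X1
      (X2.trans hRD) (X2.trans (hRD.trans ((hfl.trans hMY).trans (by push_cast; exact hM4)))) ?_).trans ?_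
    · push_cast
      have : T^2 ≤ (M:ℝ)^2 := by nlinarith
      nlinarith [sq_nonneg (M:ℝ)]
    · intro q hq
      have h1 := hqM q hq
      exact ⟨by linarith, le_rfl⟩
    · intro q hq n hqn hn
      have q1 : 1 ≤ q := (Finset.mem_Icc.1 hq).1
      have n1 : 1 ≤ n := q1.trans hqn
      have n1' : (1:ℝ) ≤ n := by exact_mod_cast n1
      have q1' : (1:ℝ) ≤ q := by exact_mod_cast q1
      have hqn' : (q:ℝ) ≤ n := by exact_mod_cast hqn
      have hb : c ≤ T / (2 * π * n) := by
        rw [le_div_iff₀ (by positivity)]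
        rw [le_div_iff₀ (by positivity), ← div_eq_mul_inv, le_div_iff₀ (by positivity)] at hn
        linarith
      refine far_saddle hα hη0 hη1 H n1 (by linarith) rfl ?_ ?_
      · refine hη2.trans ?_
        have : 0 ≤ 1 - 2 * η := by linarith
        gcongr
        linarith
      · rw [le_div_iff₀ (by positivity)]
        have : 2 * (T / (2 * π * n)) * q ≤ 2 * (T / (2 * π * n)) * n := by gcongr
        have e1 : 2 * (T / (2 * π * n)) * n = T / π := by field_simp
        have e2 : T / π ≤ T := div_le_self (by linarith) (by linarith)
        nlinarith
    · exact bound_log ha (by positivity) le_rfl hK hlog hTT hR1 (by exact_mod_cast hM1.trans hM4) (hfl.trans hMY) hMK (by push_cast; rfl) X1 X2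

end Atk

namespace Atk

theorem far_term {T : ℝ} {n : ℕ} (hT : 0 < T) (hn : 1 ≤ n) :
    mf T n = (n : ℝ) ^ (-(1 / 2 : ℝ)) * (Real.log (T / (2 * Real.pi * n)))⁻¹ *
              Real.cos (T * Real.log (T / (2 * Real.pi * n)) - T + Real.pi / 4) := by
  have n1 : (0:ℝ) < n := by exact_mod_cast hn
  unfold mf fA
  set s := T / (2 * π * n) with hs
  have hs0 : 0 < s := by positivity
  have e1 : 2 * π * n * s = T := by rw [hs]; field_simp
  rw [e1]
  have e2 : sin (T - T * log s + π / 4) = cos (T * log s - T + π / 4) := by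
    rw [← cos_pi_div_two_sub]
    congr 1; ring
  rw [e2]
  have e3 : exp (-(1/2) * log s) * √(2 * π / (T / s ^ 2)) = (n:ℝ) ^ (-(1/2:ℝ)) := by
    have : exp (-(1/2) * log s) = s ^ (-(1/2:ℝ)) := by rw [rpow_def_of_pos hs0]; congr 1; ring
    rw [this, sqrt_eq_rpow]
    have : 2 * π / (T / s^2) = s * (n:ℝ)⁻¹ := by rw [← e1]; field_simp
    rw [this, mul_rpow hs0.le (by positivity), ← mul_assoc, ← rpow_add hs0, inv_rpow n1.le, rpow_neg n1.le]
    norm_num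
  rw [← e3]
  ring

theorem near_term {T : ℝ} {n : ℕ} (hT : 0 < T) (hn : 1 ≤ n) :
    2 * mn T n = Real.sqrt 2 * (T / (2 * Real.pi)) ^ ((1 : ℝ) / 4) * ((-1 : ℝ) ^ n * (n : ℝ) ^ (-(3 / 4 : ℝ)) * e T n *
                Real.cos (f T n)) := by
  have n1 : (0:ℝ) < n := by exact_mod_cast hn
  unfold mn
  set y := y0 T n with hy
  set z : ℝ := π * n / (2 * T) with hz
  have hz0 : 0 < z := by positivity
  set p := √z with hp
  set q := √(1 + z) with hq
  have hp0 : 0 < p := sqrt_pos.2 hz0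
  have hq0 : 0 < q := sqrt_pos.2 (by positivity)
  have hpp : p ^ 2 = z := sq_sqrt hz0.le
  have hqq : q ^ 2 = 1 + z := sq_sqrt (by positivity)
  have hpq : p < q := sqrt_lt_sqrt hz0.le (by linarith)
  have hnp : (n:ℝ) = 2 * T * p ^ 2 / π := by rw [hpp, hz]; field_simp
  have hyr : y = q / (2 * p) - 1 / 2 := by
    rw [hy]; unfold y0
    have : 1/4 + T / (2 * π * n) = (q / (2 * p))^2 := by
      rw [div_pow, hqq, mul_pow, hpp, hz]; field_simp; ring
    rw [this, sqrt_sq (by positivity)]; ring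
  have hy1 : y = (q - p) / (2 * p) := by rw [hyr]; field_simp
  have hy2 : 1 + y = (q + p) / (2 * p) := by rw [hyr]; field_simp; ring
  have hy0 : 0 < y := by rw [hy1]; apply div_pos <;> linarith
  have hyy : y * (1 + y) = 1 / (4 * p ^ 2) := by
    rw [hy2, hy1, div_mul_div_comm, div_eq_div_iff (by positivity) (by positivity)]
    have : (q - p) * (q + p) = 1 := by nlinarith
    rw [this]; ring
  have hy21 : 2 * y + 1 = q / p := by rw [hyr]; field_simp; ring
  have hw : log (1 + y) - log y = 2 * arsinh p := by
    rw [← log_div (by positivity) (by positivity), arsinh, hpp, ← hq]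
    have : (1 + y) / y = (p + q)^2 := by
      rw [hy2, hy1, div_div_div_cancel_right₀ (by positivity), div_eq_iff (by linarith)]
      have : (q - p) * (q + p) = 1 := by nlinarith
      linear_combination -(q+p)*this
    rw [this, log_pow]; push_cast; ring
  have hars : 0 < arsinh p := arsinh_pos_iff.2 hp0
  have hA : nA y = p / arsinh p := by
    unfold nA
    rw [hw, ← log_mul (by positivity) (by positivity), hyy]
    have : -(1/2) * log (1 / (4 * p^2)) = log (2 * p) := by
      rw [show 1 / (4 * p ^ 2) = ((2 * p)^2)⁻¹ by field_simp; ring, log_inv, log_pow]; push_cast; ring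
    rw [this, exp_log (by positivity)]
    field_simp
  have hsq : √(2*n*π*T + π^2*n^2) = π * n * (q / p) := by
    have : 2*n*π*T + π^2*n^2 = (π * n * (q / p))^2 := by
      rw [mul_pow, div_pow, hqq, hpp, hz]; field_simp
    rw [this, sqrt_sq (by positivity)]
  have hsin : sin (2*π*n*y - T * nl y + π/4) = (-1)^n * cos (f T n) := by
    have : 2*π*n*y - T * nl y + π/4 = π / 2 - ((n:ℤ) * π - f T n) := by
      unfold f nl
      rw [← hz, ← hp, show 2 * π * n * T = 2*n*π*T by ring, hsq]
      rw [show log y - log (1 + y) = -(2 * arsinh p) by linarith, hyr]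
      push_cast
      field_simp
      ring
    rw [this, sin_pi_div_two_sub, ← cos_neg, neg_sub]
    rw [cos_sub_int_mul_pi]
    simp
  rw [hA, hsin, hyy, hy21]
  unfold e
  rw [← hz, ← hp]
  have h2 : (2 * T / (π * n)) ^ ((1:ℝ)/2) = 1 / p := by
    rw [← sqrt_eq_rpow]
    have : 2 * T / (π * n) = (1 / p)^2 := by rw [div_pow, hpp, hz]; field_simp
    rw [this, sqrt_sq (by positivity)]
  rw [h2]
  have key : 2 * √(2 * π / (T * (q / p) / (1 / (4 * p^2))^2)) = √2 * (T / (2 * π)) ^ ((1:ℝ)/4) * (n:ℝ)^(-(3/4:ℝ)) * (1 + z)^(-(1/4:ℝ)) := by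
    rw [← pow_left_inj₀ (n := 4) (by positivity) (by positivity) (by norm_num)]
    have s4 : ∀ x : ℝ, 0 ≤ x → √x ^ 4 = x ^ 2 := fun x hx => by
      rw [show √x ^ 4 = (√x ^ 2) ^ 2 by ring, sq_sqrt hx]
    have r4 : ∀ x c : ℝ, 0 ≤ x → (x ^ c) ^ 4 = x ^ (c * 4) := fun x c hx => by
      rw [← rpow_natCast, ← rpow_mul hx]; norm_num
    rw [mul_pow, mul_pow, mul_pow, mul_pow, s4 _ (by positivity), s4 _ (by positivity), r4 _ _ (by positivity),
      r4 _ _ (by positivity), r4 _ _ (by positivity)]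
    rw [show (1:ℝ)/4*4 = 1 by norm_num, show -(3/4:ℝ)*4 = -((3:ℕ):ℝ) by norm_num, show -(1/4:ℝ)*4 = -1 by norm_num,
      rpow_one, rpow_neg_one, rpow_neg n1.le, rpow_natCast, ← hqq, hnp]
    field_simp
    norm_num
  have : ((1 / p) * arsinh p)⁻¹ = p / arsinh p := by field_simp
  rw [this]
  linear_combination (p / arsinh p * ((-1)^n * cos (f T n))) * key

end Atk

namespace Atk

noncomputable def tau (s : ℂ) (k : ℕ) : ℂ := (s - 1) * ((k + 1 : ℕ) : ℂ) ^ (-s) + ((k + 1 : ℕ) : ℂ) ^ (1 - s) - (k : ℂ) ^ (1 - s)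
noncomputable def sig (s : ℂ) (K : ℕ) : ℂ := (s - 1) * ∑ m ∈ Finset.Icc 1 K, (m : ℂ) ^ (-s) + (K : ℂ) ^ (1 - s)

theorem sig_one (s : ℂ) : sig s 1 = s := by
  unfold sig; simp

theorem sig_succ (s : ℂ) (K : ℕ) : sig s (K + 1) = sig s K + tau s K := by
  unfold sig tau
  rw [Finset.sum_Icc_succ_top (by omega)]
  ring

theorem tau_bound {s : ℂ} (hs : 0 < s.re) {k : ℕ} (hk : 1 ≤ k) :
    ‖tau s k‖ ≤ ‖s‖ * ‖s - 1‖ * (k:ℝ) ^ (-s.re - 1) := by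
  have k1 : (1:ℝ) ≤ k := by exact_mod_cast hk
  have hd : ∀ x ∈ Set.Icc (k:ℝ) (k + 1), HasDerivWithinAt (fun x : ℝ => (s - 1) * ((x:ℂ) - k) * (x:ℂ) ^ (-s) + (x:ℂ) ^ (1 - s))
      (-s * (s - 1) * ((x:ℂ) - k) * (x:ℂ) ^ (-s - 1)) (Set.Icc (k:ℝ) (k + 1)) x := by
    intro x hx
    have x0 : 0 < x := by linarith [hx.1]
    have hx0 : (x:ℂ) ≠ 0 := by exact_mod_cast x0.ne'
    have hsl : (x:ℂ) ∈ Complex.slitPlane := Complex.ofReal_mem_slitPlane.2 x0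
    have d0 : HasDerivAt (fun x : ℝ => (x:ℂ)) 1 x := Complex.ofRealCLM.hasDerivAt
    have d1 : HasDerivAt (fun x : ℝ => (x:ℂ) ^ (-s)) (-s * (x:ℂ) ^ (-s - 1)) x := by
      have := (hasDerivAt_id (x:ℂ)).cpow_const (c := -s) hsl
      simpa using this.comp_ofReal
    have d2 : HasDerivAt (fun x : ℝ => (x:ℂ) ^ (1-s)) ((1-s) * (x:ℂ) ^ (-s)) x := by
      have := (hasDerivAt_id (x:ℂ)).cpow_const (c := 1-s) hsl
      simpa using this.comp_ofReal
    have d3 := (((d0.sub_const (k:ℂ)).const_mul (s - 1)).mul d1).add d2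
    refine (d3.congr_deriv ?_).hasDerivWithinAt
    have e1 : (x:ℂ) ^ (-s) = x * (x:ℂ) ^ (-s-1) := by
      rw [Complex.cpow_sub _ _ hx0, Complex.cpow_one]; field_simp
    simp only [mul_one]
    ring
  have hb := Convex.norm_image_sub_le_of_norm_hasDerivWithin_le (C := ‖s‖ * ‖s - 1‖ * (k:ℝ) ^ (-s.re - 1)) hd ?_ (convex_Icc _ _)
    (Set.left_mem_Icc.2 (by linarith)) (Set.right_mem_Icc.2 (by linarith))
  · simp only [add_sub_cancel_left] at hb
    unfold tau
    push_cast at hb ⊢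
    simp only [add_sub_cancel_left, sub_self, mul_zero, zero_mul, zero_add, mul_one, norm_one] at hb
    convert hb using 2
  · intro x hx
    have x0 : 0 < x := by linarith [hx.1]
    rw [norm_mul, norm_mul, norm_mul, norm_neg, Complex.norm_cpow_eq_rpow_re_of_pos x0]
    have e1 : ‖(x:ℂ) - k‖ ≤ 1 := by
      rw [← Complex.ofReal_natCast, ← Complex.ofReal_sub, Complex.norm_real, norm_eq_abs, abs_le]
      constructor <;> linarith [hx.1, hx.2]
    have e2 : x ^ ((-s - 1).re) ≤ (k:ℝ) ^ (-s.re - 1) := by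
      simp only [Complex.sub_re, Complex.neg_re, Complex.one_re]
      apply rpow_le_rpow_of_nonpos (by linarith) hx.1 (by linarith)
    calc _ ≤ ‖s‖ * ‖s - 1‖ * 1 * (k:ℝ) ^ (-s.re - 1) := by gcongr
      _ = _ := by ring

theorem tau_summable {s : ℂ} (hs : 0 < s.re) : Summable (fun k : ℕ => tau s (k + 1)) := by
  refine Summable.of_norm_bounded (g := fun k : ℕ => ‖s‖ * ‖s - 1‖ * ((k + 1 : ℕ):ℝ) ^ (-s.re - 1)) ?_ (fun k => tau_bound hs (by omega))
  apply Summable.mul_left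
  exact (summable_nat_add_iff 1).2 (Real.summable_nat_rpow.2 (by linarith))

theorem sig_tendsto {s : ℂ} (hs : 0 < s.re) :
    Filter.Tendsto (fun K : ℕ => sig s K) Filter.atTop (nhds (s + ∑' k : ℕ, tau s (k + 1))) := by
  rw [← Filter.tendsto_add_atTop_iff_nat 1]
  have h1 := ((tau_summable hs).hasSum.tendsto_sum_nat).const_add s
  refine h1.congr (fun K => ?_)
  induction K with
  | zero => simp [sig_one]
  | succ K ih => rw [Finset.sum_range_succ, ← add_assoc, ih, sig_succ s (K + 1)]

theorem zeta1_of_one_lt {s : ℂ} (hs : 1 < s.re) : s + ∑' k : ℕ, tau s (k + 1) = riemannZeta₁ s := by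
  refine tendsto_nhds_unique (sig_tendsto (by linarith)) ?_
  have hs1 : s ≠ 1 := by rintro rfl; simp at hs
  have e : riemannZeta₁ s = (s - 1) * riemannZeta s + 0 := by
    rw [riemannZeta_eq_inv_sub_mul hs1]
    have := sub_ne_zero.2 hs1
    field_simp
    ring
  rw [e]
  apply Filter.Tendsto.add
  · apply Filter.Tendsto.const_mul
    have := (Complex.summable_one_div_nat_cpow.2 hs).hasSum.tendsto_sum_nat
    rw [← zeta_eq_tsum_one_div_nat_cpow hs, ← Filter.tendsto_add_atTop_iff_nat 1] at this
    refine this.congr (fun K => ?_)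
    rw [Finset.sum_range_succ']
    have hs0 : s ≠ 0 := by rintro rfl; simp at hs; linarith
    have : Finset.Icc 1 K = Finset.Ico (0 + 1) (K + 1) := by ext; simp
    rw [this, ← Finset.sum_Ico_add', Finset.range_eq_Ico]
    simp [Complex.cpow_neg, hs0]
  · rw [tendsto_zero_iff_norm_tendsto_zero]
    have h1 := (tendsto_rpow_neg_atTop (show 0 < s.re - 1 by linarith)).comp tendsto_natCast_atTop_atTop
    refine h1.congr' ?_
    filter_upwards [Filter.eventually_gt_atTop 0] with K hK
    rw [Complex.norm_natCast_cpow_of_pos hK]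
    simp

theorem zeta1_eq {s : ℂ} (hs : 1/4 < s.re) : s + ∑' k : ℕ, tau s (k + 1) = riemannZeta₁ s := by
  set R : ℝ := ‖s‖ + 3 with hR
  have hR0 : 0 < R := by positivity
  set U : Set ℂ := {z | 1/4 < z.re} ∩ Metric.ball 0 R with hU
  have hUo : IsOpen U := (isOpen_lt continuous_const Complex.continuous_re).inter Metric.isOpen_ball
  have hUc : Convex ℝ U := (convex_halfSpace_re_gt _).inter (convex_ball _ _)
  have hdt : ∀ k : ℕ, Differentiable ℂ (fun z => tau z (k + 1)) := by
    intro k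
    unfold tau
    have n1 : ((k + 1 : ℕ) : ℂ) ≠ 0 := by exact_mod_cast Nat.succ_ne_zero k
    have n2 : ((k + 1 + 1 : ℕ) : ℂ) ≠ 0 := by exact_mod_cast Nat.succ_ne_zero (k + 1)
    intro z
    have a1 : DifferentiableAt ℂ (fun z : ℂ => ((k + 1 + 1 : ℕ) : ℂ) ^ (-z)) z := (differentiableAt_id.neg).const_cpow (Or.inl n2)
    have a2 : DifferentiableAt ℂ (fun z : ℂ => ((k + 1 + 1 : ℕ) : ℂ) ^ (1-z)) z := (differentiableAt_id.const_sub 1).const_cpow (Or.inl n2)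
    have a3 : DifferentiableAt ℂ (fun z : ℂ => ((k + 1 : ℕ) : ℂ) ^ (1-z)) z := (differentiableAt_id.const_sub 1).const_cpow (Or.inl n1)
    exact (((differentiableAt_id.sub_const 1).mul a1).add a2).sub a3
  have hsum : Summable (fun k : ℕ => R * (R + 1) * ((k + 1 : ℕ):ℝ) ^ (-(5/4:ℝ))) :=
    ((summable_nat_add_iff 1).2 (Real.summable_nat_rpow.2 (by norm_num))).mul_left _
  have hd1 : DifferentiableOn ℂ (fun z => z + ∑' k : ℕ, tau z (k + 1)) U := by
    apply differentiableOn_id.add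
    apply Complex.differentiableOn_tsum_of_summable_norm hsum (fun k => (hdt k).differentiableOn) hUo
    intro k w hw
    have w1 : 1/4 < w.re := hw.1
    have w2 : ‖w‖ < R := by simpa using hw.2
    refine (tau_bound (by linarith) (by omega)).trans ?_
    have w3 : ‖w - 1‖ ≤ R + 1 := (norm_sub_le _ _).trans (by simp; linarith)
    have w4 : ((k + 1 : ℕ):ℝ) ^ (-w.re - 1) ≤ ((k + 1 : ℕ):ℝ) ^ (-(5/4:ℝ)) := by
      apply rpow_le_rpow_of_exponent_le
      · push_cast; linarith [(Nat.cast_nonneg k : (0:ℝ) ≤ k)]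
      · linarith
    gcongr
  have h2 : (2:ℂ) ∈ U := by
    refine ⟨?_, ?_⟩
    · norm_num [Set.mem_setOf_eq]
    · simp [hR]; linarith [norm_nonneg s]
  have hsU : s ∈ U := ⟨hs, by simp [hR]⟩
  refine AnalyticOnNhd.eqOn_of_preconnected_of_eventuallyEq (hd1.analyticOnNhd hUo)
    (differentiable_riemannZeta₁.differentiableOn.analyticOnNhd hUo) hUc.isPreconnected h2 ?_ hsU
  filter_upwards [(isOpen_lt continuous_const Complex.continuous_re).mem_nhds (show (1:ℝ) < (2:ℂ).re by norm_num)] with z hz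
  exact zeta1_of_one_lt hz

theorem tel_sqrt {k : ℕ} (hk : 1 ≤ k) : (k:ℝ) ^ (-(1/2:ℝ) - 1) ≤ 6 * (1 / √k - 1 / √(k + 1 : ℕ)) := by
  have k1 : (1:ℝ) ≤ k := by exact_mod_cast hk
  have e1 : (k:ℝ) ^ (-(1/2:ℝ) - 1) = 1 / (√k * k) := by
    rw [show -(1/2:ℝ) - 1 = -((1/2) + 1) by ring, rpow_neg (by linarith), rpow_add (by linarith), ← sqrt_eq_rpow, rpow_one, one_div]
  rw [e1]
  push_cast
  set u := √(k:ℝ) with hu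
  set v := √((k:ℝ) + 1) with hv
  have u0 : 0 < u := sqrt_pos.2 (by linarith)
  have v0 : 0 < v := sqrt_pos.2 (by linarith)
  have uu : u ^ 2 = k := sq_sqrt (by linarith)
  have vv : v ^ 2 = k + 1 := sq_sqrt (by linarith)
  have v2 : v ≤ 2 * u := by nlinarith
  have e2 : 1 / u - 1 / v = 1 / (u * v * (u + v)) := by
    rw [div_sub_div _ _ u0.ne' v0.ne', div_eq_div_iff (by positivity) (by positivity)]
    have : (v - u) * (u + v) = 1 := by nlinarith
    linear_combination u * v * this
  rw [e2, ← uu, mul_one_div, div_le_div_iff₀ (by positivity) (by positivity)]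
  have : v * (u + v) ≤ (2 * u) * (3 * u) := by gcongr; linarith
  nlinarith

theorem sig_diff {t : ℝ} {M : ℕ} (hM : 1 ≤ M) (j : ℕ) :
    ‖sig (1/2 + Complex.I * t) (M + j) - sig (1/2 + Complex.I * t) M‖ ≤
      ‖(1/2 + Complex.I * t : ℂ)‖ * ‖(1/2 + Complex.I * t : ℂ) - 1‖ * (6 * (1 / √M - 1 / √(M + j : ℕ))) := by
  induction j with
  | zero => simp
  | succ j ih =>
    set s : ℂ := 1/2 + Complex.I * t
    have hre : s.re = 1/2 := by simp [s]
    have h1 := tau_bound (s := s) (by rw [hre]; norm_num) (k := M + j) (by omega)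
    rw [hre] at h1
    have h2 := tel_sqrt (k := M + j) (by omega)
    have h3 : ‖s‖ * ‖s - 1‖ * ((M + j : ℕ):ℝ) ^ (-(1/2:ℝ) - 1) ≤ ‖s‖ * ‖s - 1‖ * (6 * (1 / √(M + j : ℕ) - 1 / √(M + j + 1 : ℕ))) := by gcongr
    rw [← add_assoc, sig_succ, add_sub_right_comm]
    refine (norm_add_le _ _).trans ?_
    linarith

/-- `D_M(t)` -/
noncomputable def DM (M : ℕ) (t : ℝ) : ℂ :=
  ∑ m ∈ Finset.Icc 1 M, (m : ℂ) ^ (-(1/2 + Complex.I * t : ℂ)) + (M:ℂ) ^ (1 - (1/2 + Complex.I * t : ℂ)) / ((1/2 + Complex.I * t : ℂ) - 1)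

theorem zeta_approx (t : ℝ) {M : ℕ} (hM : 1 ≤ M) :
    ‖riemannZeta (1 / 2 + Complex.I * t) - DM M t‖ ≤ ‖(1/2 + Complex.I * t : ℂ)‖ * (6 / √M) := by
  unfold DM
  set s : ℂ := 1/2 + Complex.I * t with hsdef
  have hre : s.re = 1/2 := by simp [s]
  have hs1 : s - 1 ≠ 0 := by
    intro h
    have := congrArg Complex.re h
    rw [Complex.sub_re, hre] at this
    norm_num at this
  have hlim := sig_tendsto (s := s) (by rw [hre]; norm_num)
  rw [zeta1_eq (by rw [hre]; norm_num), ← Filter.tendsto_add_atTop_iff_nat M] at hlim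
  have h1 : ‖riemannZeta₁ s - sig s M‖ ≤ ‖s‖ * ‖s - 1‖ * (6 / √M) := by
    refine le_of_tendsto (hlim.sub_const (sig s M)).norm (Filter.Eventually.of_forall fun j => ?_)
    have := sig_diff (t := t) hM j
    rw [add_comm j M]
    refine this.trans ?_
    rw [← hsdef, mul_sub, mul_one_div]
    gcongr
    have : 0 ≤ 6 * (1 / √((M + j : ℕ):ℝ)) := by positivity
    linarith
  have e1 : riemannZeta s - (∑ m ∈ Finset.Icc 1 M, (m : ℂ) ^ (-s) + (M:ℂ) ^ (1 - s) / (s - 1)) = (riemannZeta₁ s - sig s M) / (s - 1) := by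
    rw [riemannZeta_eq_inv_sub_mul (sub_ne_zero.1 hs1)]
    unfold sig
    field_simp
  rw [e1, norm_div, div_le_iff₀ (norm_pos_iff.2 hs1)]
  linarith

end Atk

namespace Atk

theorem s_sub_ne (t : ℝ) : (1/2 + Complex.I * t : ℂ) - 1 ≠ 0 := by
  intro h
  have := congrArg Complex.re h
  norm_num at this

theorem DM_cont {M : ℕ} (hM : 1 ≤ M) : Continuous (DM M) := by
  unfold DM
  apply Continuous.add
  · apply continuous_finsetSum
    intro m hm
    have hm0 : (m:ℂ) ≠ 0 := by
      have := (Finset.mem_Icc.1 hm).1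
      exact_mod_cast (by omega : m ≠ 0)
    exact Continuous.const_cpow (by fun_prop) (Or.inl hm0)
  · have hM0 : (M:ℂ) ≠ 0 := by exact_mod_cast (by omega : M ≠ 0)
    exact (Continuous.const_cpow (by fun_prop) (Or.inl hM0)).div (by fun_prop) (fun t => s_sub_ne t)

theorem zeta_cont : Continuous (fun t : ℝ => riemannZeta (1 / 2 + Complex.I * t)) := by
  rw [continuous_iff_continuousAt]
  intro t
  have h1 := (differentiableAt_riemannZeta (sub_ne_zero.1 (s_sub_ne t))).continuousAt
  exact ContinuousAt.comp (f := fun t : ℝ => (1 / 2 + Complex.I * t : ℂ)) h1 (by fun_prop)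

theorem s_norm {t : ℝ} (ht : 0 ≤ t) : ‖(1/2 + Complex.I * t : ℂ)‖ ≤ 1 + t := by
  refine (norm_add_le _ _).trans ?_
  rw [norm_mul, Complex.norm_I, Complex.norm_real, norm_eq_abs, abs_of_nonneg ht]
  norm_num
  

theorem zeta_bd {t : ℝ} (ht : 0 ≤ t) : ‖riemannZeta (1 / 2 + Complex.I * t)‖ ≤ 9 * (1 + t) := by
  have h1 := zeta_approx t (le_refl 1)
  have h2 : ‖DM 1 t‖ ≤ 3 := by
    unfold DM
    simp only [Finset.Icc_self, Finset.sum_singleton, Nat.cast_one, Complex.one_cpow]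
    refine (norm_add_le _ _).trans ?_
    have h3 : 1/2 ≤ ‖(1/2 + Complex.I * t : ℂ) - 1‖ := by
      have := Complex.abs_re_le_norm ((1/2 + Complex.I * t : ℂ) - 1)
      norm_num at this
      norm_num
      exact this
    rw [norm_div, norm_one]
    have : 1 / ‖(1/2 + Complex.I * t : ℂ) - 1‖ ≤ 1 / (1/2) := by gcongr
    linarith
  have h3 := s_norm ht
  have h4 := norm_sub_norm_le (riemannZeta (1 / 2 + Complex.I * t)) (DM 1 t)
  simp only [Nat.cast_one, sqrt_one, div_one] at h1
  linarith

theorem mean_sq_approx {T : ℝ} {M : ℕ} (hT : 1 ≤ T) (hM : T ^ 6 ≤ M) :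
    |(∫ t in (0:ℝ)..T, ‖riemannZeta (1 / 2 + Complex.I * t)‖^2) - ∫ t in (0:ℝ)..T, ‖DM M t‖^2| ≤ 576 := by
  have hM1' : (1:ℝ) ≤ M := (one_le_pow₀ hT).trans hM
  have hM1 : 1 ≤ M := by exact_mod_cast hM1'
  have i1 : IntervalIntegrable (fun t : ℝ => ‖riemannZeta (1 / 2 + Complex.I * t)‖^2) volume 0 T := (zeta_cont.norm.pow 2).intervalIntegrable _ _
  have i2 : IntervalIntegrable (fun t : ℝ => ‖DM M t‖^2) volume 0 T := ((DM_cont hM1).norm.pow 2).intervalIntegrable _ _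
  rw [← intervalIntegral.integral_sub i1 i2]
  have hb : ∀ t ∈ Set.uIoc 0 T, ‖‖riemannZeta (1 / 2 + Complex.I * t)‖^2 - ‖DM M t‖^2‖ ≤ 144 * (2*T)^2 / T^3 := by
    intro t ht
    rw [Set.uIoc_of_le (by linarith)] at ht
    have t0 : 0 ≤ t := ht.1.le
    have tT := ht.2
    have h1 := zeta_approx t hM1
    have h2 := zeta_bd t0
    have h3 := s_norm t0
    have hsq : T^3 ≤ √M := by
      apply le_sqrt_of_sq_le
      rw [← pow_mul]; exact hM
    have h4 := abs_norm_sub_norm_le (riemannZeta (1 / 2 + Complex.I * t)) (DM M t)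
    set z := ‖riemannZeta (1 / 2 + Complex.I * t)‖ with hz
    set d := ‖DM M t‖ with hd
    have h5 : |z - d| ≤ (2*T) * (6 / T^3) := by
      refine h4.trans (h1.trans ?_)
      gcongr
      linarith
    have h6 : (6:ℝ) / T^3 ≤ 6 := div_le_self (by norm_num) (one_le_pow₀ hT)
    have h7 : |z - d| ≤ (2*T) * 6 := h5.trans (by gcongr)
    have z0 : 0 ≤ z := norm_nonneg _
    have d0 : 0 ≤ d := norm_nonneg _
    have h8 : z + d ≤ 24 * (2 * T) := by
      have := (abs_le.1 h7).1
      nlinarith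
    rw [norm_eq_abs, show z^2 - d^2 = (z - d) * (z + d) by ring, abs_mul, abs_of_nonneg (add_nonneg z0 d0)]
    calc _ ≤ ((2*T) * (6 / T^3)) * (24 * (2 * T)) := by gcongr
      _ = _ := by ring
  have := intervalIntegral.norm_integral_le_of_norm_le_const hb
  rw [norm_eq_abs] at this
  refine this.trans ?_
  rw [sub_zero, abs_of_nonneg (by linarith)]
  apply le_of_eq
  field_simp
  norm_num

end Atk

namespace Atk

theorem sq_sum_Icc (x : ℕ → ℝ) (M : ℕ) : (∑ m ∈ Finset.Icc 1 M, x m)^2 =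
    ∑ m ∈ Finset.Icc 1 M, (x m)^2 + 2 * ∑ m ∈ Finset.Icc 1 M, ∑ k ∈ Finset.Ioc m M, x m * x k := by
  induction M with
  | zero => simp
  | succ M ih =>
    rw [Finset.sum_Icc_succ_top (by omega), Finset.sum_Icc_succ_top (by omega), Finset.sum_Icc_succ_top (by omega)]
    have : ∑ m ∈ Finset.Icc 1 M, ∑ k ∈ Finset.Ioc m (M+1), x m * x k = ∑ m ∈ Finset.Icc 1 M, (∑ k ∈ Finset.Ioc m M, x m * x k + x m * x (M+1)) := by
      apply Finset.sum_congr rfl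
      intro m hm
      rw [Finset.sum_Ioc_succ_top (Finset.mem_Icc.1 hm).2]
    rw [this, Finset.sum_add_distrib, ← Finset.sum_mul]
    simp only [Finset.Ioc_self, Finset.sum_empty]
    linear_combination ih

/-- kernel -/
noncomputable def ck (t s : ℝ) : ℝ := exp (-(1/2) * log s) * cos (t * log s)
noncomputable def Gf (T s : ℝ) : ℝ := fA s * sin (T * log s)
noncomputable def GG (t w : ℝ) : ℝ := exp (w / 2) * (1/2 * cos (t * w) + t * sin (t * w)) / (1/4 + t^2)

theorem ck_int (t : ℝ) {Z : ℝ} (hZ : 1 ≤ Z) : ∫ s in (1:ℝ)..Z, ck t s = GG t (log Z) - (1/2) / (1/4 + t^2) := by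
  have hc : ContinuousOn (fun s => ck t s) (Set.uIcc 1 Z) := by
    have : ContinuousOn log (Set.uIcc 1 Z) := by
      apply continuousOn_log.mono
      intro x hx
      rw [Set.uIcc_of_le hZ] at hx
      exact ne_of_gt (by linarith [hx.1])
    unfold ck
    fun_prop
  rw [intervalIntegral.integral_eq_sub_of_hasDerivAt (f := fun s => GG t (log s)) ?_ hc.intervalIntegrable]
  · unfold GG; simp
  · intro s hs
    rw [Set.uIcc_of_le hZ] at hs
    have s0 : 0 < s := by linarith [hs.1]
    have hp : (1/4 + t^2) ≠ 0 := by positivity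
    have d1 : ∀ w, HasDerivAt (GG t) (exp (w/2) * cos (t * w)) w := by
      intro w
      have a1 : HasDerivAt (fun w : ℝ => exp (w/2)) (exp (w/2) * (1/2)) w := ((hasDerivAt_id w).div_const 2).exp
      have a2 : HasDerivAt (fun w : ℝ => t * w) t w := by simpa using (hasDerivAt_id w).const_mul t
      have a3 := (a2.cos.const_mul (1/2)).add (a2.sin.const_mul t)
      refine ((a1.mul a3).div_const (1/4 + t^2)).congr_deriv ?_
      simp only [Pi.add_apply]
      field_simp
      ring
    refine ((d1 (log s)).comp s (hasDerivAt_log s0.ne')).congr_deriv ?_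
    unfold ck
    have : exp (log s / 2) * s⁻¹ = exp (-(1/2) * log s) := by
      nth_rewrite 2 [← exp_log s0]
      rw [← exp_neg, ← exp_add]; congr 1; ring
    rw [← this]; ring

theorem natcpow {m : ℕ} (hm : 1 ≤ m) (r t : ℝ) : ((m:ℂ) ^ ((r:ℂ) - Complex.I * t)) =
    ((exp (r * log m) * cos (t * log m) : ℝ) : ℂ) - ((exp (r * log m) * sin (t * log m) : ℝ):ℂ) * Complex.I := by
  have hm0 : (m:ℂ) ≠ 0 := by exact_mod_cast (by omega : m ≠ 0)
  rw [Complex.cpow_def_of_ne_zero hm0, ← Complex.natCast_log]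
  have : ((log m : ℝ):ℂ) * ((r:ℂ) - Complex.I * t) = ((r * log m : ℝ):ℂ) + ((-(t * log m) : ℝ):ℂ) * Complex.I := by
    push_cast; ring
  rw [this, Complex.exp_add, Complex.exp_mul_I, ← Complex.ofReal_exp, ← Complex.ofReal_cos, ← Complex.ofReal_sin, cos_neg, sin_neg]
  push_cast; ring

theorem DM_sq (t : ℝ) {M : ℕ} (hM : 1 ≤ M) : ‖DM M t‖^2 = ∑ m ∈ Finset.Icc 1 M, 1/(m:ℝ) +
    2 * ∑ m ∈ Finset.Icc 1 M, (∑ k ∈ Finset.Ioc m M, (1/(m:ℝ)) * ck t (k/m) - ∫ s in (1:ℝ)..(M/m:ℝ), ck t s) := by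
  set C : ℕ → ℝ := fun m => exp (-(1/2) * log m) * cos (t * log m) with hC
  set S : ℕ → ℝ := fun m => exp (-(1/2) * log m) * sin (t * log m) with hS
  set v := t * log M with hv
  set a := exp (1/2 * log M) / (1/4 + t^2) with ha
  have hp : (1/4 + t^2) ≠ 0 := by positivity
  have hM1 : (1:ℝ) ≤ M := by exact_mod_cast hM
  set RP := a * (1/2 * cos v + t * sin v) with hRP
  set IP := a * (t * cos v - 1/2 * sin v) with hIP
  have hD : DM M t = ((∑ m ∈ Finset.Icc 1 M, C m - RP : ℝ):ℂ) + ((-∑ m ∈ Finset.Icc 1 M, S m - IP : ℝ):ℂ) * Complex.I := by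
    unfold DM
    have e1 : ∑ m ∈ Finset.Icc 1 M, (m : ℂ) ^ (-(1/2 + Complex.I * t : ℂ)) = ∑ m ∈ Finset.Icc 1 M, (((C m : ℝ):ℂ) - ((S m : ℝ):ℂ) * Complex.I) := by
      apply Finset.sum_congr rfl
      intro m hm
      have := natcpow (Finset.mem_Icc.1 hm).1 (-(1/2)) t
      rw [← this]; congr 1; push_cast; ring
    have e2 : (M:ℂ) ^ (1 - (1/2 + Complex.I * t : ℂ)) / ((1/2 + Complex.I * t : ℂ) - 1) = -(RP : ℂ) - (IP:ℂ) * Complex.I := by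
      have := natcpow hM (1/2) t
      rw [show 1 - (1/2 + Complex.I * t : ℂ) = ((1/2:ℝ):ℂ) - Complex.I * t by push_cast; ring, this, div_eq_iff (s_sub_ne t), ← hv]
      have e3 : exp (1/2 * log M) = a * (1/4 + t^2) := by rw [ha]; field_simp
      rw [e3, hRP, hIP]
      push_cast
      linear_combination ((a:ℂ) * (t:ℂ)^2 * Complex.cos v - a * t * (1/2) * Complex.sin v) * Complex.I_sq
    rw [e1, e2, Finset.sum_sub_distrib, ← Finset.sum_mul]
    push_cast
    ring
  have hn : ‖DM M t‖^2 = (∑ m ∈ Finset.Icc 1 M, C m - RP)^2 + (-∑ m ∈ Finset.Icc 1 M, S m - IP)^2 := by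
    rw [hD, ← Complex.normSq_eq_norm_sq, Complex.normSq_add_mul_I]
  have hcs : ∀ m, C m ^ 2 + S m ^ 2 = exp (-(1/2) * log m)^2 := fun m => by
    simp only [hC, hS]
    linear_combination (exp (-(1/2) * log m))^2 * sin_sq_add_cos_sq (t * log m)
  have hPP : RP^2 + IP^2 = M / (1/4 + t^2) := by
    have e1 : exp (1/2 * log M)^2 = M := by
      rw [← exp_nat_mul, show ((2:ℕ):ℝ) * (1/2 * log M) = log M by push_cast; ring, exp_log (by linarith)]
    have e2 : RP^2 + IP^2 = a^2 * (1/4 + t^2) := by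
      rw [hRP, hIP]
      linear_combination (a^2 * (1/4 + t^2)) * sin_sq_add_cos_sq v
    rw [e2, ha, div_pow, e1]; field_simp
  have h1 : ∀ m ∈ Finset.Icc 1 M, C m ^ 2 + S m ^ 2 = 1/(m:ℝ) := by
    intro m hm
    have m0 : (0:ℝ) < m := by exact_mod_cast (Finset.mem_Icc.1 hm).1
    rw [hcs, ← exp_nat_mul, show ((2:ℕ):ℝ) * (-(1/2) * log m) = -log m by push_cast; ring, exp_neg, exp_log m0, one_div]
  have h2 : ∀ m ∈ Finset.Icc 1 M, ∀ k ∈ Finset.Ioc m M, C m * C k + S m * S k = (1/(m:ℝ)) * ck t (k/m) := by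
    intro m hm k hk
    have m0 : (0:ℝ) < m := by exact_mod_cast (Finset.mem_Icc.1 hm).1
    have k0 : (0:ℝ) < k := by exact_mod_cast (by linarith [(Finset.mem_Icc.1 hm).1, (Finset.mem_Ioc.1 hk).1] : 0 < k)
    simp only [hC, hS, ck]
    rw [log_div k0.ne' m0.ne', mul_sub t, cos_sub]
    have : 1 / (m:ℝ) * exp (-(1/2) * (log k - log m)) = exp (-(1/2) * log m) * exp (-(1/2) * log k) := by
      rw [one_div]; nth_rewrite 1 [← exp_log m0]
      rw [← exp_neg, ← exp_add, ← exp_add]; congr 1; ring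
    linear_combination (-(cos (t * log k) * cos (t * log m) + sin (t * log k) * sin (t * log m))) * this
  have h3 : ∀ m ∈ Finset.Icc 1 M, C m * RP - S m * IP = (1/2)/(1/4+t^2) + ∫ s in (1:ℝ)..(M/m:ℝ), ck t s := by
    intro m hm
    have m0 : (0:ℝ) < m := by exact_mod_cast (Finset.mem_Icc.1 hm).1
    have hmM : (m:ℝ) ≤ M := by exact_mod_cast (Finset.mem_Icc.1 hm).2
    rw [ck_int t ((one_le_div m0).2 hmM)]
    unfold GG
    rw [log_div (by linarith) m0.ne', mul_sub t, cos_sub, sin_sub, ← hv]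
    simp only [hC, hS, hRP, hIP, ha]
    have : exp ((log M - log m)/2) = exp (-(1/2) * log m) * exp (1/2 * log M) := by
      rw [← exp_add]; congr 1; ring
    rw [this]
    field_simp
    ring
  rw [hn]
  have h4 := sq_sum_Icc C M
  have h5 := sq_sum_Icc S M
  have h6 : ∑ m ∈ Finset.Icc 1 M, 1/(m:ℝ) = ∑ m ∈ Finset.Icc 1 M, C m ^ 2 + ∑ m ∈ Finset.Icc 1 M, S m ^ 2 := by
    rw [← Finset.sum_add_distrib]
    exact Finset.sum_congr rfl fun m hm => (h1 m hm).symm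
  have h7 : ∑ m ∈ Finset.Icc 1 M, ∑ k ∈ Finset.Ioc m M, (1/(m:ℝ)) * ck t (k/m) = 
     ∑ m ∈ Finset.Icc 1 M, ∑ k ∈ Finset.Ioc m M, C m * C k + ∑ m ∈ Finset.Icc 1 M, ∑ k ∈ Finset.Ioc m M, S m * S k := by
    rw [← Finset.sum_add_distrib]
    refine Finset.sum_congr rfl fun m hm => ?_
    rw [← Finset.sum_add_distrib]
    exact Finset.sum_congr rfl fun k hk => (h2 m hm k hk).symm
  have h8 : (∑ m ∈ Finset.Icc 1 M, C m) * RP - (∑ m ∈ Finset.Icc 1 M, S m) * IP = M * ((1/2)/(1/4+t^2)) + ∑ m ∈ Finset.Icc 1 M, ∫ s in (1:ℝ)..(M/m:ℝ), ck t s := by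
    rw [Finset.sum_mul, Finset.sum_mul, ← Finset.sum_sub_distrib, Finset.sum_congr rfl h3, Finset.sum_add_distrib]
    simp
  rw [Finset.sum_sub_distrib, h7, h6]
  have h9 : M * ((1/2)/(1/4+t^2)) = (1/2) * (M / (1/4 + t^2)) := by ring
  rw [h9, ← hPP] at h8
  linear_combination h4 + h5 - 2 * h8

theorem ck_tint (T : ℝ) {s : ℝ} (hs : 1 < s) : ∫ t in (0:ℝ)..T, ck t s = Gf T s := by
  have hl : log s ≠ 0 := (log_pos hs).ne'
  unfold ck Gf fA
  rw [intervalIntegral.integral_const_mul, intervalIntegral.integral_comp_mul_right (fun x => cos x) hl, integral_cos]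
  simp
  ring

theorem ck_cont : ContinuousOn (fun p : ℝ × ℝ => ck p.1 p.2) (Set.univ ×ˢ Set.Ioi 0) := by
  unfold ck
  have h : ContinuousOn (fun p : ℝ × ℝ => log p.2) (Set.univ ×ˢ Set.Ioi 0) :=
    continuousOn_log.comp continuousOn_snd (fun p hp => ne_of_gt hp.2)
  have h2 : ContinuousOn (fun p : ℝ × ℝ => p.1) (Set.univ ×ˢ Set.Ioi 0) := continuousOn_fst
  exact ((continuous_exp.comp_continuousOn (h.const_smul (-(1/2:ℝ))))).mul (continuous_cos.comp_continuousOn (h2.mul h))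

theorem mean_sq {T : ℝ} (hT : 0 ≤ T) {M : ℕ} (hM : 1 ≤ M) : ∫ t in (0:ℝ)..T, ‖DM M t‖^2 = T * ∑ m ∈ Finset.Icc 1 M, 1/(m:ℝ) +
    2 * ∑ m ∈ Finset.Icc 1 M, (∑ k ∈ Finset.Ioc m M, (1/(m:ℝ)) * Gf T (k/m) - ∫ s in (1:ℝ)..(M/m:ℝ), Gf T s) := by
  have hck : ∀ s : ℝ, IntervalIntegrable (fun t => ck t s) volume 0 T := fun s => by
    apply Continuous.intervalIntegrable; unfold ck; fun_prop
  have hi : ∀ m ∈ Finset.Icc 1 M, IntegrableOn (fun p : ℝ × ℝ => ck p.1 p.2) (Set.uIoc 0 T ×ˢ Set.uIoc 1 (M/m:ℝ)) := by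
    intro m hm
    have m0 : (0:ℝ) < m := by exact_mod_cast (Finset.mem_Icc.1 hm).1
    have hmM : (m:ℝ) ≤ M := by exact_mod_cast (Finset.mem_Icc.1 hm).2
    have : IntegrableOn (fun p : ℝ × ℝ => ck p.1 p.2) (Set.uIcc 0 T ×ˢ Set.uIcc 1 (M/m:ℝ)) := by
      apply ContinuousOn.integrableOn_compact (isCompact_uIcc.prod isCompact_uIcc)
      apply ck_cont.mono
      rintro ⟨x, y⟩ ⟨h1, h2⟩
      refine ⟨trivial, ?_⟩
      rw [Set.uIcc_of_le ((one_le_div m0).2 hmM)] at h2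
      exact lt_of_lt_of_le one_pos h2.1
    exact this.mono_set (Set.prod_mono Set.uIoc_subset_uIcc Set.uIoc_subset_uIcc)
  have hintg : ∀ m ∈ Finset.Icc 1 M, IntervalIntegrable (fun t => ∫ s in (1:ℝ)..(M/m:ℝ), ck t s) volume 0 T := by
    intro m hm
    have m0 : (0:ℝ) < m := by exact_mod_cast (Finset.mem_Icc.1 hm).1
    have hmM : (m:ℝ) ≤ M := by exact_mod_cast (Finset.mem_Icc.1 hm).2
    have : (fun t => ∫ s in (1:ℝ)..(M/m:ℝ), ck t s) = fun t => GG t (log (M/m)) - (1/2) / (1/4 + t^2) := by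
      funext t; exact ck_int t ((one_le_div m0).2 hmM)
    rw [this]
    apply Continuous.intervalIntegrable
    unfold GG
    have hp : ∀ t : ℝ, (1/4 + t^2) ≠ 0 := fun t => by positivity
    exact (Continuous.div (by fun_prop) (by fun_prop) hp).sub (Continuous.div (by fun_prop) (by fun_prop) hp)
  have hs2 : ∀ m ∈ Finset.Icc 1 M, IntervalIntegrable (fun t => ∑ k ∈ Finset.Ioc m M, (1/(m:ℝ)) * ck t (k/m)) volume 0 T := by
    intro m hm
    apply Continuous.intervalIntegrable
    unfold ck
    fun_prop
  have e0 : ∀ t, ‖DM M t‖^2 = ∑ m ∈ Finset.Icc 1 M, 1/(m:ℝ) +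
    2 * ∑ m ∈ Finset.Icc 1 M, (∑ k ∈ Finset.Ioc m M, (1/(m:ℝ)) * ck t (k/m) - ∫ s in (1:ℝ)..(M/m:ℝ), ck t s) := fun t => DM_sq t hM
  simp only [e0]
  rw [intervalIntegral.integral_add (by simp) ?_, intervalIntegral.integral_const, intervalIntegral.integral_const_mul,
    intervalIntegral.integral_finsetSum (fun m hm => (hs2 m hm).sub (hintg m hm))]
  · rw [sub_zero, smul_eq_mul]
    congr 2
    apply Finset.sum_congr rfl
    intro m hm
    have m0 : (0:ℝ) < m := by exact_mod_cast (Finset.mem_Icc.1 hm).1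
    have hmM : (m:ℝ) ≤ M := by exact_mod_cast (Finset.mem_Icc.1 hm).2
    rw [intervalIntegral.integral_sub (hs2 m hm) (hintg m hm)]
    congr 1
    · rw [intervalIntegral.integral_finsetSum (fun k _ => (hck _).const_mul _)]
      apply Finset.sum_congr rfl
      intro k hk
      rw [intervalIntegral.integral_const_mul, ck_tint T ((one_lt_div m0).2 (by exact_mod_cast (Finset.mem_Ioc.1 hk).1))]
    · rw [intervalIntegral_intervalIntegral_swap]
      · apply intervalIntegral.integral_congr_ae
        refine Filter.Eventually.of_forall fun s hs => ?_
        rw [Set.uIoc_of_le ((one_le_div m0).2 hmM)] at hs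
        exact ck_tint T hs.1
      · exact hi m hm
  · apply IntervalIntegrable.const_mul
    have := IntervalIntegrable.sum (Finset.Icc 1 M) (fun m hm => (hs2 m hm).sub (hintg m hm))
    refine this.congr (fun t _ => ?_)
    simp

end Atk

namespace Atk

theorem split_comb (F : ℕ → ℕ → ℝ) {Y : ℝ} (hY : 0 < Y) (M : ℕ) :
    ∑ m ∈ Finset.Icc 1 M, ∑ k ∈ Finset.Ioc m M, F m k =
      ∑ m ∈ Finset.Icc 1 ⌊M/(1+1/Y)⌋₊, ∑ k ∈ Finset.Ioc ⌊(1+1/Y)*m⌋₊ M, F m k +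
      ∑ r ∈ Finset.Icc 1 ⌊M/(1+Y)⌋₊, ∑ m ∈ Finset.Icc ⌈Y*r⌉₊ (M-r), F m (m+r) := by
  have hc : 1 < 1 + 1/Y := by have := one_div_pos.2 hY; linarith
  set c := 1 + 1/Y with hcdef
  have hcY : Y*c = 1 + Y := by rw [hcdef]; field_simp; ring
  have e1 : ∑ m ∈ Finset.Icc 1 M, ∑ k ∈ Finset.Ioc m M, F m k =
      ∑ m ∈ Finset.Icc 1 M, ∑ k ∈ (Finset.Ioc m M).filter (fun k : ℕ => ¬ (k:ℝ) ≤ c*m), F m k +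
      ∑ m ∈ Finset.Icc 1 M, ∑ k ∈ (Finset.Ioc m M).filter (fun k : ℕ => (k:ℝ) ≤ c*m), F m k := by
    rw [← Finset.sum_add_distrib]
    apply Finset.sum_congr rfl
    intro m _
    rw [add_comm, Finset.sum_filter_add_sum_filter_not]
  rw [e1]
  congr 1
  · have e2 : ∀ m : ℕ, (Finset.Ioc m M).filter (fun k : ℕ => ¬ (k:ℝ) ≤ c*m) = Finset.Ioc ⌊c*m⌋₊ M := by
      intro m
      ext k
      have h0 : 0 ≤ c*m := by positivity
      simp only [Finset.mem_filter, Finset.mem_Ioc, not_le, Nat.floor_lt h0]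
      constructor
      · rintro ⟨⟨a, b⟩, d⟩; exact ⟨d, b⟩
      · rintro ⟨d, b⟩
        refine ⟨⟨?_, b⟩, d⟩
        have : (m:ℝ) < k := by nlinarith [Nat.cast_nonneg (α := ℝ) m]
        exact_mod_cast this
    simp only [e2]
    symm
    apply Finset.sum_subset
    · intro m hm
      rw [Finset.mem_Icc] at hm ⊢
      refine ⟨hm.1, hm.2.trans ?_⟩
      apply Nat.floor_le_of_le
      exact div_le_self (Nat.cast_nonneg M) hc.le
    · intro m hm hm'
      rw [Finset.mem_Icc] at hm hm'
      have h1 : ⌊M/c⌋₊ < m := by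
        by_contra h; exact hm' ⟨hm.1, not_lt.1 h⟩
      rw [Nat.floor_lt (by positivity), div_lt_iff₀ (by linarith)] at h1
      rw [Finset.Ioc_eq_empty, Finset.sum_empty]
      intro h2
      rw [Nat.floor_lt (by positivity)] at h2
      linarith
  · rw [Finset.sum_sigma', Finset.sum_sigma']
    apply Finset.sum_bij' (i := fun p _ => (⟨p.2 - p.1, p.1⟩ : (_ : ℕ) × ℕ)) (j := fun p _ => (⟨p.2, p.2 + p.1⟩ : (_ : ℕ) × ℕ))
    · rintro ⟨m, k⟩ h
      simp only [Finset.mem_sigma, Finset.mem_Icc, Finset.mem_filter, Finset.mem_Ioc] at h ⊢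
      obtain ⟨⟨h1, h2⟩, ⟨h3, h4⟩, h5⟩ := h
      have hk : ((k - m : ℕ):ℝ) = k - m := by rw [Nat.cast_sub h3.le]
      have h6 : Y * ((k - m : ℕ):ℝ) ≤ m := by rw [hk]; nlinarith
      refine ⟨⟨by omega, ?_⟩, ?_, by omega⟩
      · apply Nat.le_floor
        rw [le_div_iff₀ (by linarith)]
        have : (k:ℝ) ≤ M := by exact_mod_cast h4
        linarith
      · exact Nat.ceil_le.2 h6
    · rintro ⟨r, m⟩ h
      simp only [Finset.mem_sigma, Finset.mem_Icc, Finset.mem_filter, Finset.mem_Ioc] at h ⊢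
      obtain ⟨⟨h1, h2⟩, h3, h4⟩ := h
      have h5 : Y * r ≤ m := Nat.ceil_le.1 h3
      have r0 : (1:ℝ) ≤ r := by exact_mod_cast h1
      have m0 : (0:ℝ) < m := by nlinarith
      have m1 : 0 < m := by exact_mod_cast m0
      refine ⟨⟨m1, by omega⟩, ⟨by omega, by omega⟩, ?_⟩
      push_cast
      have : c*m = m + m/Y := by rw [hcdef]; ring
      rw [this]
      have : (r:ℝ) ≤ m/Y := by rw [le_div_iff₀ hY]; linarith
      linarith
    · rintro ⟨m, k⟩ h
      simp only [Finset.mem_sigma, Finset.mem_Icc, Finset.mem_filter, Finset.mem_Ioc] at h ⊢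
      have : m + (k - m) = k := by omega
      simp [this]
    · rintro ⟨r, m⟩ h
      simp
    · rintro ⟨m, k⟩ h
      simp only [Finset.mem_sigma, Finset.mem_Icc, Finset.mem_filter, Finset.mem_Ioc] at h ⊢
      have : m + (k - m) = k := by omega
      simp [this]

/-- regularised far integrand -/
noncomputable def Gs (T s : ℝ) : ℝ := exp (-(1/2)*log s) * (T * sinc (T * log s))

theorem Gf_eq {T s : ℝ} (hs : 1 < s) : Gf T s = Gs T s := by
  unfold Gf Gs fA
  have hl : 0 < log s := log_pos hs
  by_cases hT : T = 0
  · simp [hT]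
  rw [sinc_of_ne_zero (by positivity)]
  field_simp

theorem Gs_cont (T : ℝ) : ContinuousOn (Gs T) (Set.Ioi 0) := by
  unfold Gs
  have h : ContinuousOn log (Set.Ioi 0) := continuousOn_log.mono (fun x hx => ne_of_gt hx)
  have h2 : ContinuousOn (fun s => sinc (T * log s)) (Set.Ioi 0) :=
    continuous_sinc.comp_continuousOn (by fun_prop)
  fun_prop

theorem Gf_int (T : ℝ) {a b : ℝ} (ha : 1 ≤ a) (hb : 1 ≤ b) : IntervalIntegrable (Gf T) volume a b := by
  have h : IntervalIntegrable (Gs T) volume a b := by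
    apply ContinuousOn.intervalIntegrable
    apply (Gs_cont T).mono
    intro x hx
    have := (Set.mem_uIcc.1 hx)
    rw [Set.mem_Ioi]
    rcases this with h | h <;> linarith [h.1]
  refine h.congr (fun x hx => ?_)
  have : 1 < x := by
    have := Set.mem_uIoc.1 hx
    rcases this with h | h <;> linarith [h.1]
  exact (Gf_eq this).symm

theorem near_pt (T : ℝ) {m r : ℕ} (hm : 1 ≤ m) (hr : 1 ≤ r) :
    (1/(m:ℝ)) * Gf T (((m+r:ℕ):ℝ)/m) = - ((1/(r:ℝ))*(nA (m/r)*sin (T*nl (m/r)))) := by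
  have m0 : (0:ℝ) < m := by exact_mod_cast hm
  have r0 : (0:ℝ) < r := by exact_mod_cast hr
  have y0 : (0:ℝ) < m/r := by positivity
  have e1 : log (((m+r:ℕ):ℝ)/m) = log (1 + m/r) - log ((m:ℝ)/r) := by
    rw [← log_div (by positivity) (by positivity)]
    congr 1; push_cast; field_simp; ring
  unfold Gf fA nA nl
  rw [e1]
  set L := log (1 + (m:ℝ)/r) - log ((m:ℝ)/r) with hL
  have e3 : log ((m:ℝ)/r) - log (1 + m/r) = -L := by rw [hL]; ring
  have e4 : exp (-(1/2)*(log ((m:ℝ)/r) + log (1+m/r))) = exp (-(1/2)*L) * exp (-log ((m:ℝ)/r)) := by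
    rw [← exp_add]; congr 1; rw [hL]; ring
  rw [e3, e4, exp_neg (log _), exp_log y0, mul_neg, sin_neg]
  field_simp

theorem icc_ioc (G : ℕ → ℝ) {x B : ℝ} (hx : 0 ≤ x) (b : ℕ) (hB : ∀ m : ℕ, (m:ℝ) = x → |G m| ≤ B) (hB0 : 0 ≤ B) :
    |∑ m ∈ Finset.Icc ⌈x⌉₊ b, G m - ∑ m ∈ Finset.Ioc ⌊x⌋₊ b, G m| ≤ B := by
  by_cases h : (⌊x⌋₊:ℝ) = x
  · have h1 : ⌈x⌉₊ = ⌊x⌋₊ := by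
      conv_lhs => rw [← h]
      simp
    rw [h1]
    by_cases h2 : ⌊x⌋₊ ≤ b
    · rw [← Finset.Ioc_insert_left h2, Finset.sum_insert (by simp)]
      rw [add_sub_cancel_right]
      exact hB _ h
    · rw [Finset.Icc_eq_empty h2, Finset.Ioc_eq_empty (by omega)]
      simpa using hB0
  · have h1 : ⌈x⌉₊ = ⌊x⌋₊ + 1 := by
      apply le_antisymm (Nat.ceil_le_floor_add_one x)
      apply Nat.succ_le_of_lt
      by_contra h3
      push Not at h3
      have := Nat.le_ceil x
      have h4 := Nat.floor_le hx
      have h5 : (⌈x⌉₊:ℝ) ≤ ⌊x⌋₊ := by exact_mod_cast h3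
      exact h (by linarith)
    rw [h1]
    have : Finset.Icc (⌊x⌋₊+1) b = Finset.Ioc ⌊x⌋₊ b := by ext; simp [Nat.succ_le_iff]
    rw [this]; simpa using hB0

noncomputable def nearB (T Y : ℝ) (M : ℕ) : ℝ := ∑ q∈Finset.Icc 1 ⌊M/(1+Y)⌋₊, ((∑ j∈Finset.Ioc ⌊Y*q⌋₊ (M - q), (1/(q:ℝ))*(nA (j/q)*sin (T*nl (j/q)))) - (∫ t in Y..((M-q:ℕ)/q:ℝ), nA t*sin (T*nl t)))

noncomputable def farB (T c : ℝ) (M : ℕ) : ℝ := ∑ q∈Finset.Icc 1 ⌊M/c⌋₊, ((∑ j∈Finset.Ioc ⌊c*q⌋₊ M, (1/(q:ℝ))*(fA (j/q)*sin (T*log (j/q)))) - (∫ t in c..(M/q:ℝ), fA t*sin (T*log t)))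

noncomputable def mainB (T Y : ℝ) (M : ℕ) : ℝ := -(∑ q∈Finset.Icc 1 ⌊M/(1+Y)⌋₊, ∫ t in Y..((M-q:ℕ)/q:ℝ), nA t*sin (T*nl t)) - ∑ m ∈ Finset.Icc 1 M, ∫ s in (1:ℝ)..min (1+1/Y) (M/m:ℝ), Gf T s

theorem split_final (T : ℝ) {Y : ℝ} (hY : 0 < Y) {M : ℕ} (hM : 1 ≤ M) :
    |∑ m∈Finset.Icc 1 M, (∑ k∈Finset.Ioc m M, (1/(m:ℝ))*Gf T (k/m) - ∫ s in (1:ℝ)..(M/m:ℝ), Gf T s)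
      - (farB T (1+1/Y) M - nearB T Y M + mainB T Y M)| ≤ nA Y * (1 + log M) := by
  have hc : 1 < 1 + 1/Y := by have := one_div_pos.2 hY; linarith
  have hA0 : 0 ≤ nA Y := by
    have := nL_lower hY
    have : 0 < 2 / (2*Y+1) := by positivity
    unfold nA
    apply div_nonneg (exp_pos _).le; linarith
  set c := 1 + 1/Y with hcdef
  set R := ⌊M/(1+Y)⌋₊ with hR
  have hRM : R ≤ M := by
    apply Nat.floor_le_of_le
    exact div_le_self (Nat.cast_nonneg M) (by linarith)
  rw [Finset.sum_sub_distrib, split_comb _ hY M]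
  have e1 : ∑ m ∈ Finset.Icc 1 M, ∫ s in (1:ℝ)..(M/m:ℝ), Gf T s =
      (∑ m ∈ Finset.Icc 1 M, ∫ s in (1:ℝ)..min c (M/m:ℝ), Gf T s) +
      ∑ m ∈ Finset.Icc 1 ⌊M/c⌋₊, ∫ s in c..(M/m:ℝ), Gf T s := by
    have : ∑ m ∈ Finset.Icc 1 ⌊M/c⌋₊, ∫ s in c..(M/m:ℝ), Gf T s =
        ∑ m ∈ Finset.Icc 1 M, ∫ s in (min c (M/m:ℝ))..(M/m:ℝ), Gf T s := by
      have h1 : ∑ m ∈ Finset.Icc 1 ⌊M/c⌋₊, ∫ s in c..(M/m:ℝ), Gf T s =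
        ∑ m ∈ Finset.Icc 1 ⌊M/c⌋₊, ∫ s in (min c (M/m:ℝ))..(M/m:ℝ), Gf T s := by
        apply Finset.sum_congr rfl
        intro m hm
        rw [Finset.mem_Icc, Nat.le_floor_iff (by positivity)] at hm
        have m0 : (0:ℝ) < m := by exact_mod_cast hm.1
        have : c ≤ M/m := by
          rw [le_div_iff₀ m0]
          have := hm.2
          rw [le_div_iff₀ (by linarith)] at this
          linarith
        rw [min_eq_left this]
      rw [h1]
      apply Finset.sum_subset
      · intro m hm
        rw [Finset.mem_Icc] at hm ⊢
        refine ⟨hm.1, hm.2.trans ?_⟩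
        apply Nat.floor_le_of_le
        exact div_le_self (Nat.cast_nonneg M) hc.le
      · intro m hm hm'
        rw [Finset.mem_Icc] at hm hm'
        have m0 : (0:ℝ) < m := by exact_mod_cast hm.1
        have h1 : ⌊M/c⌋₊ < m := by
          by_contra h; exact hm' ⟨hm.1, not_lt.1 h⟩
        rw [Nat.floor_lt (by positivity), div_lt_iff₀ (by linarith)] at h1
        have : (M:ℝ)/m ≤ c := by rw [div_le_iff₀ m0]; linarith
        rw [min_eq_right this, intervalIntegral.integral_same]
    rw [this, ← Finset.sum_add_distrib]
    apply Finset.sum_congr rfl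
    intro m hm
    rw [Finset.mem_Icc] at hm
    have m0 : (0:ℝ) < m := by exact_mod_cast hm.1
    have h1 : 1 ≤ (M:ℝ)/m := by rw [one_le_div m0]; exact_mod_cast hm.2
    rw [intervalIntegral.integral_add_adjacent_intervals (Gf_int T le_rfl (le_min hc.le h1)) (Gf_int T (le_min hc.le h1) h1)]
  rw [e1]
  have e2 : ∑ r ∈ Finset.Icc 1 R, ∑ m ∈ Finset.Icc ⌈Y*r⌉₊ (M-r), (1/(m:ℝ))*Gf T (((m+r:ℕ):ℝ)/m) =
     ∑ r ∈ Finset.Icc 1 R, -∑ m ∈ Finset.Icc ⌈Y*r⌉₊ (M-r), ((1/(r:ℝ))*(nA (m/r)*sin (T*nl (m/r)))) := by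
    apply Finset.sum_congr rfl
    intro r hr
    rw [← Finset.sum_neg_distrib]
    apply Finset.sum_congr rfl
    intro m hm
    rw [Finset.mem_Icc] at hr hm
    have r0 : (1:ℝ) ≤ r := by exact_mod_cast hr.1
    have : 0 < m := lt_of_lt_of_le (Nat.ceil_pos.2 (by nlinarith)) hm.1
    exact near_pt T this hr.1
  rw [e2]
  have e3 : (∑ m ∈ Finset.Icc 1 ⌊M/c⌋₊, ∑ k ∈ Finset.Ioc ⌊c*m⌋₊ M, 1/(m:ℝ) * Gf T (k/m) +
      ∑ r ∈ Finset.Icc 1 R, -∑ m ∈ Finset.Icc ⌈Y*r⌉₊ (M-r), ((1/(r:ℝ))*(nA (m/r)*sin (T*nl (m/r)))) -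
      ((∑ m ∈ Finset.Icc 1 M, ∫ s in (1:ℝ)..min c (M/m:ℝ), Gf T s) +
      ∑ m ∈ Finset.Icc 1 ⌊M/c⌋₊, ∫ s in c..(M/m:ℝ), Gf T s)) - (farB T c M - nearB T Y M + mainB T Y M) =
      - ∑ r ∈ Finset.Icc 1 R, (∑ m ∈ Finset.Icc ⌈Y*r⌉₊ (M-r), ((1/(r:ℝ))*(nA (m/r)*sin (T*nl (m/r)))) - ∑ m ∈ Finset.Ioc ⌊Y*r⌋₊ (M-r), ((1/(r:ℝ))*(nA (m/r)*sin (T*nl (m/r))))) := by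
    unfold farB nearB mainB Gf
    simp only [Finset.sum_sub_distrib, Finset.sum_neg_distrib, ← hR, ← hcdef]
    ring
  rw [e3, abs_neg]
  calc _ ≤ ∑ r ∈ Finset.Icc 1 R, nA Y * (1/(r:ℝ)) := by
        refine (Finset.abs_sum_le_sum_abs _ _).trans (Finset.sum_le_sum ?_)
        intro r hr
        have r0 : (0:ℝ) < r := by exact_mod_cast (Finset.mem_Icc.1 hr).1
        apply icc_ioc _ (by positivity)
        · intro m hm
          have : (m:ℝ)/r = Y := by rw [hm]; field_simp
          rw [this, abs_mul, abs_mul, abs_of_nonneg hA0, abs_of_pos (by positivity : 0 < 1/(r:ℝ))]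
          have := abs_sin_le_one (T * nl Y)
          have h3 : 0 ≤ nA Y * (1/(r:ℝ)) := by positivity
          nlinarith
        · positivity
    _ ≤ _ := by
        rw [← Finset.mul_sum]
        apply mul_le_mul_of_nonneg_left _ hA0
        refine (Finset.sum_le_sum_of_subset_of_nonneg (Finset.Icc_subset_Icc le_rfl hRM) ?_).trans (harm_sum_le M)
        intros; positivity

end Atk

namespace Atk

theorem logexp_integral : ∫ t in Set.Ioi (0:ℝ), log t * exp (-t) = -eulerMascheroniConstant := by
  have h1 := Complex.hasDerivAt_GammaIntegral (s := 1) (by simp)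
  have h2 : HasDerivAt Complex.GammaIntegral (-(eulerMascheroniConstant:ℂ)) 1 := by
    refine Complex.hasDerivAt_Gamma_one.congr_of_eventuallyEq ?_
    have : {s : ℂ | 0 < s.re} ∈ nhds (1:ℂ) :=
      (isOpen_lt continuous_const Complex.continuous_re).mem_nhds (by simp)
    filter_upwards [this] with s hs
    exact (Complex.Gamma_eq_integral hs).symm
  have h3 := h1.unique h2
  have h4 : ((∫ t in Set.Ioi (0:ℝ), log t * exp (-t) : ℝ):ℂ) = -(eulerMascheroniConstant:ℂ) := by
    rw [← h3, ← integral_complex_ofReal]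
    apply integral_congr_ae
    filter_upwards with t
    simp
  exact_mod_cast h4

theorem logexp_integrable : IntegrableOn (fun t => log t * exp (-t)) (Set.Ioi 0) := by
  have e : Set.Ioi (0:ℝ) = Set.Ioc 0 1 ∪ Set.Ioi 1 := (Set.Ioc_union_Ioi_eq_Ioi zero_le_one).symm
  rw [e]
  apply IntegrableOn.union
  · rw [← intervalIntegrable_iff_integrableOn_Ioc_of_le zero_le_one]
    exact intervalIntegral.intervalIntegrable_log'.mul_continuousOn (by fun_prop)
  · have h := (Real.GammaIntegral_convergent (s := 2) (by norm_num)).mono_set (Set.Ioi_subset_Ioi zero_le_one)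
    refine Integrable.mono h ?_ ?_
    · apply Measurable.aestronglyMeasurable
      exact measurable_log.mul (by fun_prop)
    · refine (ae_restrict_mem measurableSet_Ioi).mono fun t ht => ?_
      rw [Set.mem_Ioi] at ht
      rw [norm_mul, norm_mul, mul_comm]
      apply mul_le_mul_of_nonneg_left _ (norm_nonneg _)
      rw [Real.norm_of_nonneg (log_nonneg ht.le), show (2:ℝ)-1 = 1 by norm_num, rpow_one, Real.norm_of_nonneg (by linarith)]
      linarith [log_le_sub_one_of_pos (by linarith : 0 < t)]

theorem tail_int (X : ℝ) : IntegrableOn (fun t => t * exp (-t)) (Set.Ioi X) ∧ ∫ t in Set.Ioi X, t * exp (-t) = (X+1)*exp (-X) := by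
  have hd : ∀ x ∈ Set.Ici X, HasDerivAt (fun t => -((t+1)*exp (-t))) (x * exp (-x)) x := by
    intro x _
    have := (((hasDerivAt_id x).add_const 1).mul ((hasDerivAt_neg x).exp)).neg
    refine this.congr_deriv ?_
    simp; ring
  have hlim : Filter.Tendsto (fun t => -((t+1)*exp (-t))) Filter.atTop (nhds 0) := by
    have h1 := Real.tendsto_pow_mul_exp_neg_atTop_nhds_zero 1
    have h2 := Real.tendsto_pow_mul_exp_neg_atTop_nhds_zero 0
    have := (h1.add h2).neg
    simp only [pow_one, pow_zero, add_zero, neg_zero] at this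
    refine this.congr fun t => by ring
  by_cases hX : 0 ≤ X
  · have hp : ∀ x ∈ Set.Ioi X, 0 ≤ x * exp (-x) := fun x hx => mul_nonneg (hX.trans (le_of_lt hx)) (exp_pos _).le
    refine ⟨integrableOn_Ioi_deriv_of_nonneg' hd hp hlim, ?_⟩
    rw [integral_Ioi_of_hasDerivAt_of_nonneg' hd hp hlim]
    ring
  · push Not at hX
    have hp : ∀ x ∈ Set.Ioi (0:ℝ), 0 ≤ x * exp (-x) := fun x hx => mul_nonneg (le_of_lt hx) (exp_pos _).le
    have hi : IntegrableOn (fun t => t * exp (-t)) (Set.Ioi X) := by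
      rw [← Set.Ioc_union_Ioi_eq_Ioi hX.le]
      apply IntegrableOn.union
      · rw [← intervalIntegrable_iff_integrableOn_Ioc_of_le hX.le]
        exact Continuous.intervalIntegrable (by fun_prop) _ _
      · exact integrableOn_Ioi_deriv_of_nonneg' (fun x hx => hd x (hX.le.trans hx)) hp hlim
    refine ⟨hi, ?_⟩
    rw [integral_Ioi_of_hasDerivAt_of_tendsto' hd hi hlim]
    ring

theorem expint {ε X : ℝ} (hε : 0 < ε) (hε1 : ε ≤ 1) (hX : 1 ≤ X) :
    |(∫ t in ε..X, exp (-t)/t) + log ε + eulerMascheroniConstant| ≤ 4/X + 2*ε*(1 - log ε) := by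
  have hεX : ε ≤ X := hε1.trans hX
  have X0 : 0 < X := by linarith
  have pos : ∀ x ∈ Set.uIcc ε X, 0 < x := by
    intro x hx; rw [Set.uIcc_of_le hεX] at hx; linarith [hx.1]
  have hcl : ContinuousOn log (Set.uIcc ε X) := continuousOn_log.mono (fun x hx => (pos x hx).ne')
  have hii : IntervalIntegrable (fun t => exp (-t)/t) volume ε X := by
    apply ContinuousOn.intervalIntegrable
    exact ContinuousOn.div (by fun_prop) (by fun_prop) (fun x hx => (pos x hx).ne')
  have hil : IntervalIntegrable (fun t => log t * exp (-t)) volume ε X := by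
    apply ContinuousOn.intervalIntegrable
    fun_prop
  -- integration by parts
  have h1 : ∫ t in ε..X, (exp (-t)/t - log t * exp (-t)) = log X * exp (-X) - log ε * exp (-ε) := by
    rw [intervalIntegral.integral_eq_sub_of_hasDerivAt (f := fun t => log t * exp (-t))]
    · intro x hx
      have := (hasDerivAt_log (pos x hx).ne').mul ((hasDerivAt_neg x).exp)
      refine this.congr_deriv ?_
      rw [div_eq_mul_inv]; ring
    · exact hii.sub hil
  rw [intervalIntegral.integral_sub hii hil] at h1
  have h2 : -eulerMascheroniConstant = (∫ t in (0:ℝ)..ε, log t * exp (-t)) + (∫ t in ε..X, log t * exp (-t)) + ∫ t in Set.Ioi X, log t * exp (-t) := by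
    rw [← logexp_integral, intervalIntegral.integral_of_le hε.le, intervalIntegral.integral_of_le hεX]
    rw [← Set.Ioc_union_Ioi_eq_Ioi X0.le, ← Set.Ioc_union_Ioc_eq_Ioc hε.le hεX]
    have i := logexp_integrable
    rw [setIntegral_union _ measurableSet_Ioi _ (i.mono_set (Set.Ioi_subset_Ioi X0.le)), setIntegral_union _ measurableSet_Ioc]
    · exact i.mono_set Set.Ioc_subset_Ioi_self
    · exact i.mono_set (Set.Ioc_subset_Ioi_self.trans (Set.Ioi_subset_Ioi hε.le))
    · rw [Set.disjoint_left]; intro x a b; exact absurd a.2 (not_le.2 b.1)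
    · rw [Set.Ioc_union_Ioc_eq_Ioc hε.le hεX, Set.disjoint_left]; intro x a b; exact absurd a.2 (not_le.2 b)
    · rw [Set.Ioc_union_Ioc_eq_Ioc hε.le hεX]; exact i.mono_set Set.Ioc_subset_Ioi_self
  have h3 : |∫ t in Set.Ioi X, log t * exp (-t)| ≤ (X+1)*exp (-X) := by
    rw [← (tail_int X).2, ← Real.norm_eq_abs]
    apply norm_integral_le_of_norm_le (tail_int X).1
    refine (ae_restrict_mem measurableSet_Ioi).mono fun t ht => ?_
    rw [Set.mem_Ioi] at ht
    rw [norm_mul, Real.norm_of_nonneg (exp_pos _).le, Real.norm_of_nonneg (log_nonneg (by linarith))]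
    apply mul_le_mul_of_nonneg_right _ (exp_pos _).le
    linarith [log_le_sub_one_of_pos (by linarith : 0 < t)]
  have h4 : |∫ t in (0:ℝ)..ε, log t * exp (-t)| ≤ ε - ε*log ε := by
    have e1 : ∫ t in (0:ℝ)..ε, -log t = ε - ε * log ε := by
      rw [intervalIntegral.integral_neg, integral_log]; simp
    rw [← e1, ← Real.norm_eq_abs]
    apply intervalIntegral.norm_integral_le_of_norm_le hε.le
    · refine Filter.Eventually.of_forall fun t ht => ?_
      have hl : log t ≤ 0 := log_nonpos ht.1.le (by linarith [ht.2])
      rw [norm_mul, Real.norm_of_nonpos hl, Real.norm_of_nonneg (exp_pos _).le]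
      have : exp (-t) ≤ 1 := by rw [exp_le_one_iff]; linarith [ht.1]
      nlinarith
    · exact intervalIntegral.intervalIntegrable_log'.neg
  have h5 : |log X * exp (-X)| + (X+1)*exp (-X) ≤ 4/X := by
    have hl : 0 ≤ log X := log_nonneg hX
    rw [abs_of_nonneg (by positivity)]
    have h6 : log X ≤ X := by linarith [log_le_sub_one_of_pos X0]
    have h7 : 1 + X + X^2/2 ≤ exp X := by
      have := Real.quadratic_le_exp_of_nonneg X0.le; linarith
    rw [le_div_iff₀ X0]
    have h8 : exp (-X) * exp X = 1 := by rw [← exp_add]; simp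
    have h9 : 0 < exp (-X) := exp_pos _
    calc _ ≤ (2*X+1)*X*exp (-X) := by nlinarith [mul_nonneg (mul_nonneg X0.le h9.le) (sub_nonneg.2 h6)]
      _ ≤ 4*(1 + X + X^2/2) * exp (-X) := by
        apply mul_le_mul_of_nonneg_right _ h9.le; nlinarith
      _ ≤ 4 * exp X * exp (-X) := by
        apply mul_le_mul_of_nonneg_right _ h9.le; linarith
      _ = _ := by linear_combination 4 * h8
  have hle : log ε ≤ 0 := log_nonpos hε.le hε1
  have h6 : |(1 - exp (-ε)) * log ε| ≤ -(ε * log ε) := by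
    have a : exp (-ε) ≤ 1 := by rw [exp_le_one_iff]; linarith
    have b := add_one_le_exp (-ε)
    rw [abs_mul, abs_of_nonneg (by linarith), abs_of_nonpos hle]
    nlinarith
  have e : (∫ t in ε..X, exp (-t)/t) + log ε + eulerMascheroniConstant =
     log X * exp (-X) + (1 - exp (-ε)) * log ε - (∫ t in (0:ℝ)..ε, log t * exp (-t)) - ∫ t in Set.Ioi X, log t * exp (-t) := by
    linarith
  rw [e]
  rw [abs_le] at *
  obtain ⟨a1, a2⟩ := h3
  obtain ⟨b1, b2⟩ := h4
  obtain ⟨c1, c2⟩ := h6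
  have d1 := neg_abs_le (log X * exp (-X))
  have d2 := le_abs_self (log X * exp (-X))
  constructor <;> linarith

theorem cosint {ε X : ℝ} (hε : 0 < ε) (hε1 : ε ≤ 1) (hX : 1 ≤ X) :
    |∫ x in ε..X, (cos x - exp (-x))/x| ≤ 2*ε + 2/X := by
  have hεX : ε ≤ X := hε1.trans hX
  have X0 : 0 < X := by linarith
  set W : ℝ → ℝ → ℝ := fun x θ => exp (-(x*cos θ)) * sin (x * sin θ) with hW
  set D : ℝ → ℝ → ℝ := fun x θ => exp (-(x*cos θ)) * (sin θ * cos (x * sin θ) - cos θ * sin (x * sin θ)) with hD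
  have hDc : Continuous (Function.uncurry D) := by
    rw [hD]; unfold Function.uncurry; fun_prop
  have hx : ∀ θ x, HasDerivAt (fun x => W x θ) (D x θ) x := by
    intro θ x
    have h1 : HasDerivAt (fun x => exp (-(x*cos θ))) (exp (-(x*cos θ)) * (-cos θ)) x := by
      have := (((hasDerivAt_id x).mul_const (cos θ)).neg).exp
      refine this.congr_deriv ?_; simp
    have h2 : HasDerivAt (fun x => sin (x * sin θ)) (cos (x * sin θ) * sin θ) x := by
      have := ((hasDerivAt_id x).mul_const (sin θ)).sin
      refine this.congr_deriv ?_; simp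
    refine (h1.mul h2).congr_deriv ?_
    rw [hD]; ring
  have ht : ∀ x θ, HasDerivAt (fun θ => exp (-(x*cos θ)) * cos (x * sin θ)) (x * D x θ) θ := by
    intro x θ
    have h1 : HasDerivAt (fun θ => exp (-(x*cos θ))) (exp (-(x*cos θ)) * (x * sin θ)) θ := by
      have := (((hasDerivAt_cos θ).const_mul x).neg).exp
      refine this.congr_deriv ?_; simp
    have h2 : HasDerivAt (fun θ => cos (x * sin θ)) (-sin (x * sin θ) * (x * cos θ)) θ := by
      exact ((hasDerivAt_sin θ).const_mul x).cos
    refine (h1.mul h2).congr_deriv ?_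
    rw [hD]; ring
  have e1 : ∀ x ∈ Set.uIcc ε X, (cos x - exp (-x))/x = ∫ θ in (0:ℝ)..(π/2), D x θ := by
    intro x hx
    rw [Set.uIcc_of_le hεX] at hx
    have x0 : 0 < x := by linarith [hx.1]
    have := intervalIntegral.integral_eq_sub_of_hasDerivAt (a := 0) (b := π/2) (fun θ _ => ht x θ)
      (by apply Continuous.intervalIntegrable; rw [hD]; fun_prop)
    rw [intervalIntegral.integral_const_mul] at this
    rw [div_eq_iff x0.ne', mul_comm, this]
    simp
  rw [intervalIntegral.integral_congr e1, intervalIntegral_intervalIntegral_swap]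
  · have e2 : ∀ θ ∈ Set.uIcc 0 (π/2), ∫ x in ε..X, D x θ = W X θ - W ε θ := by
      intro θ _
      exact intervalIntegral.integral_eq_sub_of_hasDerivAt (fun x _ => hx θ x)
        (by apply Continuous.intervalIntegrable; rw [hD]; fun_prop)
    rw [intervalIntegral.integral_congr e2]
    have hp := pi_pos
    have h5 : ∫ θ in (0:ℝ)..(π/2), (exp (-X + (2*X/π)*θ) + ε) ≤ 2*ε + 2/X := by
      rw [intervalIntegral.integral_add (Continuous.intervalIntegrable (by fun_prop) _ _) (by simp)]
      have : ∫ θ in (0:ℝ)..(π/2), exp (-X + (2*X/π)*θ) = (π/(2*X)) * (1 - exp (-X)) := by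
        rw [intervalIntegral.integral_eq_sub_of_hasDerivAt (f := fun θ => (π/(2*X)) * exp (-X + (2*X/π)*θ))]
        · have : -X + 2*X/π*(π/2) = 0 := by field_simp; ring
          rw [this]; simp; ring
        · intro θ _
          have := ((((hasDerivAt_id θ).const_mul (2*X/π)).const_add (-X)).exp).const_mul (π/(2*X))
          refine this.congr_deriv ?_
          simp; field_simp
        · exact Continuous.intervalIntegrable (by fun_prop) _ _
      rw [this, intervalIntegral.integral_const, smul_eq_mul]
      have hp4 := pi_le_four
      have : π/(2*X) * (1 - exp (-X)) ≤ 2/X := by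
        calc _ ≤ π/(2*X) * 1 := by
              apply mul_le_mul_of_nonneg_left _ (by positivity); linarith [exp_pos (-X)]
          _ ≤ _ := by rw [mul_one, div_le_div_iff₀ (by positivity) X0]; nlinarith
      nlinarith
    refine le_trans ?_ h5
    rw [← Real.norm_eq_abs]
    apply intervalIntegral.norm_integral_le_of_norm_le (by positivity)
    · refine Filter.Eventually.of_forall fun θ hθ => ?_
      have hc := one_sub_mul_le_cos hθ.1.le hθ.2
      have hc0 : 0 ≤ cos θ := cos_nonneg_of_mem_Icc ⟨by linarith [hθ.1], hθ.2⟩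
      rw [Real.norm_eq_abs]
      refine (abs_sub _ _).trans ?_
      apply add_le_add
      · rw [hW]; simp only [abs_mul, abs_exp]
        calc _ ≤ exp (-(X*cos θ)) * 1 := mul_le_mul_of_nonneg_left (abs_sin_le_one _) (exp_pos _).le
          _ ≤ _ := by
            rw [mul_one, exp_le_exp]
            have : X*(1 - 2/π*θ) ≤ X * cos θ := mul_le_mul_of_nonneg_left hc X0.le
            have e : X*(1 - 2/π*θ) = X - 2*X/π*θ := by ring
            linarith
      · rw [hW]; simp only [abs_mul, abs_exp]
        have h1 : exp (-(ε*cos θ)) ≤ 1 := by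
          rw [exp_le_one_iff]
          have := mul_nonneg hε.le hc0
          linarith
        have h2 : |sin (ε * sin θ)| ≤ ε := by
          refine abs_sin_le_abs.trans ?_
          rw [abs_mul, abs_of_pos hε]
          have := abs_sin_le_one θ
          nlinarith
        calc _ ≤ 1 * |sin (ε * sin θ)| := mul_le_mul_of_nonneg_right h1 (abs_nonneg _)
          _ ≤ _ := by linarith
    · exact Continuous.intervalIntegrable (by fun_prop) _ _
  · have : IntegrableOn (Function.uncurry D) (Set.uIcc ε X ×ˢ Set.uIcc 0 (π/2)) :=
      hDc.continuousOn.integrableOn_compact (isCompact_uIcc.prod isCompact_uIcc)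
    exact this.mono_set (Set.prod_mono Set.uIoc_subset_uIcc Set.uIoc_subset_uIcc)

theorem sinint {ε X : ℝ} (hε : 0 < ε) (hε1 : ε ≤ 1) (hX : 1 ≤ X) :
    |(∫ x in ε..X, sin x/x^2) + log ε - (1 - eulerMascheroniConstant)| ≤ 7/X + 5*ε*(1 - log ε) := by
  have hεX : ε ≤ X := hε1.trans hX
  have X0 : 0 < X := by linarith
  have pos : ∀ x ∈ Set.uIcc ε X, x ≠ 0 := by
    intro x hx; rw [Set.uIcc_of_le hεX] at hx; linarith [hx.1]
  have i1 : IntervalIntegrable (fun x => sin x/x^2) volume ε X :=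
    ContinuousOn.intervalIntegrable (ContinuousOn.div (by fun_prop) (by fun_prop) (fun x hx => pow_ne_zero _ (pos x hx)))
  have i2 : IntervalIntegrable (fun x => cos x/x) volume ε X :=
    ContinuousOn.intervalIntegrable (ContinuousOn.div (by fun_prop) (by fun_prop) (fun x hx => pos x hx))
  have i3 : IntervalIntegrable (fun x => exp (-x)/x) volume ε X :=
    ContinuousOn.intervalIntegrable (ContinuousOn.div (by fun_prop) (by fun_prop) (fun x hx => pos x hx))
  have h1 : ∫ x in ε..X, (cos x/x - sin x/x^2) = sin X/X - sin ε/ε := by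
    rw [intervalIntegral.integral_eq_sub_of_hasDerivAt (f := fun t => sin t/t)]
    · intro x hx
      have := (hasDerivAt_sin x).div (hasDerivAt_id x) (pos x hx)
      refine this.congr_deriv ?_
      have := pos x hx
      simp; field_simp
    · exact i2.sub i1
  rw [intervalIntegral.integral_sub i2 i1] at h1
  have h2 := cosint hε hε1 hX
  have e2 : ∫ x in ε..X, (cos x - exp (-x))/x = (∫ x in ε..X, cos x/x) - ∫ x in ε..X, exp (-x)/x := by
    rw [← intervalIntegral.integral_sub i2 i3]
    apply intervalIntegral.integral_congr
    intro x _; ring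
  rw [e2] at h2
  have h3 := expint hε hε1 hX
  have h4 : |sin X/X| ≤ 1/X := by
    rw [abs_div, abs_of_pos X0]
    exact div_le_div_of_nonneg_right (abs_sin_le_one X) X0.le
  have h5 : |sin ε/ε - 1| ≤ ε := by
    have a := sin_le hε.le
    have b := sin_ge_sub_cube hε.le
    have : sin ε/ε - 1 = (sin ε - ε)/ε := by field_simp
    rw [this, abs_div, abs_of_pos hε, div_le_iff₀ hε, abs_of_nonpos (by linarith)]
    nlinarith [sq_nonneg ε]
  have hle : log ε ≤ 0 := log_nonpos hε.le hε1
  have e3 : 7/X = 4/X+2/X+1/X := by ring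
  have h6 : 0 ≤ -(ε * log ε) := by nlinarith
  rw [abs_le] at *
  obtain ⟨a1, a2⟩ := h2
  obtain ⟨b1, b2⟩ := h3
  obtain ⟨c1, c2⟩ := h4
  obtain ⟨d1, d2⟩ := h5
  constructor <;> nlinarith

end Atk

namespace Atk

noncomputable def Pw (T w : ℝ) : ℝ := exp (w/2) * (T * sinc (T*w))

noncomputable def Qw (T w : ℝ) : ℝ := (Pw T w - T) / (exp w - 1)

theorem Pw_cont (T : ℝ) : Continuous (Pw T) := by
  unfold Pw
  have : Continuous (fun w => sinc (T*w)) := continuous_sinc.comp (by fun_prop)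
  fun_prop

theorem Pw_pos {T w : ℝ} (hT : 1 ≤ T) (hw : 0 < w) : Pw T w = exp (w/2) * sin (T*w) / w := by
  unfold Pw
  rw [sinc_of_ne_zero (by positivity)]
  field_simp

theorem Pw_abs {T w b : ℝ} (hT : 1 ≤ T) (hwb : w ≤ b) : |Pw T w| ≤ exp (b/2) * T := by
  unfold Pw
  rw [abs_mul, abs_exp, abs_mul, abs_of_nonneg (by linarith : (0:ℝ) ≤ T)]
  have h1 : |sinc (T*w)| ≤ 1 := abs_sinc_le_one _
  have h2 : exp (w/2) ≤ exp (b/2) := by rw [exp_le_exp]; linarith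
  apply mul_le_mul h2 _ (by positivity) (exp_pos _).le
  nlinarith

theorem Pw_abs' {T w b : ℝ} (hT : 1 ≤ T) (hw : 0 < w) (hwb : w ≤ b) : |Pw T w| ≤ exp (b/2) * (1/w) := by
  rw [Pw_pos hT hw, abs_div, abs_mul, abs_exp, abs_of_pos hw]
  have h1 : |sin (T*w)| ≤ 1 := abs_sin_le_one _
  have h2 : exp (w/2) ≤ exp (b/2) := by rw [exp_le_exp]; linarith
  rw [mul_one_div]
  apply div_le_div_of_nonneg_right _ hw.le
  have := mul_le_mul h2 h1 (abs_nonneg _) (exp_pos _).le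
  linarith

theorem Pw_L1 {T b : ℝ} (hT : 1 ≤ T) (hTb : 1 ≤ T*b) :
    ∫ w in (0:ℝ)..b, |Pw T w| ≤ exp (b/2) * (1 + log (T*b)) := by
  have T0 : 0 < T := by linarith
  have hc : Continuous (fun w => |Pw T w|) := (Pw_cont T).abs
  have h1 : 0 ≤ 1/T := by positivity
  have h2 : 1/T ≤ b := by rw [div_le_iff₀ T0]; linarith
  rw [← intervalIntegral.integral_add_adjacent_intervals (hc.intervalIntegrable 0 (1/T)) (hc.intervalIntegrable (1/T) b)]
  have a1 : ∫ w in (0:ℝ)..(1/T), |Pw T w| ≤ exp (b/2) := by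
    calc _ ≤ ∫ w in (0:ℝ)..(1/T), exp (b/2) * T := by
          apply intervalIntegral.integral_mono_on h1 (hc.intervalIntegrable _ _) (by simp)
          intro w hw
          exact Pw_abs hT (hw.2.trans h2)
      _ = _ := by rw [intervalIntegral.integral_const, smul_eq_mul]; field_simp; simp
  have a2 : ∫ w in (1/T)..b, |Pw T w| ≤ exp (b/2) * log (T*b) := by
    have i0 : IntervalIntegrable (fun w:ℝ => 1/w) volume (1/T) b := by
      apply ContinuousOn.intervalIntegrable
      apply ContinuousOn.div (by fun_prop) (by fun_prop)
      intro x hx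
      rw [Set.uIcc_of_le h2] at hx
      have : 0 < 1/T := by positivity
      linarith [hx.1]
    calc _ ≤ ∫ w in (1/T)..b, exp (b/2) * (1/w) := by
          apply intervalIntegral.integral_mono_on h2 (hc.intervalIntegrable _ _)
          · exact i0.const_mul _
          intro w hw
          have : 0 < 1/T := by positivity
          exact Pw_abs' hT (by linarith [hw.1]) hw.2
      _ = _ := by
          rw [intervalIntegral.integral_const_mul, integral_one_div_of_pos (by positivity) (by linarith [(by positivity : 0 < 1/T)])]
          congr 2; field_simp
  linarith

theorem sinc_sub_one {x : ℝ} (hx : 0 ≤ x) : |sinc x - 1| ≤ 2*x := by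
  rcases hx.eq_or_lt with h | h
  · rw [← h]; simp
  by_cases h1 : x ≤ 1
  · have a := sin_le hx
    have b := sin_ge_sub_cube hx
    rw [sinc_of_ne_zero h.ne']
    have : sin x/x - 1 = (sin x - x)/x := by field_simp
    rw [this, abs_div, abs_of_pos h, div_le_iff₀ h, abs_of_nonpos (by linarith)]
    nlinarith [sq_nonneg x]
  · push Not at h1
    have := abs_sinc_le_one x
    rw [abs_le] at *
    constructor <;> linarith

theorem Pw_sub {T w b : ℝ} (hT : 1 ≤ T) (hw : 0 ≤ w) (hwb : w ≤ b) : |Pw T w - T| ≤ 3 * exp (b/2) * T^2 * w := by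
  have T0 : 0 < T := by linarith
  have e : Pw T w - T = T * (exp (w/2) * (sinc (T*w) - 1) + (exp (w/2) - 1)) := by unfold Pw; ring
  have h2 : exp (w/2) ≤ exp (b/2) := by rw [exp_le_exp]; linarith
  have h3 := sinc_sub_one (x := T*w) (by positivity)
  have h4 : |exp (w/2) - 1| ≤ exp (b/2) * w := by
    have a := one_le_exp (by linarith : 0 ≤ w/2)
    have b' := add_one_le_exp (-(w/2))
    rw [abs_of_nonneg (by linarith)]
    have : exp (w/2) * exp (-(w/2)) = 1 := by rw [← exp_add]; simp
    nlinarith [exp_pos (w/2)]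
  rw [e, abs_mul, abs_of_pos T0]
  have h5 : |exp (w/2) * (sinc (T*w) - 1) + (exp (w/2) - 1)| ≤ exp (b/2) * (2*(T*w)) + exp (b/2) * w := by
    refine (abs_add_le _ _).trans (add_le_add ?_ h4)
    rw [abs_mul, abs_exp]
    exact mul_le_mul h2 h3 (abs_nonneg _) (exp_pos _).le
  have h6 : exp (b/2) * (2*(T*w)) + exp (b/2) * w ≤ exp (b/2) * (3 * (T*w)) := by
    have : exp (b/2) * w ≤ exp (b/2) * (T*w) := by
      apply mul_le_mul_of_nonneg_left _ (exp_pos _).le; nlinarith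
    linarith
  calc _ ≤ T * (exp (b/2) * (3 * (T*w))) := mul_le_mul_of_nonneg_left (h5.trans h6) T0.le
    _ = _ := by ring

theorem Qw_abs {T w b : ℝ} (hT : 1 ≤ T) (hw : 0 < w) (hwb : w ≤ b) : |Qw T w| ≤ 3 * exp (b/2) * T^2 := by
  unfold Qw
  have h1 := Pw_sub hT hw.le hwb
  have h2 := add_one_le_exp w
  rw [abs_div, abs_of_pos (by linarith : 0 < exp w - 1), div_le_iff₀ (by linarith)]
  refine h1.trans ?_
  apply mul_le_mul_of_nonneg_left (by linarith) (by positivity)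

theorem Qw_meas (T : ℝ) : Measurable (Qw T) := by
  unfold Qw
  exact ((Pw_cont T).measurable.sub_const T).div (by fun_prop)

theorem bdd_int {g : ℝ → ℝ} {b K : ℝ} (hb : 0 ≤ b) (hg : Measurable g) (hK : ∀ w, 0 < w → w ≤ b → |g w| ≤ K) :
    IntervalIntegrable g volume 0 b := by
  rw [intervalIntegrable_iff_integrableOn_Ioc_of_le hb]
  apply Measure.integrableOn_of_bounded (M := K) (by simp) hg.aestronglyMeasurable
  refine (ae_restrict_mem measurableSet_Ioc).mono fun w hw => hK w hw.1 hw.2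

theorem Qw_int {T b : ℝ} (hT : 1 ≤ T) (hb : 0 ≤ b) : IntervalIntegrable (Qw T) volume 0 b :=
  bdd_int hb (Qw_meas T) (fun _ h1 h2 => Qw_abs hT h1 h2)

theorem Psi_abs (t : ℝ) : |Psi t| ≤ 1 := by
  unfold Psi
  have a := Int.fract_nonneg t
  have b := Int.fract_lt_one t
  rw [abs_le]
  constructor <;> nlinarith

theorem exp_v_lower {w b : ℝ} (hw : 0 ≤ w) (hwb : w ≤ b) : w * exp (-b) ≤ 1 - exp (-w) := by
  have h1 := add_one_le_exp w
  have h2 : exp w * exp (-w) = 1 := by rw [← exp_add]; simp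
  have h3 : exp (-b) ≤ exp (-w) := by rw [exp_le_exp]; linarith
  nlinarith [exp_pos (-w)]

set_option maxHeartbeats 1000000 in
theorem psi_term {T b δ : ℝ} {M : ℕ} (hT : 1 ≤ T) (hδ : 0 < δ) (hδ1 : δ ≤ 1) (hδb : δ ≤ b) (hM : 1 ≤ M) :
    |∫ w in δ..b, psi (M*(1 - exp (-w))) * Qw T w| ≤ 9*(1+b)*exp (3*b) * T/(δ^3*M) := by
  have T0 : 0 < T := by linarith
  have M0 : (0:ℝ) < M := by exact_mod_cast hM
  have b0 : 0 < b := by linarith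
  set p : ℝ → ℝ := fun w => exp (w/2) * sin (T*w) / w with hp
  set p' : ℝ → ℝ := fun w => exp (w/2) * (sin (T*w)/(2*w) + T*cos (T*w)/w - sin (T*w)/w^2) with hp'
  set v : ℝ → ℝ := fun w => 1 - exp (-w) with hv
  set q : ℝ → ℝ := fun w => (p w - T)/v w with hq
  set q' : ℝ → ℝ := fun w => p' w/v w - (p w - T)*exp (-w)/(v w)^2 with hq'
  have memb : ∀ w ∈ Set.uIcc δ b, δ ≤ w ∧ w ≤ b := by
    intro w hw; rwa [Set.uIcc_of_le hδb] at hw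
  have w0 : ∀ w ∈ Set.uIcc δ b, w ≠ 0 := fun w hw => by linarith [(memb w hw).1]
  have vlow : ∀ w ∈ Set.uIcc δ b, δ * exp (-b) ≤ v w := by
    intro w hw
    obtain ⟨h1, h2⟩ := memb w hw
    refine le_trans ?_ (exp_v_lower (by linarith) h2)
    exact mul_le_mul_of_nonneg_right h1 (exp_pos _).le
  have vpos : ∀ w ∈ Set.uIcc δ b, 0 < v w := fun w hw => lt_of_lt_of_le (by positivity) (vlow w hw)
  have hvd : ∀ w, HasDerivAt v (exp (-w)) w := by
    intro w
    have := ((hasDerivAt_neg w).exp).const_sub 1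
    refine this.congr_deriv (by simp)
  have hpd : ∀ w ∈ Set.uIcc δ b, HasDerivAt p (p' w) w := by
    intro w hw
    have hw0 := w0 w hw
    have h1 : HasDerivAt (fun w => exp (w/2)) (exp (w/2) * (1/2)) w := ((hasDerivAt_id w).div_const 2).exp
    have h2 : HasDerivAt (fun w => sin (T*w)) (cos (T*w) * T) w := by
      have := ((hasDerivAt_id w).const_mul T).sin
      refine this.congr_deriv (by simp)
    refine ((h1.mul h2).div (hasDerivAt_id w) hw0).congr_deriv ?_
    simp only [hp', Pi.mul_apply, id]
    field_simp
  have hqd : ∀ w ∈ Set.uIcc δ b, HasDerivAt q (q' w) w := by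
    intro w hw
    have hv0 := (vpos w hw).ne'
    refine (((hpd w hw).sub_const T).div (hvd w) hv0).congr_deriv ?_
    simp only [hq']
    field_simp
  have hPd : ∀ w, HasDerivWithinAt (fun w => Psi (M * v w) / M) (psi (M * v w) * exp (-w)) (Set.Ioi w) w := by
    intro w
    have h1 : HasDerivWithinAt (fun w => M * v w) (M * exp (-w)) (Set.Ioi w) w := ((hvd w).const_mul (M:ℝ)).hasDerivWithinAt
    have h2 := HasDerivWithinAt.comp w (Psi_deriv (M * v w)) h1 (by
      intro x hx
      rw [Set.mem_Ioi] at hx ⊢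
      apply mul_lt_mul_of_pos_left _ M0
      simp only [hv]
      have : exp (-x) < exp (-w) := by rw [exp_lt_exp]; linarith
      linarith)
    refine (h2.div_const (M:ℝ)).congr_deriv ?_
    field_simp
  have hvc : Continuous v := by rw [hv]; fun_prop
  have hpc : ContinuousOn p (Set.uIcc δ b) := fun w hw => (hpd w hw).continuousAt.continuousWithinAt
  have hqc : ContinuousOn q (Set.uIcc δ b) := fun w hw => (hqd w hw).continuousAt.continuousWithinAt
  have hp'c : ContinuousOn p' (Set.uIcc δ b) := by
    rw [hp']
    apply ContinuousOn.mul (by fun_prop)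
    apply ContinuousOn.sub
    · apply ContinuousOn.add
      · exact ContinuousOn.div (by fun_prop) (by fun_prop) (fun w hw => mul_ne_zero two_ne_zero (w0 w hw))
      · exact ContinuousOn.div (by fun_prop) (by fun_prop) (fun w hw => w0 w hw)
    · exact ContinuousOn.div (by fun_prop) (by fun_prop) (fun w hw => pow_ne_zero _ (w0 w hw))
  have hq'c : ContinuousOn q' (Set.uIcc δ b) := by
    rw [hq']
    apply ContinuousOn.sub
    · exact ContinuousOn.div hp'c hvc.continuousOn (fun w hw => (vpos w hw).ne')
    · exact ContinuousOn.div ((hpc.sub (by fun_prop)).mul (by fun_prop)) (by fun_prop) (fun w hw => pow_ne_zero _ (vpos w hw).ne')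
  have i2 : IntervalIntegrable (fun w => psi (M * v w) * exp (-w)) volume δ b := by
    rw [intervalIntegrable_iff_integrableOn_Ioc_of_le hδb]
    apply Measure.integrableOn_of_bounded (M := 1) (by simp)
    · apply Measurable.aestronglyMeasurable
      exact (psi_meas.comp (by fun_prop)).mul (by fun_prop)
    · refine (ae_restrict_mem measurableSet_Ioc).mono fun w hw => ?_
      rw [norm_mul, Real.norm_eq_abs, Real.norm_eq_abs, abs_exp]
      have h1 := psi_abs (M * v w)
      have h2 : exp (-w) ≤ 1 := by rw [exp_le_one_iff]; linarith [hw.1]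
      nlinarith [exp_pos (-w), abs_nonneg (psi (M * v w))]
  have ibp := intervalIntegral.integral_mul_deriv_eq_deriv_mul_of_hasDeriv_right (a := δ) (b := b) (u := q) (u' := q')
    (v := fun w => Psi (M * v w) / M) (v' := fun w => psi (M * v w) * exp (-w)) hqc
    (by
      have := Psi_cont
      have h2 : Continuous (fun w => Psi (M * v w)) := this.comp (by fun_prop)
      fun_prop)
    (fun w hw => (hqd w (Set.Ioo_subset_Icc_self hw)).hasDerivWithinAt) (fun w hw => hPd w)
    hq'c.intervalIntegrable i2
  have e1 : ∫ w in δ..b, psi (M*(1 - exp (-w))) * Qw T w = ∫ w in δ..b, q w * (psi (M * v w) * exp (-w)) := by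
    apply intervalIntegral.integral_congr
    intro w hw
    have h0 : 0 < w := by linarith [(memb w hw).1]
    have hv0 := (vpos w hw)
    have : exp w - 1 = v w / exp (-w) := by
      simp only [hv]; rw [exp_neg]; field_simp
    simp only [Qw, Pw_pos hT h0, this, hq, hp]
    have := exp_pos (-w)
    field_simp
    exact mul_comm _ _
  rw [e1, ibp]
  -- bounds
  have ebh : exp (b/2) ≤ exp b := by rw [exp_le_exp]; linarith
  have eb1 : 1 ≤ exp b := one_le_exp b0.le
  have ebm : exp (-b) * exp b = 1 := by rw [← exp_add]; simp
  have vinv : ∀ w ∈ Set.uIcc δ b, 1/v w ≤ exp b/δ := by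
    intro w hw
    rw [div_le_div_iff₀ (vpos w hw) hδ]
    have := mul_le_mul_of_nonneg_left (vlow w hw) (exp_pos b).le
    nlinarith
  have pb : ∀ w ∈ Set.uIcc δ b, |p w - T| ≤ 2 * exp b * T := by
    intro w hw
    obtain ⟨h1, h2⟩ := memb w hw
    have : p w = Pw T w := (Pw_pos hT (by linarith)).symm
    rw [this]
    refine (abs_sub _ _).trans ?_
    have := Pw_abs hT h2
    rw [abs_of_pos T0]
    nlinarith
  have qb : ∀ w ∈ Set.uIcc δ b, |q w| ≤ 2 * exp (3*b) * T/δ := by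
    intro w hw
    have hv0 := vpos w hw
    simp only [hq]
    rw [abs_div, abs_of_pos hv0, div_eq_mul_one_div]
    calc _ ≤ (2 * exp b * T) * (exp b/δ) := mul_le_mul (pb w hw) (vinv w hw) (by positivity) (by positivity)
      _ ≤ _ := by
        have : exp (3*b) = exp b * exp b * exp b := by rw [← exp_add, ← exp_add]; ring_nf
        rw [this]
        have : (2 * exp b * T) * (exp b/δ) = (2*exp b*exp b*T/δ) * 1 := by ring
        rw [this]
        calc _ ≤ (2*exp b*exp b*T/δ) * exp b := mul_le_mul_of_nonneg_left eb1 (by positivity)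
          _ = _ := by ring
  have p'b : ∀ w ∈ Set.uIcc δ b, |p' w| ≤ 3 * exp b * T/δ^2 := by
    intro w hw
    obtain ⟨h1, h2⟩ := memb w hw
    have h0 : 0 < w := by linarith
    have a1 : exp (w/2) ≤ exp b := by rw [exp_le_exp]; linarith
    have s1 := abs_sin_le_one (T*w)
    have s2 := abs_cos_le_one (T*w)
    have g0 : 1/w ≤ 1/δ := one_div_le_one_div_of_le hδ h1
    have g1 : 1/δ ≤ 1/δ^2 := one_div_le_one_div_of_le (by positivity) (by nlinarith)
    have g2 : 1/w^2 ≤ 1/δ^2 := one_div_le_one_div_of_le (by positivity) (by gcongr)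
    have b1 : |sin (T*w)/(2*w)| ≤ 1/δ^2 := by
      rw [abs_div, abs_of_pos (by positivity : 0 < 2*w)]
      calc _ ≤ 1/(2*w) := div_le_div_of_nonneg_right s1 (by positivity)
        _ ≤ 1/w := one_div_le_one_div_of_le h0 (by linarith)
        _ ≤ _ := g0.trans g1
    have b2 : |T*cos (T*w)/w| ≤ T*(1/δ^2) := by
      rw [abs_div, abs_mul, abs_of_pos h0, abs_of_pos T0]
      calc _ ≤ T*1/w := by gcongr
        _ = T*(1/w) := by ring
        _ ≤ _ := mul_le_mul_of_nonneg_left (g0.trans g1) T0.le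
    have b3 : |sin (T*w)/w^2| ≤ 1/δ^2 := by
      rw [abs_div, abs_of_pos (by positivity : 0 < w^2)]
      exact (div_le_div_of_nonneg_right s1 (by positivity)).trans g2
    simp only [hp']
    rw [abs_mul, abs_exp]
    have d0 : 0 < 1/δ^2 := by positivity
    have b4 : |sin (T*w)/(2*w) + T*cos (T*w)/w - sin (T*w)/w^2| ≤ 3*T*(1/δ^2) := by
      refine (abs_sub _ _).trans ?_
      have := abs_add_le (sin (T*w)/(2*w)) (T*cos (T*w)/w)
      nlinarith
    calc _ ≤ exp b * (3*T*(1/δ^2)) := mul_le_mul a1 b4 (abs_nonneg _) (exp_pos _).le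
      _ = _ := by ring
  have e3 : exp (3*b) = exp b * exp b * exp b := by rw [← exp_add, ← exp_add]; ring_nf
  have q'b : ∀ w ∈ Set.uIcc δ b, |q' w| ≤ 5 * exp (3*b) * T/δ^3 := by
    intro w hw
    obtain ⟨h1, h2⟩ := memb w hw
    have hv0 := vpos w hw
    have hvi := vinv w hw
    have c1 : |p' w/v w| ≤ 3 * exp (3*b) * T/δ^3 := by
      rw [abs_div, abs_of_pos hv0, div_eq_mul_one_div]
      calc _ ≤ (3 * exp b * T/δ^2) * (exp b/δ) := mul_le_mul (p'b w hw) hvi (by positivity) (by positivity)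
        _ = (3*exp b*exp b*T/δ^3) * 1 := by field_simp
        _ ≤ (3*exp b*exp b*T/δ^3) * exp b := mul_le_mul_of_nonneg_left eb1 (by positivity)
        _ = _ := by rw [e3]; ring
    have c2 : |(p w - T)*exp (-w)/(v w)^2| ≤ 2 * exp (3*b) * T/δ^3 := by
      have ew : exp (-w) ≤ 1 := by rw [exp_le_one_iff]; linarith
      rw [abs_div, abs_mul, abs_exp, abs_of_pos (by positivity : 0 < v w^2)]
      have : |p w - T| * exp (-w)/v w^2 = |p w - T| * exp (-w) * (1/v w * (1/v w)) := by field_simp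
      rw [this]
      have d2 : δ^3 ≤ δ^2 := by nlinarith [sq_nonneg δ]
      calc _ ≤ (2 * exp b * T) * 1 * ((exp b/δ) * (exp b/δ)) := by
            apply mul_le_mul
            · exact mul_le_mul (pb w hw) ew (exp_pos _).le (by positivity)
            · exact mul_le_mul hvi hvi (by positivity) (by positivity)
            · positivity
            · positivity
        _ = 2 * exp (3*b) * T/δ^2 := by rw [e3]; field_simp
        _ ≤ _ := div_le_div_of_nonneg_left (by positivity) (by positivity) d2
    simp only [hq']
    refine (abs_sub _ _).trans ?_
    have : 5 * exp (3*b) * T/δ^3 = 3 * exp (3*b) * T/δ^3 + 2 * exp (3*b) * T/δ^3 := by ring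
    linarith
  have Pb : ∀ w, |Psi (M * v w)/M| ≤ 1/M := by
    intro w
    rw [abs_div, abs_of_pos M0]
    exact div_le_div_of_nonneg_right (Psi_abs _) M0.le
  have bd : ∀ w ∈ Set.uIcc δ b, |q w * (Psi (M * v w)/M)| ≤ 2 * exp (3*b) * T/(δ^3*M) := by
    intro w hw
    rw [abs_mul]
    have d2 : δ^3 ≤ δ := by nlinarith [sq_nonneg δ]
    calc _ ≤ (2 * exp (3*b) * T/δ) * (1/M) := mul_le_mul (qb w hw) (Pb w) (abs_nonneg _) (by positivity)
      _ ≤ (2 * exp (3*b) * T/δ^3) * (1/M) := by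
          apply mul_le_mul_of_nonneg_right _ (by positivity)
          exact div_le_div_of_nonneg_left (by positivity) (by positivity) d2
      _ = _ := by field_simp
  have t1 := bd b Set.right_mem_uIcc
  have t2 := bd δ Set.left_mem_uIcc
  have t3 : |∫ w in δ..b, q' w * (Psi (M * v w)/M)| ≤ (5 * exp (3*b) * T/(δ^3*M)) * b := by
    have : ∀ w ∈ Set.uIoc δ b, ‖q' w * (Psi (M * v w)/M)‖ ≤ 5 * exp (3*b) * T/(δ^3*M) := by
      intro w hw
      rw [norm_mul, Real.norm_eq_abs, Real.norm_eq_abs]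
      calc _ ≤ (5 * exp (3*b) * T/δ^3) * (1/M) := mul_le_mul (q'b w (Set.uIoc_subset_uIcc hw)) (Pb w) (abs_nonneg _) (by positivity)
        _ = _ := by field_simp
    refine (intervalIntegral.norm_integral_le_of_norm_le_const this).trans ?_
    apply mul_le_mul_of_nonneg_left _ (by positivity)
    rw [abs_of_nonneg (by linarith)]; linarith
  have e9 : 9*(1+b)*exp (3*b) * T/(δ^3*M) = 9 * (exp (3*b) * T/(δ^3*M)) + 9*b*(exp (3*b) * T/(δ^3*M)) := by ring
  have e2 : 2 * exp (3*b) * T/(δ^3*M) = 2 * (exp (3*b) * T/(δ^3*M)) := by ring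
  have e5 : (5 * exp (3*b) * T/(δ^3*M)) * b = 5*b*(exp (3*b) * T/(δ^3*M)) := by ring
  have z : 0 ≤ exp (3*b) * T/(δ^3*M) := by positivity
  have zb : 0 ≤ b*(exp (3*b) * T/(δ^3*M)) := by positivity
  rw [e9]
  rw [e2] at t1 t2
  rw [e5] at t3
  rw [abs_le] at *
  obtain ⟨x1, x2⟩ := t1
  obtain ⟨y1, y2⟩ := t2
  obtain ⟨z1, z2⟩ := t3
  constructor <;> nlinarith

end Atk

namespace Atk

theorem hker {w b : ℝ} (hw : 0 < w) (hwb : w ≤ b) : |exp (w/2)/(exp w - 1) - 1/w| ≤ exp (b/2) := by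
  have h1 := add_one_le_exp w
  have hp : 0 < exp w - 1 := by linarith
  have e1 : exp w = exp (w/2) * exp (w/2) := by rw [← exp_add]; ring_nf
  have e2 : exp (-(w/2)) * exp (w/2) = 1 := by rw [← exp_add]; simp
  have e3 : exp w * exp (-w) = 1 := by rw [← exp_add]; simp
  have h2 := add_one_le_exp (-(w/2))
  have h3 := add_one_le_exp (-w)
  have h4 : exp (w/2) ≤ exp (b/2) := by rw [exp_le_exp]; linarith
  have h5 : 1 ≤ exp (w/2) := one_le_exp (by linarith)
  have lo : 1/w - 1/2 ≤ exp (w/2)/(exp w - 1) := by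
    have : exp w - 1 ≤ w * exp w := by nlinarith [exp_pos w]
    calc 1/w - 1/2 = (1 - w/2)/w := by field_simp
      _ ≤ exp (-(w/2))/w := by apply div_le_div_of_nonneg_right _ hw.le; linarith
      _ = exp (w/2)/(w * exp w) := by
          rw [div_eq_div_iff hw.ne' (by positivity), e1]
          linear_combination (w * exp (w/2)) * e2
      _ ≤ _ := div_le_div_of_nonneg_left (exp_pos _).le hp this
  have up : exp (w/2)/(exp w - 1) ≤ 1/w + exp (w/2)/2 := by
    calc _ ≤ exp (w/2)/w := div_le_div_of_nonneg_left (exp_pos _).le hw (by linarith)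
      _ ≤ (1 + w/2*exp (w/2))/w := by
          apply div_le_div_of_nonneg_right _ hw.le
          nlinarith [exp_pos (w/2)]
      _ = _ := by field_simp
  rw [abs_le]
  constructor <;> linarith

set_option maxHeartbeats 1000000 in
theorem Q_integral {T b : ℝ} (hT : 1 ≤ T) (hTb : 1 ≤ T*b) :
    |(∫ w in (0:ℝ)..b, Qw T w) - (T*(1 - eulerMascheroniConstant - log T) - T * log (1 - exp (-b)))| ≤
      exp b * (4 + log (T*b)) + 7/b + 16 := by
  have T0 : 0 < T := by linarith
  have b0 : 0 < b := by
    by_contra h; push Not at h; nlinarith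
  set δ := 1/T^3 with hδ
  have T3 : T ≤ T^3 := by nlinarith [mul_nonneg T0.le T0.le]
  have δ0 : 0 < δ := by positivity
  have δb : δ ≤ b := by
    rw [hδ, div_le_iff₀ (by positivity)]
    nlinarith
  have pos : ∀ x ∈ Set.uIcc δ b, 0 < x := by
    intro x hx; rw [Set.uIcc_of_le δb] at hx; linarith [hx.1]
  have epos : ∀ x ∈ Set.uIcc δ b, 0 < exp x - 1 := by
    intro x hx; linarith [add_one_le_exp x, pos x hx]
  have iQ : IntervalIntegrable (Qw T) volume 0 b := Qw_int hT b0.le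
  have iQ1 : IntervalIntegrable (Qw T) volume 0 δ := Qw_int hT δ0.le
  have iQ2 : IntervalIntegrable (Qw T) volume δ b := iQ1.symm.trans iQ
  have s1 := intervalIntegral.integral_add_adjacent_intervals iQ1 iQ2
  have hPc := Pw_cont T
  have i1 : IntervalIntegrable (fun w => Pw T w/(exp w - 1)) volume δ b :=
    ContinuousOn.intervalIntegrable (ContinuousOn.div hPc.continuousOn (by fun_prop) (fun x hx => (epos x hx).ne'))
  have i2 : IntervalIntegrable (fun w => sin (T*w)/w^2) volume δ b :=
    ContinuousOn.intervalIntegrable (ContinuousOn.div (by fun_prop) (by fun_prop) (fun x hx => pow_ne_zero _ (pos x hx).ne'))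
  have i3 : IntervalIntegrable (fun w => T/(exp w - 1)) volume δ b :=
    ContinuousOn.intervalIntegrable (ContinuousOn.div (by fun_prop) (by fun_prop) (fun x hx => (epos x hx).ne'))
  have s2 : ∫ w in δ..b, Qw T w = (∫ w in δ..b, Pw T w/(exp w - 1)) - ∫ w in δ..b, T/(exp w - 1) := by
    rw [← intervalIntegral.integral_sub i1 i3]
    apply intervalIntegral.integral_congr
    intro w _; simp only [Qw]; ring
  -- head
  have a1 : |∫ w in (0:ℝ)..δ, Qw T w| ≤ 3 * exp b := by
    have : ∀ w ∈ Set.uIoc 0 δ, ‖Qw T w‖ ≤ 3 * exp b * T^2 := by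
      intro w hw
      rw [Set.uIoc_of_le δ0.le] at hw
      refine (Qw_abs hT hw.1 (hw.2.trans δb)).trans ?_
      have : exp (b/2) ≤ exp b := by rw [exp_le_exp]; linarith
      gcongr
    refine (intervalIntegral.norm_integral_le_of_norm_le_const this).trans ?_
    rw [sub_zero, abs_of_pos δ0, hδ]
    have : 3*exp b*T^2*(1/T^3) = 3*exp b*(1/T) := by field_simp
    rw [this]
    have : 1/T ≤ 1 := by rw [div_le_one T0]; exact hT
    nlinarith [exp_pos b]
  -- D
  have a2 : |(∫ w in δ..b, Pw T w/(exp w - 1)) - ∫ w in δ..b, sin (T*w)/w^2| ≤ exp b * (1 + log (T*b)) := by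
    rw [← intervalIntegral.integral_sub i1 i2, ← Real.norm_eq_abs]
    have hc : Continuous (fun w => |Pw T w|) := hPc.abs
    calc _ ≤ ∫ w in δ..b, exp (b/2) * |Pw T w| := by
          apply intervalIntegral.norm_integral_le_of_norm_le δb
          · refine Filter.Eventually.of_forall fun w hw => ?_
            have w0 : 0 < w := by linarith [hw.1]
            have hk := hker w0 hw.2
            have e : Pw T w/(exp w - 1) - sin (T*w)/w^2 = (exp (w/2)/(exp w - 1) - 1/w) * (sin (T*w)/w) := by
              rw [Pw_pos hT w0]
              have : exp w - 1 ≠ 0 := by linarith [add_one_le_exp w]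
              field_simp
            rw [e, norm_mul, Real.norm_eq_abs, Real.norm_eq_abs]
            apply mul_le_mul hk _ (abs_nonneg _) (exp_pos _).le
            rw [Pw_pos hT w0, mul_div_assoc, abs_mul, abs_exp]
            have := one_le_exp (by linarith : 0 ≤ w/2)
            nlinarith [abs_nonneg (sin (T*w)/w)]
          · exact (hc.intervalIntegrable _ _).const_mul _
      _ = exp (b/2) * ∫ w in δ..b, |Pw T w| := by rw [intervalIntegral.integral_const_mul]
      _ ≤ exp (b/2) * ∫ w in (0:ℝ)..b, |Pw T w| := by
          apply mul_le_mul_of_nonneg_left _ (exp_pos _).le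
          apply intervalIntegral.integral_mono_interval δ0.le δb le_rfl
          · exact Filter.Eventually.of_forall fun w => abs_nonneg _
          · exact hc.intervalIntegrable _ _
      _ ≤ exp (b/2) * (exp (b/2) * (1 + log (T*b))) := mul_le_mul_of_nonneg_left (Pw_L1 hT hTb) (exp_pos _).le
      _ = _ := by rw [← mul_assoc, ← exp_add]; ring_nf
  -- scaling
  have s3 : ∫ w in δ..b, sin (T*w)/w^2 = T * ∫ x in (T*δ)..(T*b), sin x/x^2 := by
    have := intervalIntegral.integral_comp_mul_left (a := δ) (b := b) (fun x => sin x/x^2) T0.ne'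
    rw [smul_eq_mul] at this
    have e : ∫ w in δ..b, sin (T*w)/w^2 = T^2 * ∫ w in δ..b, sin (T*w)/(T*w)^2 := by
      rw [← intervalIntegral.integral_const_mul]
      apply intervalIntegral.integral_congr
      intro w hw
      have := pos w hw
      simp only
      field_simp
    rw [e, this]; field_simp
  have Tδ : T*δ = 1/T^2 := by rw [hδ]; field_simp
  have hε1 : T*δ ≤ 1 := by rw [Tδ, div_le_one (by positivity)]; nlinarith
  have h3 := sinint (ε := T*δ) (X := T*b) (by positivity) hε1 hTb
  have lTδ : log (T*δ) = -2*log T := by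
    rw [Tδ, log_div one_ne_zero (by positivity), log_one, log_pow]; push_cast; ring
  have lδ : log δ = -3*log T := by
    rw [hδ, log_div one_ne_zero (by positivity), log_one, log_pow]; push_cast; ring
  have a3 : T * (7/(T*b) + 5*(T*δ)*(1 - log (T*δ))) ≤ 7/b + 15 := by
    rw [lTδ, Tδ]
    have e : T * (7/(T*b) + 5*(1/T^2)*(1 - -2*log T)) = 7/b + 5*(1 + 2*log T)/T := by field_simp; ring
    rw [e]
    have : 5*(1 + 2*log T)/T ≤ 15 := by
      rw [div_le_iff₀ T0]
      linarith [log_le_sub_one_of_pos T0]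
    linarith
  -- log part
  have vpos : ∀ x ∈ Set.uIcc δ b, 0 < 1 - exp (-x) := by
    intro x hx
    have : exp (-x) < 1 := by rw [exp_lt_one_iff]; linarith [pos x hx]
    linarith
  have s4 : ∫ w in δ..b, T/(exp w - 1) = T * log (1 - exp (-b)) - T * log (1 - exp (-δ)) := by
    rw [intervalIntegral.integral_eq_sub_of_hasDerivAt (f := fun w => T * log (1 - exp (-w)))]
    · intro x hx
      have h1 : HasDerivAt (fun w => 1 - exp (-w)) (exp (-x)) x :=
        (((hasDerivAt_neg x).exp).const_sub 1).congr_deriv (by simp)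
      refine ((h1.log (vpos x hx).ne').const_mul T).congr_deriv ?_
      have := epos x hx
      have := vpos x hx
      have e : exp (-x) = 1/exp x := by rw [exp_neg]; simp
      rw [e]
      rw [e] at this
      field_simp
    · exact i3
  have a4 : |log (1 - exp (-δ)) - log δ| ≤ δ := by
    have h1 := exp_v_lower δ0.le (le_refl δ)
    have h2 := add_one_le_exp (-δ)
    have hv := vpos δ Set.left_mem_uIcc
    have l1 : log (1 - exp (-δ)) ≤ log δ := log_le_log hv (by linarith)
    have l2 : log (δ * exp (-δ)) ≤ log (1 - exp (-δ)) := log_le_log (by positivity) h1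
    rw [log_mul δ0.ne' (exp_pos _).ne', log_exp] at l2
    rw [abs_le]; constructor <;> linarith
  have a4' : |T * (log (1 - exp (-δ)) - log δ)| ≤ 1 := by
    rw [abs_mul, abs_of_pos T0]
    calc _ ≤ T*δ := mul_le_mul_of_nonneg_left a4 T0.le
      _ ≤ 1 := hε1
  have a3' : |T * ((∫ x in (T*δ)..(T*b), sin x/x^2) + log (T*δ) - (1 - eulerMascheroniConstant))| ≤ 7/b + 15 := by
    rw [abs_mul, abs_of_pos T0]
    exact (mul_le_mul_of_nonneg_left h3 T0.le).trans a3
  rw [← s1, s2, s4]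
  rw [s3] at a2
  rw [lTδ] at a3'
  rw [lδ] at a4'
  set I := ∫ x in (T*δ)..(T*b), sin x/x^2
  set J := ∫ w in δ..b, Pw T w/(exp w - 1)
  set H := ∫ w in (0:ℝ)..δ, Qw T w
  rw [abs_le] at *
  obtain ⟨x1, x2⟩ := a1
  obtain ⟨y1, y2⟩ := a2
  obtain ⟨z1, z2⟩ := a3'
  obtain ⟨u1, u2⟩ := a4'
  constructor <;> nlinarith

end Atk

namespace Atk

theorem stir {n : ℕ} (hn : 1 ≤ n) : 0 ≤ log (n.factorial) - (n * log n - n + log n / 2 + log (2*π)/2) ∧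
    log (n.factorial) - (n * log n - n + log n / 2 + log (2*π)/2) ≤ 1/(12*n) := by
  refine ⟨by linarith [Stirling.le_log_factorial_stirling (n := n) (by omega)], ?_⟩
  have mono : Monotone (fun k : ℕ => log (Stirling.stirlingSeq (k+1)) - 1/(12*((k:ℝ)+1))) := by
    apply monotone_nat_of_le_succ
    intro k
    have h := Stirling.log_stirlingSeq_sdiff_le (k+1)
    push_cast at h ⊢
    have e : 1/(12*((k:ℝ)+1)*((k:ℝ)+1+1)) = 1/(12*((k:ℝ)+1)) - 1/(12*((k:ℝ)+1+1)) := by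
      field_simp; ring
    rw [e] at h
    linarith
  have lim : Filter.Tendsto (fun k : ℕ => log (Stirling.stirlingSeq (k+1)) - 1/(12*((k:ℝ)+1))) Filter.atTop (nhds (log (√π) - 0)) := by
    apply Filter.Tendsto.sub
    · have h1 := Stirling.tendsto_stirlingSeq_sqrt_pi.comp (Filter.tendsto_add_atTop_nat 1)
      exact h1.log (by positivity)
    · have := (tendsto_one_div_add_atTop_nhds_zero_nat (𝕜 := ℝ)).const_mul (1/12)
      rw [mul_zero] at this
      refine this.congr fun k => by field_simp
  obtain ⟨k, rfl⟩ : ∃ k, n = k+1 := ⟨n-1, by omega⟩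
  have h := mono.ge_of_tendsto lim k
  rw [Stirling.log_stirlingSeq_formula, log_sqrt pi_pos.le, log_div (by positivity) (exp_pos _).ne', log_exp,
    log_mul two_ne_zero (by positivity)] at h
  rw [log_mul two_ne_zero pi_pos.ne']
  push_cast at h ⊢
  linarith

theorem sum_log_fact (n : ℕ) : ∑ r ∈ Finset.Icc 1 n, log (r:ℝ) = log (n.factorial) := by
  induction n with
  | zero => simp
  | succ n ih =>
    rw [Finset.sum_Icc_succ_top (by omega), ih, Nat.factorial_succ]
    push_cast
    rw [log_mul (by positivity) (by positivity)]; ring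

theorem stir_sum {U : ℝ} (hU : 1 ≤ U) :
    |∑ r ∈ Finset.Icc 1 ⌊U⌋₊, (log U - log r) - (U - log U/2 - log (2*π)/2)| ≤ 3/U := by
  set R := ⌊U⌋₊ with hR
  have U0 : 0 < U := by linarith
  have R1 : 1 ≤ R := Nat.le_floor (by simpa using hU)
  have R1' : (1:ℝ) ≤ R := by exact_mod_cast R1
  have h1 : (R:ℝ) ≤ U := Nat.floor_le U0.le
  have h2 : U < R + 1 := Nat.lt_floor_add_one U
  obtain ⟨s1, s2⟩ := stir R1
  rw [Finset.sum_sub_distrib, sum_log_fact, Finset.sum_const, Nat.card_Icc, nsmul_eq_mul, Nat.add_sub_cancel]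
  have l1 : log U - log R ≤ U/R - 1 := by
    rw [← log_div U0.ne' (by positivity)]
    exact log_le_sub_one_of_pos (by positivity)
  have l2 : 1 - R/U ≤ log U - log R := by
    rw [← log_div U0.ne' (by positivity)]
    have := one_sub_inv_le_log_of_pos (by positivity : 0 < U/R)
    rwa [inv_div] at this
  have R0 : (0:ℝ) < R := by linarith
  have hRU : 1/(R:ℝ) ≤ 2/U := by rw [div_le_div_iff₀ R0 U0]; linarith
  have a1 : R*(log U - log R) ≤ U - R := by
    have := mul_le_mul_of_nonneg_left l1 R0.le
    have e : R*(U/R - 1) = U - R := by field_simp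
    linarith
  have a2 : U - R - 1/U ≤ R*(log U - log R) := by
    have := mul_le_mul_of_nonneg_left l2 R0.le
    have e : R*(1 - R/U) = U - R - (U-R)^2/U := by field_simp; ring
    have : (U-R)^2/U ≤ 1/U := by
      apply div_le_div_of_nonneg_right _ U0.le; nlinarith
    linarith
  have a3 : log U - log R ≤ 2/U := by
    have e : U/R - 1 = (U - R)/R := by field_simp
    have : (U-R)/R ≤ 1/R := by apply div_le_div_of_nonneg_right _ R0.le; linarith
    linarith
  have a4 : 0 ≤ log U - log R := by
    have : (R:ℝ)/U ≤ 1 := by rw [div_le_one U0]; exact h1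
    linarith
  have a5 : 1/(12*(R:ℝ)) ≤ 1/U := by
    have : 1/(12*(R:ℝ)) = (1/12)*(1/R) := by field_simp
    have e : 2/U = 2*(1/U) := by ring
    have : 0 < 1/U := by positivity
    linarith
  have e3 : 3/U = 3*(1/U) := by ring
  have e2 : 2/U = 2*(1/U) := by ring
  have z : 0 < 1/U := by positivity
  rw [abs_le]
  constructor <;> nlinarith

theorem layer_lower {g : ℝ → ℝ} {b : ℝ} (hb : 0 ≤ b) (hg : IntervalIntegrable g volume 0 b) (s : Finset ℕ) (a : ℕ → ℝ)
    (ha : ∀ r ∈ s, 0 < a r ∧ a r ≤ b) :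
    ∑ r ∈ s, ∫ w in (a r)..b, g w = ∫ w in (0:ℝ)..b, ((s.filter (fun r => a r ≤ w)).card : ℝ) * g w := by
  rw [intervalIntegrable_iff_integrableOn_Ioc_of_le hb] at hg
  have h1 : ∀ r ∈ s, ∫ w in (a r)..b, g w = ∫ w in Set.Ioc 0 b, (Set.Ici (a r)).indicator g w := by
    intro r hr
    rw [setIntegral_indicator measurableSet_Ici, intervalIntegral.integral_of_le (ha r hr).2, ← integral_Icc_eq_integral_Ioc]
    congr 2
    ext x
    simp only [Set.mem_Icc, Set.mem_inter_iff, Set.mem_Ioc, Set.mem_Ici]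
    constructor
    · rintro ⟨h, h'⟩; exact ⟨⟨by linarith [(ha r hr).1], h'⟩, h⟩
    · rintro ⟨⟨_, h'⟩, h⟩; exact ⟨h, h'⟩
  rw [Finset.sum_congr rfl h1, ← integral_finsetSum]
  · rw [intervalIntegral.integral_of_le hb]
    congr 1
    funext w
    simp only [Set.indicator_apply, Set.mem_Ici]
    rw [← Finset.sum_filter, Finset.sum_const, nsmul_eq_mul]
  · intro r _
    exact hg.indicator measurableSet_Ici

theorem layer_upper {g : ℝ → ℝ} {b : ℝ} (hb : 0 ≤ b) (hg : IntervalIntegrable g volume 0 b) (s : Finset ℕ) (a : ℕ → ℝ)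
    (ha : ∀ r ∈ s, 0 ≤ a r) :
    ∑ r ∈ s, ∫ w in (0:ℝ)..min b (a r), g w = ∫ w in (0:ℝ)..b, ((s.filter (fun r => w ≤ a r)).card : ℝ) * g w := by
  rw [intervalIntegrable_iff_integrableOn_Ioc_of_le hb] at hg
  have h1 : ∀ r ∈ s, ∫ w in (0:ℝ)..min b (a r), g w = ∫ w in Set.Ioc 0 b, (Set.Iic (a r)).indicator g w := by
    intro r hr
    rw [setIntegral_indicator measurableSet_Iic, intervalIntegral.integral_of_le (le_min hb (ha r hr))]
    congr 2
    ext x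
    simp only [Set.mem_inter_iff, Set.mem_Ioc, Set.mem_Iic, le_min_iff]
    tauto
  rw [Finset.sum_congr rfl h1, ← integral_finsetSum]
  · rw [intervalIntegral.integral_of_le hb]
    congr 1
    funext w
    simp only [Set.indicator_apply, Set.mem_Iic]
    rw [← Finset.sum_filter, Finset.sum_const, nsmul_eq_mul]
  · intro r _
    exact hg.indicator measurableSet_Iic

theorem far_sub {T z : ℝ} (hz : 1 ≤ z) : ∫ s in (1:ℝ)..z, Gf T s = ∫ w in (0:ℝ)..log z, Pw T w := by
  have h1 : ∫ s in (1:ℝ)..z, Gf T s = ∫ s in (1:ℝ)..z, Gs T s := by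
    apply intervalIntegral.integral_congr_ae
    refine Filter.Eventually.of_forall fun s hs => ?_
    rw [Set.uIoc_of_le hz] at hs
    exact Gf_eq hs.1
  have h2 := intervalIntegral.integral_comp_mul_deriv'' (a := 0) (b := log z) (f := exp) (f' := exp) (g := Gs T)
    (by fun_prop) (fun x _ => (hasDerivAt_exp x).hasDerivWithinAt) (by fun_prop)
    ((Gs_cont T).mono (by rintro _ ⟨x, _, rfl⟩; exact exp_pos x))
  rw [exp_zero, exp_log (by linarith)] at h2
  rw [h1, ← h2]
  apply intervalIntegral.integral_congr
  intro w _
  simp only [Function.comp, Gs, Pw, log_exp]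
  have : exp (-(1/2)*w) * exp w = exp (w/2) := by rw [← exp_add]; congr 1; ring
  rw [← this]; ring

theorem near_sub {T Y Z : ℝ} (hT : 1 ≤ T) (hY : 0 < Y) (hZ : Y ≤ Z) : ∫ t in Y..Z, nA t * sin (T*nl t) =
    - ∫ w in (log (1+Z) - log Z)..(log (1+Y) - log Y), Pw T w/(exp w - 1) := by
  have pos : ∀ x ∈ Set.uIcc Y Z, 0 < x := by
    intro x hx; rw [Set.uIcc_of_le hZ] at hx; linarith [hx.1]
  have Lpos : ∀ x, 0 < x → 0 < log (1+x) - log x := by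
    intro x hx
    have := nL_lower hx
    have : 0 < 2/(2*x+1) := by positivity
    linarith
  have hd : ∀ x ∈ Set.uIcc Y Z, HasDerivAt (fun y => log (1+y) - log y) (1/(1+x) - x⁻¹) x := by
    intro x hx
    have := pos x hx
    exact (((hasDerivAt_id x).const_add 1).log (by simp; linarith)).sub (hasDerivAt_log this.ne')
  have hgc : ContinuousOn (fun w => Pw T w/(exp w - 1)) (Set.Ioi 0) := by
    apply ContinuousOn.div (Pw_cont T).continuousOn (by fun_prop)
    intro x hx
    rw [Set.mem_Ioi] at hx
    linarith [add_one_le_exp x]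
  have h := intervalIntegral.integral_comp_mul_deriv' (a := Y) (b := Z) (f := fun y => log (1+y) - log y)
    (f' := fun x => 1/(1+x) - x⁻¹) (g := fun w => Pw T w/(exp w - 1)) hd
    (by
      apply ContinuousOn.sub
      · exact ContinuousOn.div (by fun_prop) (by fun_prop) (fun x hx => by linarith [pos x hx])
      · exact ContinuousOn.inv₀ (by fun_prop) (fun x hx => (pos x hx).ne'))
    (hgc.mono (by rintro _ ⟨x, hx, rfl⟩; exact Lpos x (pos x hx)))
  rw [← intervalIntegral.integral_symm, ← h]
  apply intervalIntegral.integral_congr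
  intro y hy
  have y0 := pos y hy
  have hL := Lpos y y0
  simp only [Function.comp]
  rw [Pw_pos hT hL]
  have e1 : exp (log (1+y) - log y) = (1+y)/y := by rw [exp_sub, exp_log (by linarith), exp_log y0]
  have e2 : nl y = -(log (1+y) - log y) := by unfold nl; ring
  rw [e1, e2, mul_neg, sin_neg]
  unfold nA
  set L := log (1+y) - log y with hLd
  have e3 : exp (-(1/2)*(log y + log (1+y))) = exp (L/2) * (1/(1+y)) := by
    have : exp (-(1/2)*(log y + log (1+y))) = exp (L/2) * exp (-log (1+y)) := by
      rw [← exp_add]; congr 1; rw [hLd]; ring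
    rw [this, exp_neg, exp_log (by linarith)]; simp
  rw [e3]
  have e4 : (1+y)/y - 1 = 1/y := by field_simp; ring
  rw [e4]
  field_simp
  ring

end Atk

namespace Atk

theorem near_each {T Y : ℝ} (hT : 1 ≤ T) (hY : 0 < Y) {M r : ℕ} (hr : 1 ≤ r) (hrM : (r:ℝ) ≤ M/(1+Y)) :
    -(∫ t in Y..((M-r:ℕ)/r:ℝ), nA t * sin (T*nl t)) =
      (∫ w in (-log (1 - r/M))..(log (1+Y) - log Y), Qw T w) + T*(log (M/(1+Y)) - log r) ∧
    0 < -log (1 - r/M) ∧ -log (1 - r/M) ≤ log (1+Y) - log Y ∧ (r:ℝ) < M := by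
  have r0 : (0:ℝ) < r := by exact_mod_cast hr
  rw [le_div_iff₀ (by linarith)] at hrM
  have hlt : (r:ℝ) < M := by nlinarith
  have hle : r ≤ M := by exact_mod_cast hlt.le
  have M0 : (0:ℝ) < M := by linarith
  have hc : ((M-r:ℕ):ℝ) = M - r := by push_cast [hle]; ring
  rw [hc]
  have hYZ : Y ≤ (M - r:ℝ)/r := by rw [le_div_iff₀ r0]; nlinarith
  have Z0 : 0 < (M - r:ℝ)/r := by linarith
  have hx0 : 0 < 1 - (r:ℝ)/M := by
    rw [sub_pos, div_lt_one M0]; exact hlt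
  have hx1 : 1 - (r:ℝ)/M < 1 := by
    have : 0 < (r:ℝ)/M := by positivity
    linarith
  have ew : log (1+(M - r:ℝ)/r) - log ((M - r:ℝ)/r) = -log (1 - r/M) := by
    have e1 : 1+(M - r:ℝ)/r = M/r := by field_simp; ring
    have e2 : 1 - (r:ℝ)/M = (M-r)/M := by field_simp
    rw [e1, e2, log_div M0.ne' r0.ne', log_div (by linarith) r0.ne', log_div (by linarith) M0.ne']
    ring
  rw [near_sub hT hY hYZ, ew, neg_neg]
  set a := -log (1 - (r:ℝ)/M) with ha
  set b := log (1+Y) - log Y with hb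
  have a0 : 0 < a := by
    have := log_neg hx0 hx1
    linarith
  have eb : exp (-b) = Y/(1+Y) := by
    rw [hb, neg_sub, exp_sub, exp_log hY, exp_log (by linarith)]
  have ea : exp (-a) = 1 - r/M := by
    rw [ha, neg_neg, exp_log hx0]
  have hab : a ≤ b := by
    rw [← neg_le_neg_iff, ← exp_le_exp, ea, eb]
    rw [div_le_iff₀ (by linarith)]
    have : (r:ℝ)/M*(1+Y) ≤ 1 := by
      rw [div_mul_eq_mul_div, div_le_one M0]; exact hrM
    linarith
  refine ⟨?_, a0, hab, hlt⟩
  have pos : ∀ x ∈ Set.uIcc a b, 0 < x := by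
    intro x hx; rw [Set.uIcc_of_le hab] at hx; linarith [hx.1]
  have epos : ∀ x ∈ Set.uIcc a b, 0 < exp x - 1 := by
    intro x hx; linarith [add_one_le_exp x, pos x hx]
  have iQ2 : IntervalIntegrable (Qw T) volume a b :=
    (Qw_int hT a0.le).symm.trans (Qw_int hT (a0.le.trans hab))
  have i3 : IntervalIntegrable (fun w => T/(exp w - 1)) volume a b :=
    ContinuousOn.intervalIntegrable (ContinuousOn.div (by fun_prop) (by fun_prop) (fun x hx => (epos x hx).ne'))
  have vpos : ∀ x ∈ Set.uIcc a b, 0 < 1 - exp (-x) := by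
    intro x hx
    have : exp (-x) < 1 := by rw [exp_lt_one_iff]; linarith [pos x hx]
    linarith
  have s4 : ∫ w in a..b, T/(exp w - 1) = T * log (1 - exp (-b)) - T * log (1 - exp (-a)) := by
    rw [intervalIntegral.integral_eq_sub_of_hasDerivAt (f := fun w => T * log (1 - exp (-w)))]
    · intro x hx
      have h1 : HasDerivAt (fun w => 1 - exp (-w)) (exp (-x)) x :=
        (((hasDerivAt_neg x).exp).const_sub 1).congr_deriv (by simp)
      refine ((h1.log (vpos x hx).ne').const_mul T).congr_deriv ?_
      have := epos x hx
      have := vpos x hx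
      have e : exp (-x) = 1/exp x := by rw [exp_neg]; simp
      rw [e]
      rw [e] at this
      field_simp
    · exact i3
  have s2 : ∫ w in a..b, Pw T w/(exp w - 1) = (∫ w in a..b, Qw T w) + ∫ w in a..b, T/(exp w - 1) := by
    rw [← intervalIntegral.integral_add iQ2 i3]
    apply intervalIntegral.integral_congr
    intro w _; simp only [Qw]; ring
  rw [s2, s4, eb, ea]
  have e1 : 1 - Y/(1+Y) = 1/(1+Y) := by field_simp; ring
  have e2 : 1 - (1 - (r:ℝ)/M) = r/M := by ring
  rw [e1, e2, log_div one_ne_zero (by linarith), log_div r0.ne' M0.ne', log_div M0.ne' (by linarith), log_one]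
  ring

theorem floor_psi {x : ℝ} (hx : 0 ≤ x) : ((⌊x⌋₊:ℕ):ℝ) = x - 1/2 - psi x := by
  unfold psi
  have h1 := natCast_floor_eq_intCast_floor (R := ℝ) hx
  have h2 := Int.self_sub_floor x
  rw [h1]
  linarith

/-- sum over near part -/
theorem near_layer {T Y : ℝ} (hT : 1 ≤ T) (hY : 0 < Y) {M : ℕ} :
    -(∑ r ∈ Finset.Icc 1 ⌊M/(1+Y)⌋₊, ∫ t in Y..((M-r:ℕ)/r:ℝ), nA t * sin (T*nl t)) =
      (∫ w in (0:ℝ)..(log (1+Y) - log Y), ((⌊M*(1 - exp (-w))⌋₊:ℕ):ℝ) * Qw T w) +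
      T * ∑ r ∈ Finset.Icc 1 ⌊M/(1+Y)⌋₊, (log (M/(1+Y)) - log r) := by
  set b := log (1+Y) - log Y with hb
  set R := ⌊M/(1+Y)⌋₊ with hR
  have b0 : 0 < b := by
    have := nL_lower hY
    have : 0 < 2/(2*Y+1) := by positivity
    linarith
  have eb : exp (-b) = Y/(1+Y) := by
    rw [hb, neg_sub, exp_sub, exp_log hY, exp_log (by linarith)]
  have hle : ∀ r ∈ Finset.Icc 1 R, (1 ≤ r ∧ (r:ℝ) ≤ M/(1+Y)) := by
    intro r hr
    rw [Finset.mem_Icc] at hr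
    exact ⟨hr.1, (Nat.le_floor_iff (by positivity)).1 hr.2⟩
  have key := layer_lower b0.le (Qw_int hT b0.le) (Finset.Icc 1 R) (fun r : ℕ => -log (1 - r/M))
    (fun r hr => by
      obtain ⟨h1, h2⟩ := hle r hr
      have := near_each hT hY h1 h2
      exact ⟨this.2.1, this.2.2.1⟩)
  rw [← Finset.sum_neg_distrib, Finset.mul_sum]
  rw [Finset.sum_congr rfl (fun r hr => (near_each hT hY (hle r hr).1 (hle r hr).2).1)]
  rw [Finset.sum_add_distrib, key]
  congr 1
  apply intervalIntegral.integral_congr_ae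
  refine Filter.Eventually.of_forall fun w hw => ?_
  rw [Set.uIoc_of_le b0.le] at hw
  congr 2
  have hE0 : exp (-w) < 1 := by rw [exp_lt_one_iff]; linarith [hw.1]
  have hE1 : Y/(1+Y) ≤ exp (-w) := by rw [← eb, exp_le_exp]; linarith [hw.2]
  have : (Finset.Icc 1 R).filter (fun r : ℕ => -log (1 - (r:ℝ)/M) ≤ w) = Finset.Icc 1 ⌊M*(1 - exp (-w))⌋₊ := by
    ext r
    simp only [Finset.mem_filter, Finset.mem_Icc]
    constructor
    · rintro ⟨hr, h⟩
      refine ⟨hr.1, Nat.le_floor ?_⟩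
      obtain ⟨h1, h2⟩ := hle r (Finset.mem_Icc.2 hr)
      obtain ⟨-, -, -, hlt⟩ := near_each hT hY h1 h2
      have r0 : (0:ℝ) < r := by exact_mod_cast h1
      have M0 : (0:ℝ) < M := by linarith
      have hx0 : 0 < 1 - (r:ℝ)/M := by
        rw [sub_pos, div_lt_one M0]; exact hlt
      have : exp (-w) ≤ 1 - r/M := by
        rw [← le_log_iff_exp_le hx0]; linarith
      have h3 : (r:ℝ)/M ≤ 1 - exp (-w) := by linarith
      rw [div_le_iff₀ M0] at h3
      linarith
    · rintro ⟨h1, h2⟩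
      have r0 : (0:ℝ) < r := by exact_mod_cast h1
      have h3 : (r:ℝ) ≤ M*(1 - exp (-w)) := (Nat.le_floor_iff (mul_nonneg (by positivity) (by linarith))).1 h2
      have M0 : (0:ℝ) < M := by
        by_contra hM
        have : (M:ℝ) = 0 := le_antisymm (not_lt.1 hM) (by positivity)
        rw [this] at h3; linarith
      have h4 : (r:ℝ) ≤ M/(1+Y) := by
        refine h3.trans ?_
        have : 1/(1+Y) = 1 - Y/(1+Y) := by field_simp; ring
        rw [div_eq_mul_one_div, this]
        apply mul_le_mul_of_nonneg_left _ M0.le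
        linarith
      refine ⟨⟨h1, Nat.le_floor h4⟩, ?_⟩
      obtain ⟨-, -, -, hlt⟩ := near_each hT hY h1 h4
      have hx0 : 0 < 1 - (r:ℝ)/M := by
        rw [sub_pos, div_lt_one M0]; exact hlt
      have h5 : exp (-w) ≤ 1 - r/M := by
        have : (r:ℝ)/M ≤ 1 - exp (-w) := by rw [div_le_iff₀ M0]; linarith
        linarith
      rw [← le_log_iff_exp_le hx0] at h5
      linarith
  rw [this]; simp

theorem far_layer {T Y : ℝ} (hY : 0 < Y) {M : ℕ} :
    ∑ m ∈ Finset.Icc 1 M, ∫ s in (1:ℝ)..min (1+1/Y) (M/m:ℝ), Gf T s =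
      ∫ w in (0:ℝ)..(log (1+Y) - log Y), ((⌊M*exp (-w)⌋₊:ℕ):ℝ) * Pw T w := by
  set b := log (1+Y) - log Y with hb
  have b0 : 0 < b := by
    have := nL_lower hY
    have : 0 < 2/(2*Y+1) := by positivity
    linarith
  have hcb : log (1+1/Y) = b := by
    have : 1+1/Y = (1+Y)/Y := by field_simp; ring
    rw [this, log_div (by linarith) hY.ne']
  have h1 : ∀ m ∈ Finset.Icc 1 M, (0:ℝ) < m ∧ (1:ℝ) ≤ M/m := by
    intro m hm
    rw [Finset.mem_Icc] at hm
    have m0 : (0:ℝ) < m := by exact_mod_cast hm.1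
    refine ⟨m0, ?_⟩
    rw [le_div_iff₀ m0, one_mul]; exact_mod_cast hm.2
  have key := layer_upper b0.le ((Pw_cont T).intervalIntegrable 0 b) (Finset.Icc 1 M) (fun m : ℕ => log ((M:ℝ)/m))
    (fun m hm => log_nonneg (h1 m hm).2)
  have hs : ∀ m ∈ Finset.Icc 1 M, ∫ s in (1:ℝ)..min (1+1/Y) (M/m:ℝ), Gf T s = ∫ w in (0:ℝ)..min b (log ((M:ℝ)/m)), Pw T w := by
    intro m hm
    have hc1 : 1 ≤ 1 + 1/Y := by
      have : 0 < 1/Y := by positivity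
      linarith
    have hm1 := (h1 m hm).2
    rw [far_sub (le_min hc1 hm1)]
    congr 1
    rcases le_total (1+1/Y) (M/m:ℝ) with h | h
    · rw [min_eq_left h, min_eq_left, hcb]
      rw [← hcb]; exact log_le_log (by linarith) h
    · rw [min_eq_right h, min_eq_right]
      rw [← hcb]; exact log_le_log (by linarith) h
  rw [Finset.sum_congr rfl hs, key]
  apply intervalIntegral.integral_congr_ae
  refine Filter.Eventually.of_forall fun w hw => ?_
  rw [Set.uIoc_of_le b0.le] at hw
  congr 2
  have hE0 : exp (-w) < 1 := by rw [exp_lt_one_iff]; linarith [hw.1]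
  have : (Finset.Icc 1 M).filter (fun m : ℕ => w ≤ log ((M:ℝ)/m)) = Finset.Icc 1 ⌊M*exp (-w)⌋₊ := by
    ext m
    simp only [Finset.mem_filter, Finset.mem_Icc]
    have hMe : (M:ℝ)*exp (-w) ≤ M := by nlinarith [(Nat.cast_nonneg M : (0:ℝ) ≤ M)]
    have eqv : 1 ≤ m → m ≤ M → (w ≤ log ((M:ℝ)/m) ↔ (m:ℝ) ≤ M*exp (-w)) := by
      intro a1 a2
      obtain ⟨m0, h2⟩ := h1 m (Finset.mem_Icc.2 ⟨a1, a2⟩)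
      rw [le_log_iff_exp_le (by linarith), le_div_iff₀ m0, exp_neg, ← div_eq_mul_inv, le_div_iff₀ (exp_pos _), mul_comm]
    constructor
    · rintro ⟨⟨a1, a2⟩, h⟩
      exact ⟨a1, Nat.le_floor ((eqv a1 a2).1 h)⟩
    · rintro ⟨a1, h2⟩
      have h3 := (Nat.le_floor_iff (by positivity)).1 h2
      have a2 : m ≤ M := by
        have : (m:ℝ) ≤ M := h3.trans hMe
        exact_mod_cast this
      exact ⟨⟨a1, a2⟩, (eqv a1 a2).2 h3⟩
  rw [this]; simp

end Atk

namespace Atk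

theorem psi_Q {T b : ℝ} (hT : 1 ≤ T) (hTb : 1 ≤ T*b) {M : ℕ} (hM : T^10 ≤ M) :
    IntervalIntegrable (fun w => psi (M*(1 - exp (-w))) * Qw T w) volume 0 b ∧
    |∫ w in (0:ℝ)..b, psi (M*(1 - exp (-w))) * Qw T w| ≤ 3/2 * exp b + 9*(1+b)*exp (3*b) := by
  have T0 : 0 < T := by linarith
  have b0 : 0 < b := by
    by_contra h; push Not at h; nlinarith
  set δ := 1/T^3 with hδ
  have T3 : T ≤ T^3 := by nlinarith [mul_nonneg T0.le T0.le]
  have δ0 : 0 < δ := by positivity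
  have δ1 : δ ≤ 1 := by rw [hδ, div_le_one (by positivity)]; linarith
  have δb : δ ≤ b := by
    rw [hδ, div_le_iff₀ (by positivity)]
    nlinarith
  have T10 : 0 < T^10 := by positivity
  have M0 : (0:ℝ) < M := by linarith
  have M1 : 1 ≤ M := by exact_mod_cast M0
  have meas : Measurable (fun w => psi (M*(1 - exp (-w))) * Qw T w) :=
    (psi_meas.comp (by fun_prop)).mul (Qw_meas T)
  have bd : ∀ w, 0 < w → w ≤ b → |psi (M*(1 - exp (-w))) * Qw T w| ≤ 3/2*exp b*T^2 := by
    intro w hw hwb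
    rw [abs_mul]
    have h1 := psi_abs (M*(1 - exp (-w)))
    have h2 := Qw_abs hT hw hwb
    have h3 : exp (b/2) ≤ exp b := by rw [exp_le_exp]; linarith
    calc _ ≤ 1/2 * (3*exp (b/2)*T^2) := mul_le_mul h1 h2 (abs_nonneg _) (by norm_num)
      _ ≤ 1/2 * (3*exp b*T^2) := by gcongr
      _ = _ := by ring
  have i0 := bdd_int b0.le meas bd
  have i1 := bdd_int δ0.le meas (fun w h1 h2 => bd w h1 (h2.trans δb))
  refine ⟨i0, ?_⟩
  rw [← intervalIntegral.integral_add_adjacent_intervals i1 (i1.symm.trans i0)]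
  have a1 : |∫ w in (0:ℝ)..δ, psi (M*(1 - exp (-w))) * Qw T w| ≤ 3/2 * exp b := by
    have : ∀ w ∈ Set.uIoc 0 δ, ‖psi (M*(1 - exp (-w))) * Qw T w‖ ≤ 3/2 * exp b * T^2 := by
      intro w hw
      rw [Set.uIoc_of_le δ0.le] at hw
      exact bd w hw.1 (hw.2.trans δb)
    refine (intervalIntegral.norm_integral_le_of_norm_le_const this).trans ?_
    rw [sub_zero, abs_of_pos δ0, hδ]
    have : 3/2*exp b*T^2*(1/T^3) = 3/2*exp b*(1/T) := by field_simp
    rw [this]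
    have : 1/T ≤ 1 := by rw [div_le_one T0]; exact hT
    nlinarith [exp_pos b]
  have a2 : 9*(1+b)*exp (3*b)*T/(δ^3*M) ≤ 9*(1+b)*exp (3*b) := by
    have : 9*(1+b)*exp (3*b)*T/(δ^3*M) = 9*(1+b)*exp (3*b)*(T^10/M) := by
      rw [hδ]; field_simp
    rw [this]
    apply mul_le_of_le_one_right (by positivity)
    rw [div_le_one M0]; exact hM
  have a3 := psi_term hT δ0 δ1 δb M1
  exact (abs_add_le _ _).trans (add_le_add a1 (a3.trans a2))

theorem near_count {T b : ℝ} (hT : 1 ≤ T) (hTb : 1 ≤ T*b) {M : ℕ} (hM : T^10 ≤ M) :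
    ∫ w in (0:ℝ)..b, ((⌊M*(1 - exp (-w))⌋₊:ℕ):ℝ) * Qw T w =
      (M * ∫ w in (0:ℝ)..b, exp (-w) * Pw T w) - M*T*(1 - exp (-b)) - (1/2) * (∫ w in (0:ℝ)..b, Qw T w)
        - ∫ w in (0:ℝ)..b, psi (M*(1 - exp (-w))) * Qw T w := by
  have T0 : 0 < T := by linarith
  have b0 : 0 < b := by
    by_contra h; push Not at h; nlinarith
  have i1 : IntervalIntegrable (fun w => (M:ℝ)*(exp (-w) * Pw T w)) volume 0 b := by
    apply Continuous.intervalIntegrable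
    have := Pw_cont T
    fun_prop
  have i2 : IntervalIntegrable (fun w => (M:ℝ)*T*exp (-w)) volume 0 b := by
    apply Continuous.intervalIntegrable
    fun_prop
  have i3 : IntervalIntegrable (fun w => (1/2)*Qw T w) volume 0 b := (Qw_int hT b0.le).const_mul _
  obtain ⟨i4, -⟩ := psi_Q hT hTb hM
  have e2 : ∫ w in (0:ℝ)..b, (M:ℝ)*T*exp (-w) = M*T*(1 - exp (-b)) := by
    rw [intervalIntegral.integral_const_mul]
    congr 1
    rw [intervalIntegral.integral_eq_sub_of_hasDerivAt (f := fun w => -exp (-w))]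
    · simp; ring
    · intro x _
      exact (((hasDerivAt_neg x).exp).neg).congr_deriv (by simp)
    · apply Continuous.intervalIntegrable; fun_prop
  rw [← e2, ← intervalIntegral.integral_const_mul, ← intervalIntegral.integral_const_mul,
    ← intervalIntegral.integral_sub i1 i2, ← intervalIntegral.integral_sub (i1.sub i2) i3,
    ← intervalIntegral.integral_sub ((i1.sub i2).sub i3) i4]
  apply intervalIntegral.integral_congr_ae
  refine Filter.Eventually.of_forall fun w hw => ?_
  rw [Set.uIoc_of_le b0.le] at hw
  have hE0 : exp (-w) < 1 := by rw [exp_lt_one_iff]; linarith [hw.1]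
  have hf := floor_psi (x := M*(1 - exp (-w))) (mul_nonneg (by positivity) (by linarith))
  rw [hf]
  have hQ : (1 - exp (-w)) * Qw T w = exp (-w) * (Pw T w - T) := by
    unfold Qw
    have : 0 < exp w - 1 := by linarith [add_one_le_exp w, hw.1]
    rw [exp_neg]
    field_simp
  linear_combination (M:ℝ) * hQ

theorem far_count {T b : ℝ} (hT : 1 ≤ T) (hTb : 1 ≤ T*b) {M : ℕ} :
    |(∫ w in (0:ℝ)..b, ((⌊M*exp (-w)⌋₊:ℕ):ℝ) * Pw T w) - M * ∫ w in (0:ℝ)..b, exp (-w) * Pw T w| ≤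
      exp (b/2)*(1+log (T*b)) := by
  have T0 : 0 < T := by linarith
  have b0 : 0 < b := by
    by_contra h; push Not at h; nlinarith
  have hPc := Pw_cont T
  have i1 : IntervalIntegrable (fun w => (M:ℝ)*(exp (-w) * Pw T w)) volume 0 b := by
    apply Continuous.intervalIntegrable
    fun_prop
  have i0 : IntervalIntegrable (fun w => ((⌊M*exp (-w)⌋₊:ℕ):ℝ) * Pw T w) volume 0 b := by
    apply bdd_int (K := M * (exp (b/2)*T)) b0.le
    · apply Measurable.mul _ hPc.measurable
      exact (measurable_from_nat (f := fun n : ℕ => (n:ℝ))).comp (Nat.measurable_floor.comp (by fun_prop))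
    · intro w h1 h2
      rw [abs_mul]
      have hE0 : exp (-w) < 1 := by rw [exp_lt_one_iff]; linarith
      apply mul_le_mul _ (Pw_abs (by linarith) h2) (abs_nonneg _) (by positivity)
      rw [abs_of_nonneg (by positivity)]
      refine (Nat.floor_le (by positivity)).trans ?_
      nlinarith [(Nat.cast_nonneg M : (0:ℝ) ≤ M)]
  rw [← intervalIntegral.integral_const_mul, ← intervalIntegral.integral_sub i0 i1, ← Real.norm_eq_abs]
  refine le_trans ?_ (Pw_L1 hT hTb)
  apply intervalIntegral.norm_integral_le_of_norm_le b0.le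
  · refine Filter.Eventually.of_forall fun w hw => ?_
    rw [← mul_assoc, ← sub_mul, norm_mul, Real.norm_eq_abs, Real.norm_eq_abs]
    apply mul_le_of_le_one_left (abs_nonneg _)
    have h1 := Nat.floor_le (a := (M:ℝ)*exp (-w)) (by positivity)
    have h2 := Nat.lt_floor_add_one ((M:ℝ)*exp (-w))
    rw [abs_le]; constructor <;> linarith
  · exact hPc.abs.intervalIntegrable _ _

theorem harm_gamma {M : ℕ} (hM : 1 ≤ M) : |∑ m ∈ Finset.Icc 1 M, 1/(m:ℝ) - (log M + eulerMascheroniConstant)| ≤ 1/M := by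
  have h1 := eulerMascheroniSeq_lt_eulerMascheroniConstant M
  have h2 := eulerMascheroniConstant_lt_eulerMascheroniSeq' M
  have M0 : (0:ℝ) < M := by exact_mod_cast hM
  have hH : ∑ m ∈ Finset.Icc 1 M, 1/(m:ℝ) = (harmonic M : ℝ) := by
    rw [harmonic_eq_sum_Icc]; push_cast; simp
  unfold eulerMascheroniSeq at h1
  unfold eulerMascheroniSeq' at h2
  rw [if_neg (by omega)] at h2
  have h3 : log (M+1) ≤ log M + 1/M := by
    have : (M:ℝ)+1 = M*(1+1/M) := by field_simp
    rw [this, log_mul M0.ne' (by positivity)]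
    have := log_le_sub_one_of_pos (show (0:ℝ) < 1+1/M by positivity)
    linarith
  rw [hH, abs_le]
  constructor <;> linarith

set_option maxHeartbeats 1000000 in
theorem main_term0 {T Y b : ℝ} (hT : 1 ≤ T) (hY : 0 < Y) (hb : b = log (1+Y) - log Y) (hTb : 1 ≤ T*b) (hTY : 1+Y ≤ T)
    {M : ℕ} (hM : T^10 ≤ M) :
    |T*∑ m ∈ Finset.Icc 1 M, 1/(m:ℝ) + 2*mainB T Y M - (T*log (T/(2*π)) + (2*eulerMascheroniConstant - 1)*T)| ≤
      6*exp b*(1+log (T*b)) + 7/b + 6*(1+Y) + 17 + 6*exp b + 18*(1+b)*exp (3*b) := by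
  have T0 : 0 < T := by linarith
  have b0 : 0 < b := by
    by_contra h; push Not at h; nlinarith
  have TT : T ≤ T^10 := by
    have := one_le_pow₀ (n := 9) hT
    calc T = T*1 := by ring
      _ ≤ T*T^9 := by gcongr
      _ = _ := by ring
  have TM : T ≤ M := TT.trans hM
  have M0 : (0:ℝ) < M := by linarith
  have M1 : 1 ≤ M := by exact_mod_cast M0
  have eb : exp (-b) = Y/(1+Y) := by
    rw [hb, neg_sub, exp_sub, exp_log hY, exp_log (by linarith)]
  have eV : 1 - exp (-b) = 1/(1+Y) := by rw [eb]; field_simp; ring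
  have hU : 1 ≤ (M:ℝ)/(1+Y) := by rw [le_div_iff₀ (by linarith)]; linarith
  have st := stir_sum hU
  have nl1 := near_layer (T := T) hT hY (M := M)
  have fl1 := far_layer (T := T) hY (M := M)
  rw [← hb] at nl1 fl1
  have nc := near_count hT hTb hM
  have fc := far_count hT hTb (M := M)
  obtain ⟨-, pq⟩ := psi_Q hT hTb hM
  have Qi := Q_integral hT hTb
  have hg := harm_gamma M1
  have hmain : mainB T Y M = (∫ w in (0:ℝ)..b, ((⌊M*(1 - exp (-w))⌋₊:ℕ):ℝ) * Qw T w) +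
      T * (∑ r ∈ Finset.Icc 1 ⌊M/(1+Y)⌋₊, (log (M/(1+Y)) - log r)) -
      ∫ w in (0:ℝ)..b, ((⌊M*exp (-w)⌋₊:ℕ):ℝ) * Pw T w := by
    unfold mainB
    rw [nl1, fl1]
  rw [hmain, nc]
  rw [eV] at Qi ⊢
  rw [log_div one_ne_zero (by linarith), log_one] at Qi
  have lU : log ((M:ℝ)/(1+Y)) = log M - log (1+Y) := log_div M0.ne' (by linarith)
  have lT : log (T/(2*π)) = log T - log (2*π) := log_div T0.ne' (by positivity)
  rw [lT]
  set S := ∑ r ∈ Finset.Icc 1 ⌊M/(1+Y)⌋₊, (log (M/(1+Y)) - log r)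
  rw [lU] at st
  set H := ∑ m ∈ Finset.Icc 1 M, 1/(m:ℝ)
  set P := ∫ w in (0:ℝ)..b, exp (-w) * Pw T w
  set F := ∫ w in (0:ℝ)..b, ((⌊M*exp (-w)⌋₊:ℕ):ℝ) * Pw T w
  set Q := ∫ w in (0:ℝ)..b, Qw T w
  set Ps := ∫ w in (0:ℝ)..b, psi (M*(1 - exp (-w))) * Qw T w
  have st' : |T*(S - (M/(1+Y) - (log M - log (1+Y))/2 - log (2*π)/2))| ≤ 3*(1+Y) := by
    rw [abs_mul, abs_of_pos T0]
    calc _ ≤ T*(3/(M/(1+Y))) := mul_le_mul_of_nonneg_left st T0.le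
      _ = 3*(1+Y)*(T/M) := by field_simp
      _ ≤ _ := by
        apply mul_le_of_le_one_right (by positivity)
        rw [div_le_one M0]; exact TM
  have hg' : |T*(H - (log M + eulerMascheroniConstant))| ≤ 1 := by
    rw [abs_mul, abs_of_pos T0]
    calc _ ≤ T*(1/M) := mul_le_mul_of_nonneg_left hg T0.le
      _ = T/M := by ring
      _ ≤ 1 := by rw [div_le_one M0]; exact TM
  have fc' : |F - M*P| ≤ exp b*(1+log (T*b)) := by
    refine fc.trans ?_
    have : exp (b/2) ≤ exp b := by rw [exp_le_exp]; linarith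
    apply mul_le_mul_of_nonneg_right this
    linarith [log_nonneg hTb]
  have eb1 : 0 < exp b := exp_pos b
  have el : 0 ≤ exp b * log (T*b) := mul_nonneg eb1.le (log_nonneg hTb)
  have eM : (M:ℝ)*T*(1/(1+Y)) = T*(M/(1+Y)) := by ring
  rw [eM]
  set U := (M:ℝ)/(1+Y)
  rw [abs_le] at *
  obtain ⟨x1, x2⟩ := st'
  obtain ⟨y1, y2⟩ := hg'
  obtain ⟨z1, z2⟩ := fc'
  obtain ⟨u1, u2⟩ := pq
  obtain ⟨v1, v2⟩ := Qi
  constructor <;> linarith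

theorem main_term {Y1 Y2 : ℝ} (hY1 : 0 < Y1) (hY : Y1 ≤ Y2) : ∃ C : ℝ, ∃ T0 : ℝ, ∀ T : ℝ, T0 ≤ T → ∀ Y, Y1 ≤ Y → Y ≤ Y2 →
    ∀ M : ℕ, T^10 ≤ M →
    |T*∑ m ∈ Finset.Icc 1 M, 1/(m:ℝ) + 2*mainB T Y M - (T*log (T/(2*π)) + (2*eulerMascheroniConstant - 1)*T)| ≤
      C * log T := by
  set B1 := log (1+Y2) - log Y2 with hB1
  set B2 := log (1+Y1) - log Y1 with hB2
  have hanti : ∀ x y : ℝ, 0 < x → x ≤ y → log (1+y) - log y ≤ log (1+x) - log x := by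
    intro x y hx hxy
    have hy : 0 < y := by linarith
    rw [← log_div (by linarith) hy.ne', ← log_div (by linarith) hx.ne']
    apply log_le_log (by positivity)
    rw [div_le_div_iff₀ hy hx]
    linarith
  have Y20 : 0 < Y2 := by linarith
  have B10 : 0 < B1 := by
    have := nL_lower Y20
    have : 0 < 2/(2*Y2+1) := by positivity
    linarith
  refine ⟨6*exp B2*(2+B2) + 7/B1 + 6*(1+Y2) + 17 + 6*exp B2 + 18*(1+B2)*exp (3*B2), max (max (exp 1) (1+Y2)) (1/B1), ?_⟩
  intro T hT Y h1 h2 M hM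
  rw [max_le_iff, max_le_iff] at hT
  obtain ⟨⟨t1, t2⟩, t3⟩ := hT
  have e1 := add_one_le_exp (1:ℝ)
  have T1 : 1 ≤ T := by linarith
  have T0 : 0 < T := by linarith
  have lT : 1 ≤ log T := by rw [le_log_iff_exp_le T0]; exact t1
  have Y0 : 0 < Y := by linarith
  have hb1 := hanti Y Y2 Y0 h2
  have hb2 := hanti Y1 Y hY1 h1
  set b := log (1+Y) - log Y with hb
  rw [← hB1] at hb1
  rw [← hB2] at hb2
  have b0 : 0 < b := by linarith
  have hTb : 1 ≤ T*b := by
    rw [div_le_iff₀ B10] at t3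
    nlinarith
  refine (main_term0 T1 Y0 hb hTb (by linarith) hM).trans ?_
  have hl : log (T*b) ≤ log T + B2 := by
    rw [log_mul T0.ne' b0.ne']
    linarith [log_le_sub_one_of_pos b0]
  have B20 : 0 < B2 := by linarith
  have i1 : 6*exp b*(1+log (T*b)) ≤ 6*exp B2*(2+B2) * log T := by
    have : 1 + log (T*b) ≤ (2+B2)*log T := by nlinarith
    calc _ ≤ 6*exp B2*((2+B2)*log T) := by
          apply mul_le_mul _ this (by linarith [log_nonneg hTb]) (by positivity)
          gcongr
      _ = _ := by ring
  have i2 : 7/b + 6*(1+Y) + 17 + 6*exp b + 18*(1+b)*exp (3*b) ≤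
      7/B1 + 6*(1+Y2) + 17 + 6*exp B2 + 18*(1+B2)*exp (3*B2) := by
    gcongr
  have i3 : 0 ≤ 7/B1 + 6*(1+Y2) + 17 + 6*exp B2 + 18*(1+B2)*exp (3*B2) := by positivity
  nlinarith

end Atk

namespace Atk

theorem nA_bound {Y1 Y2 Y : ℝ} (hY1 : 0 < Y1) (h1 : Y1 ≤ Y) (h2 : Y ≤ Y2) :
    nA Y ≤ exp (-(1/2)*log Y1) * ((2*Y2+1)/2) ∧ 0 ≤ nA Y := by
  have Y0 : 0 < Y := by linarith
  have hl := nL_lower Y0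
  have hp : 0 < 2/(2*Y+1) := by positivity
  have hL : 0 < log (1+Y) - log Y := by linarith
  have l1 : log Y1 ≤ log Y := log_le_log hY1 h1
  have l2 : 0 ≤ log (1+Y) := log_nonneg (by linarith)
  constructor
  · unfold nA
    rw [div_eq_mul_inv]
    apply mul_le_mul
    · rw [exp_le_exp]; linarith
    · have : (log (1+Y) - log Y)⁻¹ ≤ (2/(2*Y+1))⁻¹ := by
        apply inv_anti₀ hp
        linarith
      refine this.trans ?_
      rw [inv_div]; linarith
    · positivity
    · positivity
  · unfold nA; positivity

theorem Y_facts {T N Y : ℝ} (hT : 0 < T) (hN : 0 < N) (hY : Y = -(1/2) + √(1/4 + T/(2*π*N))) :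
    0 < Y ∧ T*ng Y/(2*π) = N ∧
    T*(1+1/Y)⁻¹/(2*π) = T/(2*π) + N/2 - √(N^2/4 + N*T/(2*π)) := by
  have hx : 0 < T/(2*π*N) := by positivity
  set x := T/(2*π*N) with hxd
  set s := √(1/4 + x) with hs
  have s2 : s^2 = 1/4 + x := sq_sqrt (by linarith)
  have s0 : 0 ≤ s := sqrt_nonneg _
  have s1 : 1/2 < s := by nlinarith
  have Y0 : 0 < Y := by linarith
  have eT : T/(2*π) = x*N := by rw [hxd]; field_simp
  have eT' : T = x*N*(2*π) := by rw [← eT]; field_simp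
  have hYx : Y*(1+Y) = x := by rw [hY]; linear_combination s2
  have es : √(N^2/4 + N*T/(2*π)) = N*s := by
    rw [show N^2/4 + N*T/(2*π) = (N*s)^2 by
      rw [mul_pow, s2, mul_div_assoc, eT]; ring]
    exact sqrt_sq (by positivity)
  refine ⟨Y0, ?_, ?_⟩
  · unfold ng
    rw [hYx, eT']; field_simp
  · rw [es, eT]
    have e1 : T*(1+1/Y)⁻¹/(2*π) = (T/(2*π))*(Y/(1+Y)) := by
      have : 1+1/Y = (1+Y)/Y := by field_simp; ring
      rw [this, inv_div]; ring
    rw [e1, eT]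
    have e2 : x*N*(Y/(1+Y)) = N*Y^2 := by
      rw [← hYx]; field_simp
    rw [e2, hY]
    linear_combination N * s2

end Atk

set_option maxHeartbeats 1000000 in
theorem atkinson_formula (A A' : ℝ) (hA : 0 < A) (hAA' : A < A') :
    ∃ C : ℝ, 0 < C ∧ ∃ T₀ : ℝ, ∀ T : ℝ, T₀ ≤ T → ∀ N : ℝ, A * T < N → N < A' * T →
      |E T -
          Real.sqrt 2 * (T / (2 * Real.pi)) ^ ((1 : ℝ) / 4) *
            (∑ n ∈ Finset.Icc 1 ⌊N⌋₊,
              (-1 : ℝ) ^ n * (n.divisors.card : ℝ) * (n : ℝ) ^ (-(3 / 4 : ℝ)) * e T n *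
                Real.cos (f T n)) -
          (-2 * ∑ n ∈ Finset.Icc 1 ⌊(T / (2 * Real.pi) + N / 2 -
              Real.sqrt (N ^ 2 / 4 + N * T / (2 * Real.pi)))⌋₊,
            (n.divisors.card : ℝ) * (n : ℝ) ^ (-(1 / 2 : ℝ)) *
              (Real.log (T / (2 * Real.pi * n)))⁻¹ *
              Real.cos (T * Real.log (T / (2 * Real.pi * n)) - T + Real.pi / 4))| ≤
        C * Real.log T ^ 2 := by
  have hA' : 0 < A' := hA.trans hAA'
  obtain ⟨Y1, hY1⟩ : ∃ y, y = -(1/2) + √(1/4 + 1/(2*π*A')) := ⟨_, rfl⟩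
  obtain ⟨Y2, hY2⟩ : ∃ y, y = -(1/2) + √(1/4 + 1/(2*π*A)) := ⟨_, rfl⟩
  have Y10 : 0 < Y1 := (Atk.Y_facts one_pos hA' hY1).1
  have Y12 : Y1 ≤ Y2 := by
    rw [hY1, hY2]
    gcongr
  have Y20 : 0 < Y2 := by linarith
  have c10 : 1 < 1 + 1/Y2 := by
    have : 0 < 1/Y2 := by positivity
    linarith
  have c12 : 1 + 1/Y2 ≤ 1 + 1/Y1 := by gcongr
  obtain ⟨C1, T1, h1⟩ := Atk.near_final (K := 20) Y10 Y12 (by norm_num)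
  obtain ⟨C2, T2, h2⟩ := Atk.far_final (K := 20) c10 c12 (by norm_num)
  obtain ⟨C3, T3, h3⟩ := Atk.main_term Y10 Y12
  obtain ⟨B, hB⟩ : ∃ B, B = exp (-(1/2)*log Y1) * ((2*Y2+1)/2) := ⟨_, rfl⟩
  have B0 : 0 ≤ B := by rw [hB]; positivity
  refine ⟨2*|C1| + 2*|C2| + |C3| + 42*B + 576, by positivity, max (max T1 T2) (max T3 (exp 1)), ?_⟩
  intro T hT N hN1 hN2
  rw [max_le_iff, max_le_iff, max_le_iff] at hT
  obtain ⟨⟨t1, t2⟩, t3, t4⟩ := hT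
  have e1 := add_one_le_exp (1:ℝ)
  have T2' : 2 ≤ T := by linarith
  have T0 : 0 < T := by linarith
  have lT : 1 ≤ log T := by rw [le_log_iff_exp_le T0]; exact t4
  have N0 : 0 < N := lt_trans (by positivity) hN1
  obtain ⟨Y, hY⟩ : ∃ y, y = -(1/2) + √(1/4 + T/(2*π*N)) := ⟨_, rfl⟩
  obtain ⟨Y0, yN, yN'⟩ := Atk.Y_facts T0 N0 hY
  have hYl : Y1 ≤ Y := by
    rw [hY1, hY]
    have : 1/(2*π*A') ≤ T/(2*π*N) := by
      rw [div_le_div_iff₀ (by positivity) (by positivity)]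
      have := mul_le_mul_of_nonneg_left hN2.le (by positivity : 0 ≤ 2*π)
      linarith
    gcongr
  have hYu : Y ≤ Y2 := by
    rw [hY2, hY]
    have : T/(2*π*N) ≤ 1/(2*π*A) := by
      rw [div_le_div_iff₀ (by positivity) (by positivity)]
      have := mul_le_mul_of_nonneg_left hN1.le (by positivity : 0 ≤ 2*π)
      linarith
    gcongr
  obtain ⟨M, hM⟩ : ∃ M : ℕ, M = ⌈T⌉₊^10 := ⟨_, rfl⟩
  have cl := Nat.le_ceil T
  have cu := Nat.ceil_lt_add_one T0.le
  have M10 : T^10 ≤ M := by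
    rw [hM]; push_cast; gcongr
  have M6 : T^6 ≤ M := le_trans (pow_le_pow_right₀ (by linarith) (by norm_num)) M10
  have M2 : T^2 ≤ M := le_trans (pow_le_pow_right₀ (by linarith) (by norm_num)) M10
  have M0 : (0:ℝ) < M := lt_of_lt_of_le (by positivity) M2
  have M1 : 1 ≤ M := by exact_mod_cast M0
  have lM : log M ≤ 20 * log T := by
    rw [hM]; push_cast
    rw [log_pow]
    have : log (⌈T⌉₊:ℝ) ≤ log (T^2) := log_le_log (by linarith) (by nlinarith)
    rw [log_pow] at this
    push_cast at this ⊢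
    linarith
  have r1 := h1 T t1 Y hYl hYu M M2 lM
  have r2 := h2 T t2 (1+1/Y) (by gcongr) (by gcongr) M M2 lM
  have r3 := h3 T t3 Y hYl hYu M M10
  have r4 := Atk.split_final T Y0 M1
  have r5 := Atk.mean_sq_approx (by linarith) M6
  have r6 := Atk.mean_sq T0.le M1
  obtain ⟨r7, r7'⟩ := Atk.nA_bound Y10 hYl hYu
  rw [← hB] at r7
  rw [yN] at r1
  rw [yN'] at r2
  change |Atk.nearB T Y M + _| ≤ _ at r1
  change |Atk.farB T (1+1/Y) M + _| ≤ _ at r2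
  have s1 : Real.sqrt 2 * (T / (2 * Real.pi)) ^ ((1 : ℝ) / 4) *
            (∑ n ∈ Finset.Icc 1 ⌊N⌋₊,
              (-1 : ℝ) ^ n * (n.divisors.card : ℝ) * (n : ℝ) ^ (-(3 / 4 : ℝ)) * e T n *
                Real.cos (f T n)) = 2 * ∑ n ∈ Finset.Icc 1 ⌊N⌋₊, (n.divisors.card:ℝ)*Atk.mn T n := by
    rw [Finset.mul_sum, Finset.mul_sum]
    apply Finset.sum_congr rfl
    intro n hn
    rw [Finset.mem_Icc] at hn
    have := Atk.near_term T0 hn.1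
    linear_combination (-(n.divisors.card:ℝ)) * this
  have s2 : (∑ n ∈ Finset.Icc 1 ⌊(T / (2 * Real.pi) + N / 2 -
              Real.sqrt (N ^ 2 / 4 + N * T / (2 * Real.pi)))⌋₊,
            (n.divisors.card : ℝ) * (n : ℝ) ^ (-(1 / 2 : ℝ)) *
              (Real.log (T / (2 * Real.pi * n)))⁻¹ *
              Real.cos (T * Real.log (T / (2 * Real.pi * n)) - T + Real.pi / 4)) =
      ∑ n ∈ Finset.Icc 1 ⌊(T / (2 * Real.pi) + N / 2 -
              Real.sqrt (N ^ 2 / 4 + N * T / (2 * Real.pi)))⌋₊, (n.divisors.card:ℝ)*Atk.mf T n := by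
    apply Finset.sum_congr rfl
    intro n hn
    rw [Finset.mem_Icc] at hn
    rw [Atk.far_term T0 hn.1]
    ring
  rw [s1, s2]
  unfold E
  rw [r6] at r5
  set I := ∫ t in (0:ℝ)..T, ‖riemannZeta (1 / 2 + Complex.I * (t : ℂ))‖ ^ 2
  set S1 := ∑ n ∈ Finset.Icc 1 ⌊N⌋₊, (n.divisors.card:ℝ)*Atk.mn T n
  set S2 := ∑ n ∈ Finset.Icc 1 ⌊(T / (2 * Real.pi) + N / 2 -
              Real.sqrt (N ^ 2 / 4 + N * T / (2 * Real.pi)))⌋₊, (n.divisors.card:ℝ)*Atk.mf T n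
  set D := ∑ m∈Finset.Icc 1 M, (∑ k∈Finset.Ioc m M, (1/(m:ℝ))*Atk.Gf T (k/m) - ∫ s in (1:ℝ)..(M/m:ℝ), Atk.Gf T s)
  set H := ∑ m ∈ Finset.Icc 1 M, 1/(m:ℝ)
  have l2 : log T ≤ log T^2 := by nlinarith
  have l0 : 1 ≤ log T^2 := by nlinarith
  have L0 : 0 ≤ log T^2 := by linarith
  have q1 : C1*log T^2 ≤ |C1| * log T^2 := mul_le_mul_of_nonneg_right (le_abs_self _) L0
  have q2 : C2*log T^2 ≤ |C2| * log T^2 := mul_le_mul_of_nonneg_right (le_abs_self _) L0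
  have q3 : C3*log T ≤ |C3| * log T^2 :=
    (mul_le_mul_of_nonneg_right (le_abs_self _) (by linarith)).trans (mul_le_mul_of_nonneg_left l2 (abs_nonneg _))
  have q4 : Atk.nA Y*(1+log M) ≤ 21*B*log T^2 := by
    have : 1 + log M ≤ 21*log T^2 := by linarith
    calc _ ≤ B*(21*log T^2) := mul_le_mul r7 this (by
            have : 0 ≤ log (M:ℝ) := log_nonneg (by exact_mod_cast M1)
            linarith) B0
      _ = _ := by ring
  rw [abs_le] at *
  obtain ⟨x1, x2⟩ := r1
  obtain ⟨y1, y2⟩ := r2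
  obtain ⟨z1, z2⟩ := r3
  obtain ⟨u1, u2⟩ := r4
  obtain ⟨v1, v2⟩ := r5
  constructor <;> linarith
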